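/- Let p be a prime, q = p^m, r ≥ 2, and let k ≥ 1 with k < q^{2r-1}. Let f̄ ∈ F_{q^r}[x] have degree k̄ with 1 ≤ k̄ ≤ k, set d̄ = max(k̄, r), and suppose: one of (i) k̄ > r ≥ 3 and p ∤ k̄, (ii) k̄ = r ≥ 4, (iii) 0 < k̄ < r and r ≥ 3 holds; q > 2r·d̄²; and q^{r-1} − (d̄−1)(d̄−2)·q^{r−3/2} − 5·d̄^{13/3}·q^{r−2} > k. Then the codeword ev(y − f̄(x)) of C_{q,r,k} is minimal: for every b ∈ F_{q^r} and every g ∈ F_{q^r}[x] of degree at most k, if the support of ev(b·y − g(x)) is contained in the support of ev(y − f̄(x)), then ev(b·y − g(x)) is a scalar multiple of ev(y − f̄(x)). -/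

import Mathlib

section
open Polynomial

namespace NT

/-- The norm of `h` modulo the monic polynomial `P`, as a resultant. -/
noncomputable def Nm {R : Type*} [CommRing R] (P h : R[X]) : R := resultant P h

section norm
variable {R S : Type*} [CommRing R] [CommRing S] {P : R[X]}

lemma Nm_eq (hP : P.Monic) (h : R[X]) {n : ℕ} (hn : h.natDegree ≤ n) :
    resultant P h P.natDegree n = Nm P h := by
  obtain ⟨k, rfl⟩ := Nat.exists_eq_add_of_le hn
  rw [resultant_add_right_deg _ _ _ _ _ le_rfl]
  simp [Nm, hP.coeff_natDegree]

lemma Nm_mul (hP : P.Monic) (g h : R[X]) : Nm P (g * h) = Nm P g * Nm P h := by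
  rw [← Nm_eq hP (g * h) natDegree_mul_le, resultant_mul_right _ _ _ _ le_rfl]
  rfl

lemma Nm_C (_hP : P.Monic) (c : R) : Nm P (C c) = c ^ P.natDegree := by
  simp [Nm]

lemma Nm_one (hP : P.Monic) : Nm P (1 : R[X]) = 1 := by
  have := Nm_C hP 1
  simpa using this

lemma Nm_pow (hP : P.Monic) (g : R[X]) (n : ℕ) : Nm P (g ^ n) = Nm P g ^ n := by
  induction n with
  | zero => simp [Nm_one hP]
  | succ n ih => rw [pow_succ, Nm_mul hP, ih, pow_succ]

lemma Nm_prod (hP : P.Monic) {ι : Type*} (s : Finset ι) (g : ι → R[X]) :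
    Nm P (∏ i ∈ s, g i) = ∏ i ∈ s, Nm P (g i) := by
  classical
  induction s using Finset.induction_on with
  | empty => simp [Nm_one hP]
  | insert a s ha ih => rw [Finset.prod_insert ha, Finset.prod_insert ha, Nm_mul hP, ih]

lemma Nm_congr (hP : P.Monic) {g h : R[X]} (hd : P ∣ g - h) : Nm P g = Nm P h := by
  obtain ⟨k, hk⟩ := hd
  have : g = h + P * k := by rw [← hk]; ring
  subst this
  set n := max (h.natDegree) (k.natDegree + P.natDegree)
  have hr : resultant P (h + P * k) P.natDegree n = resultant P h P.natDegree n :=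
    resultant_add_mul_right _ _ _ _ _ (le_max_right _ _) le_rfl
  rw [← Nm_eq hP h (n := n) (le_max_left _ _), ← hr, Nm_eq hP]
  refine (natDegree_add_le _ _).trans (max_le (le_max_left _ _) ?_)
  refine natDegree_mul_le.trans ?_
  rw [add_comm]
  exact le_max_right _ _

lemma Nm_X_sub_C (hP : P.Monic) (c : R) :
    Nm P (X - C c) = (-1) ^ P.natDegree * P.eval c := by
  rw [← Nm_eq hP (X - C c) (n := 1) (natDegree_X_sub_C_le c), resultant_X_sub_C_right _ _ _ le_rfl]

lemma Nm_map (hP : P.Monic) (φ : R →+* S) (h : R[X]) :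
    Nm (P.map φ) (h.map φ) = φ (Nm P h) := by
  rcases subsingleton_or_nontrivial S with hS | hS
  · exact Subsingleton.elim _ _
  · rw [← Nm_eq (hP.map φ) (h.map φ) (n := h.natDegree) natDegree_map_le, hP.natDegree_map,
      resultant_map_map]
    rfl

lemma Nm_mem (_hP : P.Monic) (h : R[X]) (hd : P.natDegree ≠ 0) :
    ∃ a b : R[X], P * a + h * b = C (Nm P h) := by
  obtain ⟨a, b, -, -, hab⟩ := exists_mul_add_mul_eq_C_resultant (m := P.natDegree)
    (n := h.natDegree) P h le_rfl le_rfl (Or.inl hd)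
  exact ⟨a, b, hab⟩

end norm

/-- Total degree at most `m`. -/
def TD {R : Type*} [Semiring R] (P : R[X][X]) (m : ℕ) : Prop :=
  ∀ n, P.coeff n ≠ 0 → (P.coeff n).natDegree + n ≤ m

section TD
variable {R : Type*} [CommRing R]

lemma TD.natDegree_le {P : R[X][X]} {m : ℕ} (h : TD P m) : P.natDegree ≤ m := by
  by_cases h0 : P = 0
  · simp [h0]
  · have := h P.natDegree (by simpa using h0)
    omega

lemma TD.mono {P : R[X][X]} {m n : ℕ} (h : TD P m) (hmn : m ≤ n) : TD P n :=
  fun i hi => (h i hi).trans hmn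

lemma TD.zero (m : ℕ) : TD (0 : R[X][X]) m := fun i hi => by simp at hi

lemma TD_iff_coeff {P : R[X][X]} {m : ℕ} :
    TD P m ↔ ∀ i j, (P.coeff i).coeff j ≠ 0 → i + j ≤ m := by
  constructor
  · intro h i j hij
    have h1 : P.coeff i ≠ 0 := by
      intro h0; simp [h0] at hij
    have := h i h1
    have := le_natDegree_of_ne_zero hij
    omega
  · intro h i hi
    have := h i (P.coeff i).natDegree (by simpa using hi)
    omega

lemma TD.add {P Q : R[X][X]} {m : ℕ} (h : TD P m) (h' : TD Q m) : TD (P + Q) m := by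
  rw [TD_iff_coeff] at *
  intro i j hij
  by_contra hlt
  apply hij
  have h1 : (P.coeff i).coeff j = 0 := by
    by_contra h0; exact hlt (h i j h0)
  have h2 : (Q.coeff i).coeff j = 0 := by
    by_contra h0; exact hlt (h' i j h0)
  simp [h1, h2]

lemma TD.neg {P : R[X][X]} {m : ℕ} (h : TD P m) : TD (-P) m := by
  rw [TD_iff_coeff] at *
  intro i j hij
  exact h i j (by simpa using hij)

lemma TD.sub {P Q : R[X][X]} {m : ℕ} (h : TD P m) (h' : TD Q m) : TD (P - Q) m := by
  rw [sub_eq_add_neg]; exact h.add h'.neg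

lemma TD.sum {ι : Type*} {s : Finset ι} {f : ι → R[X][X]} {m : ℕ} (h : ∀ i ∈ s, TD (f i) m) :
    TD (∑ i ∈ s, f i) m := by
  classical
  induction s using Finset.induction_on with
  | empty => simpa using TD.zero m
  | insert a s ha ih =>
    rw [Finset.sum_insert ha]
    exact (h a (by simp)).add (ih fun i hi => h i (by simp [hi]))

lemma TD.mul {P Q : R[X][X]} {m n : ℕ} (h : TD P m) (h' : TD Q n) : TD (P * Q) (m + n) := by
  rw [TD_iff_coeff] at *
  intro i j hij
  by_contra hlt
  apply hij
  rw [coeff_mul, finsetSum_coeff]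
  refine Finset.sum_eq_zero fun x hx => ?_
  rw [coeff_mul]
  refine Finset.sum_eq_zero fun y hy => ?_
  rw [Finset.HasAntidiagonal.mem_antidiagonal] at hx hy
  by_contra h0
  have h1 := h x.1 y.1 (left_ne_zero_of_mul h0)
  have h2 := h' x.2 y.2 (right_ne_zero_of_mul h0)
  omega

lemma TD.one : TD (1 : R[X][X]) 0 := by
  intro i hi
  rw [coeff_one] at hi ⊢
  split_ifs with h
  · simp [h]
  · simp [h] at hi

lemma TD.pow {P : R[X][X]} {m : ℕ} (h : TD P m) (n : ℕ) : TD (P ^ n) (n * m) := by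
  induction n with
  | zero => simpa using TD.one
  | succ n ih => rw [pow_succ, add_mul, one_mul]; exact ih.mul h

lemma TD.prod {ι : Type*} {s : Finset ι} {f : ι → R[X][X]} {m : ι → ℕ}
    (h : ∀ i ∈ s, TD (f i) (m i)) : TD (∏ i ∈ s, f i) (∑ i ∈ s, m i) := by
  classical
  induction s using Finset.induction_on with
  | empty => simpa using TD.one
  | insert a s ha ih =>
    rw [Finset.prod_insert ha, Finset.sum_insert ha]
    exact (h a (by simp)).mul (ih fun i hi => h i (by simp [hi]))

lemma TD.C {f : R[X]} {m : ℕ} (h : f.natDegree ≤ m) : TD (C f : R[X][X]) m := by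
  intro i hi
  rw [coeff_C] at hi ⊢
  split_ifs with h0
  · simp [h0, h]
  · simp [h0] at hi

lemma TD.X : TD (X : R[X][X]) 1 := by
  intro i hi
  rw [coeff_X] at hi ⊢
  split_ifs with h0
  · simp [← h0]
  · simp [h0] at hi

lemma TD.map {S : Type*} [CommRing S] (φ : R →+* S) {P : R[X][X]} {m : ℕ} (h : TD P m) :
    TD (P.map (mapRingHom φ)) m := by
  rw [TD_iff_coeff] at *
  intro i j hij
  apply h i j
  intro h0
  apply hij
  simp [h0]

/-- weighted determinant degree bound -/
lemma natDegree_det_le {n : ℕ} (M : Matrix (Fin n) (Fin n) R[X]) (c : Fin n → ℕ) (N : ℕ)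
    (hM : ∀ i j, M i j ≠ 0 → (M i j).natDegree + i ≤ c j)
    (hN : ∑ j, c j ≤ N + ∑ i : Fin n, (i : ℕ)) : M.det.natDegree ≤ N := by
  rw [Matrix.det_apply]
  refine natDegree_sum_le_of_forall_le _ _ fun σ _ => ?_
  refine (natDegree_smul_le _ _).trans ?_
  by_cases h0 : ∃ i, M (σ i) i = 0
  · obtain ⟨i, hi⟩ := h0
    rw [Finset.prod_eq_zero (f := fun i => M (σ i) i) (Finset.mem_univ i) hi]; simp
  · push Not at h0
    refine (natDegree_prod_le _ _).trans ?_
    have h1 : ∑ i, ((M (σ i) i).natDegree + ((σ i : Fin n) : ℕ)) ≤ ∑ i, c i :=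
      Finset.sum_le_sum fun i _ => hM _ _ (h0 i)
    rw [Finset.sum_add_distrib, Equiv.sum_comp σ (fun i : Fin n => (i : ℕ))] at h1
    omega

lemma natDegree_Nm_le {P h : R[X][X]} {d m : ℕ} (hP : P.Monic) (hPd : P.natDegree = d)
    (hPT : TD P d) (hh : TD h m) : (Nm P h).natDegree ≤ d * m := by
  rw [← Nm_eq hP h hh.natDegree_le, hPd]
  refine natDegree_det_le _ (fun j => j.addCases (fun j₁ => m + j₁) (fun j₁ => d + j₁)) _ ?_ ?_
  · intro i j
    refine Fin.addCases (fun j₁ => ?_) (fun j₁ => ?_) j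
    · simp only [sylvester, Matrix.of_apply, Fin.addCases_left]
      split_ifs with h1
      · intro h2
        have := hh _ h2
        have := h1.1
        omega
      · simp
    · simp only [sylvester, Matrix.of_apply, Fin.addCases_right]
      split_ifs with h1
      · intro h2
        have := hPT _ h2
        have := h1.1
        omega
      · simp
  · rw [Fin.sum_univ_add, Fin.sum_univ_add]
    simp only [Fin.addCases_left, Fin.addCases_right, Finset.sum_add_distrib, Finset.sum_const,
      Finset.card_univ, Fintype.card_fin, smul_eq_mul, Fin.val_castAdd, Fin.val_natAdd]
    have := Nat.mul_comm m d
    omega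

end TD

end NT
end

section
open Polynomial

namespace NT

lemma Nm_ne_zero {R : Type*} [CommRing R] [IsDomain R] [IsIntegrallyClosed R] {P h : R[X]}
    (hP : P.Monic) (hirr : Irreducible P) (hd : ¬ P ∣ h) : Nm P h ≠ 0 := by
  have hinj := IsFractionRing.injective R (FractionRing R)
  intro h0
  have h1 := Nm_map hP (algebraMap R (FractionRing R)) h
  rw [h0, map_zero] at h1
  rw [hP.irreducible_iff_irreducible_map_fraction_map (K := FractionRing R)] at hirr
  have h2 : ¬ P.map (algebraMap R (FractionRing R)) ∣ h.map (algebraMap R (FractionRing R)) := by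
    rwa [map_dvd_map _ hinj hP]
  exact resultant_ne_zero _ _ ((hirr.coprime_iff_not_dvd).2 h2) h1

section step
variable {R : Type*} [CommRing R]

lemma dvd_of_map_eval_eq_zero (s : R[X][X]) (ξ : R) (h : s.map (evalRingHom ξ) = 0) :
    C (X - C ξ) ∣ s := by
  rw [C_dvd_iff_dvd_coeff]
  intro i
  rw [dvd_iff_isRoot]
  have := congrArg (fun t => t.coeff i) h
  simpa using this

lemma map_C_map_eval (ξ : R) (t : R[X]) : (t.map C).map (evalRingHom ξ) = t := by
  rw [map_map]
  convert Polynomial.map_id using 2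
  ext; simp

lemma step {p s : R[X][X]} {ξ : R} {α β : R[X]} (hp : p.map (evalRingHom ξ) = α * β)
    (hs : α ∣ s.map (evalRingHom ξ)) :
    ∃ s' : R[X][X], p ∣ s * β.map C - C (X - C ξ) * s' := by
  obtain ⟨Q, hQ⟩ := hs
  have hev : ∀ t : R[X], (t.map C).map (evalRingHom ξ) = t := by
    intro t
    rw [map_map]
    convert Polynomial.map_id using 2
    ext; simp
  obtain ⟨s1, hs1⟩ := dvd_of_map_eval_eq_zero (s - (α * Q).map C) ξ (by
    rw [Polynomial.map_sub, hev, hQ, sub_self])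
  obtain ⟨p2, hp2⟩ := dvd_of_map_eval_eq_zero (p - (α * β).map C) ξ (by
    rw [Polynomial.map_sub, hev, hp, sub_self])
  refine ⟨s1 * β.map C - p2 * Q.map C, Q.map C, ?_⟩
  rw [Polynomial.map_mul] at hs1 hp2
  linear_combination (β.map C) * hs1 - (Q.map C) * hp2

lemma dvd_cancel [IsDomain R] {p s : R[X]} {c : R} (hp : p.Monic) (hc : c ≠ 0)
    (h : p ∣ C c * s) : p ∣ s := by
  rw [← modByMonic_eq_zero_iff_dvd hp] at h ⊢
  rw [← smul_eq_C_mul, smul_modByMonic] at h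
  exact (smul_eq_zero.1 h).resolve_left hc

end step

section rev
variable {R : Type*} [CommRing R]

/-- Homogenisation / change to the chart at infinity. -/
noncomputable def rev (m : ℕ) (s : R[X][X]) : R[X][X] :=
  ∑ n ∈ Finset.range (m + 1), C (reflect (m - n) (s.coeff n)) * X ^ n

lemma rev_coeff (m : ℕ) (s : R[X][X]) (n : ℕ) :
    (rev m s).coeff n = if n ≤ m then reflect (m - n) (s.coeff n) else 0 := by
  rw [rev, finsetSum_coeff]
  simp only [coeff_C_mul, coeff_X_pow, mul_ite, mul_one, mul_zero]
  rw [Finset.sum_ite_eq]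
  simp

lemma rev_map {S : Type*} [CommRing S] (φ : R →+* S) (m : ℕ) (s : R[X][X]) :
    rev m (s.map (mapRingHom φ)) = (rev m s).map (mapRingHom φ) := by
  ext1 n
  rw [coeff_map, rev_coeff, rev_coeff, coeff_map]
  split_ifs
  · simp [reflect_map]
  · simp

lemma natDegree_reflect_le' (N : ℕ) (f : R[X]) (h : f.natDegree ≤ N) :
    (reflect N f).natDegree ≤ N := by
  rw [natDegree_le_iff_coeff_eq_zero]
  intro n hn
  rw [coeff_reflect, revAt_eq_self_of_lt hn]
  exact coeff_eq_zero_of_natDegree_lt (by omega)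

lemma TD.coeff_natDegree {s : R[X][X]} {m : ℕ} (h : TD s m) {n : ℕ} (hn : n ≤ m) :
    (s.coeff n).natDegree ≤ m - n := by
  by_cases h0 : s.coeff n = 0
  · simp [h0]
  · have := h n h0; omega

lemma TD.rev {s : R[X][X]} {m : ℕ} (h : TD s m) : TD (rev m s) m := by
  intro n hn
  rw [rev_coeff] at hn ⊢
  split_ifs at hn ⊢ with hnm
  · have := natDegree_reflect_le' _ _ (h.coeff_natDegree hnm)
    omega
  · simp at hn

lemma monic_of_natDegree_coeff {s : R[X]} {d : ℕ} (h : s.natDegree ≤ d) (h1 : s.coeff d = 1) :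
    s.Monic := monic_of_natDegree_le_of_coeff_eq_one d h h1

lemma rev_monic {s : R[X][X]} {d : ℕ} (h : TD s d) (hm : s.Monic) (hd : s.natDegree = d) :
    (rev d s).Monic := by
  refine monic_of_natDegree_coeff h.rev.natDegree_le ?_
  rw [rev_coeff]
  have : s.coeff d = 1 := by rw [← hd]; exact hm
  simp [this]

lemma rev_natDegree [Nontrivial R] {s : R[X][X]} {d : ℕ} (h : TD s d) (hm : s.Monic)
    (hd : s.natDegree = d) : (rev d s).natDegree = d := by
  refine le_antisymm h.rev.natDegree_le ?_
  apply le_natDegree_of_ne_zero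
  rw [rev_coeff]
  have : s.coeff d = 1 := by rw [← hd]; exact hm
  simp [this]

lemma rev_eval {S : Type*} [CommRing S] (φ : R →+* S) {x z y : S} (hxz : x * z = 1)
    {m : ℕ} {s : R[X][X]} (h : TD s m) :
    eval₂ (eval₂RingHom φ z) (y * z) (rev m s) * x ^ m = eval₂ (eval₂RingHom φ x) y s := by
  let _ : Invertible x := ⟨z, by rw [mul_comm]; exact hxz, hxz⟩
  have hz : ⅟x = z := rfl
  rw [rev, eval₂_finsetSum, Finset.sum_mul,
    eval₂_eq_sum_range' (p := s) _ (n := m + 1) (by have := h.natDegree_le; omega)]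
  refine Finset.sum_congr rfl fun n hn => ?_
  rw [Finset.mem_range] at hn
  rw [eval₂_mul, eval₂_C, eval₂_X_pow, coe_eval₂RingHom, coe_eval₂RingHom,
    ← eval₂_reflect_mul_pow φ x (m - n) _ (h.coeff_natDegree (by omega)), hz]
  have : x ^ m = x ^ (m - n) * x ^ n := by rw [← pow_add]; congr 1; omega
  rw [this, mul_pow]
  have h2 : z ^ n * x ^ n = 1 := by rw [← mul_pow, mul_comm z, hxz, one_pow]
  linear_combination (eval₂ φ z (reflect (m - n) (s.coeff n)) * x ^ (m - n) * y ^ n) * h2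

end rev

end NT
end

section
open Polynomial

namespace NT

section compare
variable {L : Type*} [Field L]

lemma compare {p S s S' s' : L[X][X]} {ξ c : L} {α β β' : L[X]} {d b e i : ℕ}
    (hpm : p.Monic) (hpT : TD p d) (hξ : ξ ≠ 0)
    (hαβ : p.map (evalRingHom ξ) = α * β) (hcop : IsCoprime α β)
    (hST : TD S b) (hS' : S' = C (C c) * rev b S)
    (hβ' : β'.comp (C ξ⁻¹ * X) = C (ξ⁻¹ ^ e) * β)
    (h1 : p ∣ S * (β.map C) ^ i - C (X - C ξ) ^ i * s)
    (h2 : rev d p ∣ S' * (β'.map C) ^ i - C (X - C ξ⁻¹) ^ i * s') :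
    α ∣ C (c * ξ⁻¹ ^ (e * i) * ξ⁻¹ ^ b) * s.map (evalRingHom ξ) -
      C ((-ξ⁻¹ ^ 2) ^ i) * (s'.map (evalRingHom ξ⁻¹)).comp (C ξ⁻¹ * X) := by
  classical
  -- the local ring
  set x0 : PowerSeries L := PowerSeries.C ξ + PowerSeries.X with hx0
  have hcx0 : PowerSeries.constantCoeff x0 = ξ := by simp [hx0]
  set z0 : PowerSeries L := x0⁻¹ with hz0
  have hxz0 : x0 * z0 = 1 := PowerSeries.mul_inv_cancel _ (by rw [hcx0]; exact hξ)
  have hcz0 : PowerSeries.constantCoeff z0 = ξ⁻¹ := by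
    have := congrArg PowerSeries.constantCoeff hxz0
    rw [map_mul, hcx0, map_one] at this
    exact eq_inv_of_mul_eq_one_right this
  let θ : L[X] →+* PowerSeries L := eval₂RingHom PowerSeries.C x0
  set pt : (PowerSeries L)[X] := p.map θ with hpt
  have hptm : pt.Monic := hpm.map θ
  let D := AdjoinRoot pt
  let ι : PowerSeries L →+* D := AdjoinRoot.of pt
  let y : D := AdjoinRoot.root pt
  let φ : L →+* D := ι.comp PowerSeries.C
  set x : D := ι x0 with hx
  set z : D := ι z0 with hz
  have hxz : x * z = 1 := by rw [hx, hz, ← map_mul, hxz0, map_one]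
  set τ : D := ι PowerSeries.X with hτ
  have hxτ : x = φ ξ + τ := by rw [hx, hx0, map_add]; rfl
  have hreg : ∀ u v : D, ∀ n : ℕ, τ ^ n * u = τ ^ n * v → u = v := by
    intro u v n huv
    obtain ⟨u, rfl⟩ := AdjoinRoot.mk_surjective u
    obtain ⟨v, rfl⟩ := AdjoinRoot.mk_surjective v
    have h3 : τ ^ n = AdjoinRoot.mk pt (C (PowerSeries.X ^ n)) := by
      rw [hτ, ← map_pow]; rfl
    rw [h3, ← map_mul, ← map_mul, AdjoinRoot.mk_eq_mk, ← mul_sub] at huv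
    rw [AdjoinRoot.mk_eq_mk]
    exact dvd_cancel hptm (pow_ne_zero _ PowerSeries.X_ne_zero) huv
  -- evaluation homs
  let ε : L[X][X] →+* D := eval₂RingHom (eval₂RingHom φ x) y
  let ε' : L[X][X] →+* D := eval₂RingHom (eval₂RingHom φ z) (y * z)
  have hθ : (eval₂RingHom φ x : L[X] →+* D) = ι.comp θ := by
    ext <;> simp [φ, θ, hx]
  have hεp : ε p = 0 := by
    change eval₂ (eval₂RingHom φ x) y p = 0
    rw [hθ, ← eval₂_map]
    exact AdjoinRoot.eval₂_root pt
  have hrev : ∀ {m : ℕ} {t : L[X][X]}, TD t m → ε' (rev m t) * x ^ m = ε t :=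
    fun h => rev_eval φ hxz h
  have hε'p : ε' (rev d p) = 0 := by
    have h3 := hrev hpT
    rw [hεp] at h3
    have h4 : ε' (rev d p) * (x * z) ^ d = 0 := by rw [mul_pow, ← mul_assoc, h3, zero_mul]
    simpa [hxz] using h4
  have hεX : ε (C (X - C ξ)) = τ := by
    simp only [ε, coe_eval₂RingHom, eval₂_C, eval₂_sub, eval₂_X, hxτ]
    ring
  have hφξ : φ ξ * φ ξ⁻¹ = 1 := by rw [← map_mul, mul_inv_cancel₀ hξ, map_one]
  have hε'X : ε' (C (X - C ξ⁻¹)) = -τ * z * φ ξ⁻¹ := by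
    simp only [ε', coe_eval₂RingHom, eval₂_C, eval₂_sub, eval₂_X]
    have : τ = x - φ ξ := by rw [hxτ]; ring
    rw [this]
    linear_combination (φ ξ⁻¹) * hxz - z * hφξ
  have e1 : ε S * ε (β.map C) ^ i = τ ^ i * ε s := by
    have := map_dvd ε h1
    rw [hεp, zero_dvd_iff, map_sub, map_mul, map_mul, map_pow, map_pow, hεX, sub_eq_zero] at this
    exact this
  have e2 : ε' S' * ε' (β'.map C) ^ i = (-τ * z * φ ξ⁻¹) ^ i * ε' s' := by
    have := map_dvd ε' h2
    rw [hε'p, zero_dvd_iff, map_sub, map_mul, map_mul, map_pow, map_pow, hε'X, sub_eq_zero] at this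
    exact this
  have e3 : ε' S' * x ^ b = φ c * ε S := by
    rw [hS', map_mul, mul_assoc, hrev hST]
    congr 1
    simp [ε']
  have e4 : φ c * ε s * ε' (β'.map C) ^ i
      = x ^ b * (-z * φ ξ⁻¹) ^ i * ε' s' * ε (β.map C) ^ i := by
    apply hreg _ _ i
    have e5 : (-τ * z * φ ξ⁻¹) ^ i = τ ^ i * (-z * φ ξ⁻¹) ^ i := by rw [← mul_pow]; ring
    rw [e5] at e2
    linear_combination (-φ c * ε' (β'.map C) ^ i) * e1 + (x ^ b * ε (β.map C) ^ i) * e2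
      - (ε' (β'.map C) ^ i * ε (β.map C) ^ i) * e3
  -- specialise
  let π : D →+* AdjoinRoot α := AdjoinRoot.lift ((AdjoinRoot.of α).comp PowerSeries.constantCoeff)
    (AdjoinRoot.root α) (by
      rw [hpt, eval₂_map]
      have h5 : ((AdjoinRoot.of α).comp PowerSeries.constantCoeff).comp θ
          = (AdjoinRoot.of α).comp (evalRingHom ξ) := by
        ext <;> simp [θ, hcx0]
      rw [h5, ← eval₂_map, hαβ, eval₂_mul, AdjoinRoot.eval₂_root, zero_mul])
  have hπι : ∀ t, π (ι t) = AdjoinRoot.of α (PowerSeries.constantCoeff t) := fun t =>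
    AdjoinRoot.lift_of _
  have hπy : π y = AdjoinRoot.root α := AdjoinRoot.lift_root _
  have hπφ : ∀ t, π (φ t) = AdjoinRoot.of α t := fun t => by
    change π (ι (PowerSeries.C t)) = _
    rw [hπι]; simp
  have hπε : ∀ t, π (ε t) = AdjoinRoot.mk α (t.map (evalRingHom ξ)) := by
    have : π.comp ε = (AdjoinRoot.mk α).comp (mapRingHom (evalRingHom ξ)) := by
      ext a
      · simp [ε, hπφ]
      · simp [ε, hx, hπι, hcx0]
      · simp [ε, hπy]
    intro t
    exact RingHom.congr_fun this t
  have hπε' : ∀ t, π (ε' t) =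
      AdjoinRoot.mk α ((t.map (evalRingHom ξ⁻¹)).comp (C ξ⁻¹ * X)) := by
    have : π.comp ε' = ((AdjoinRoot.mk α).comp (compRingHom (C ξ⁻¹ * X))).comp
        (mapRingHom (evalRingHom ξ⁻¹)) := by
      ext a
      · simp [ε', hπφ]
      · simp [ε', hz, hπι, hcz0]
      · simp [ε', hz, hπι, hcz0, hπy]; ring
    intro t
    exact RingHom.congr_fun this t
  have hevC : ∀ (ζ : L) (t : L[X]), (t.map C).map (evalRingHom ζ) = t := by
    exact fun ζ t => map_C_map_eval ζ t
  have e6 := congrArg π e4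
  have hπx : π x = AdjoinRoot.of α ξ := by rw [hx, hπι, hcx0]
  have hπz : π z = AdjoinRoot.of α ξ⁻¹ := by rw [hz, hπι, hcz0]
  simp only [map_mul, map_pow, map_neg, hπφ, hπε, hπε', hπx, hπz, hevC, hβ'] at e6
  -- now everything lives in `AdjoinRoot α`
  obtain ⟨u, w, huw⟩ := hcop
  have hunit : AdjoinRoot.mk α w * AdjoinRoot.mk α β = 1 := by
    have := congrArg (AdjoinRoot.mk α) huw
    simpa using this
  have hunit' : AdjoinRoot.mk α w ^ i * AdjoinRoot.mk α β ^ i = 1 := by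
    rw [← mul_pow, hunit, one_pow]
  have hξu : AdjoinRoot.of α ξ ^ b * AdjoinRoot.of α ξ⁻¹ ^ b = 1 := by
    rw [← mul_pow, ← map_mul, mul_inv_cancel₀ hξ, map_one, one_pow]
  rw [← AdjoinRoot.mk_eq_mk]
  simp only [map_mul, map_pow, map_neg, AdjoinRoot.mk_C] at e6 ⊢
  set A := AdjoinRoot.mk α (s.map (evalRingHom ξ))
  set B := AdjoinRoot.mk α ((s'.map (evalRingHom ξ⁻¹)).comp (C ξ⁻¹ * X))
  set bb := AdjoinRoot.mk α β
  set ww := AdjoinRoot.mk α w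
  set t := AdjoinRoot.of α ξ⁻¹
  set t' := AdjoinRoot.of α ξ
  have e7 : (-t * t) ^ i = (-t ^ 2) ^ i := by congr 1; ring
  rw [e7] at e6
  rw [pow_mul]
  rw [mul_pow (t ^ e) bb i] at e6
  linear_combination (ww ^ i * t ^ b) * e6 + (-(AdjoinRoot.of α c) * A * (t ^ e) ^ i * t ^ b
    + t' ^ b * t ^ b * (-t ^ 2) ^ i * B) * hunit' + (-t ^ 2) ^ i * B * hξu

end compare

end NT
end

section
open Polynomial

namespace NT

section linalg
variable {K V H : Type*} [Field K] [AddCommGroup V] [Module K V] [AddCommGroup H] [Module K H]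

/-- Dimension drop along a linear relation. -/
lemma finrank_relation [FiniteDimensional K V] (M M' : Submodule K V) (T : Submodule K H)
    [FiniteDimensional K T] (G : Submodule K (V × H))
    (h1 : ∀ c ∈ M, ∃ h ∈ T, (c, h) ∈ G) (h2 : ∀ c ∈ M, (c, (0 : H)) ∈ G → c ∈ M') :
    Module.finrank K M ≤ Module.finrank K M' + Module.finrank K T := by
  classical
  let G' : Submodule K (V × T) :=
    (G.comap (LinearMap.prodMap LinearMap.id T.subtype)) ⊓ (M.comap (LinearMap.fst K V T))
  let f : G' →ₗ[K] V := (LinearMap.fst K V T).comp G'.subtype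
  let g : G' →ₗ[K] T := (LinearMap.snd K V T).comp G'.subtype
  have hf : M ≤ LinearMap.range f := by
    intro c hc
    obtain ⟨h, hT, hG⟩ := h1 c hc
    exact ⟨⟨(c, ⟨h, hT⟩), ⟨hG, hc⟩⟩, rfl⟩
  have e1 : Module.finrank K M ≤ Module.finrank K G' :=
    (Submodule.finrank_mono hf).trans (LinearMap.finrank_range_le f)
  have e2 := LinearMap.finrank_range_add_finrank_ker g
  have e3 : Module.finrank K (LinearMap.range g) ≤ Module.finrank K T :=
    Submodule.finrank_le _
  have e4 : Module.finrank K (LinearMap.ker g) ≤ Module.finrank K M' := by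
    have hk : ∀ z : LinearMap.ker g, (f.comp (LinearMap.ker g).subtype) z ∈ M' := by
      rintro ⟨⟨⟨c, t⟩, hG, hM⟩, hz⟩
      have ht : t = 0 := hz
      subst ht
      exact h2 c hM hG
    refine LinearMap.finrank_le_finrank_of_injective
      (f := (f.comp (LinearMap.ker g).subtype).codRestrict M' hk) ?_
    rintro ⟨⟨⟨c, t⟩, hG, hM⟩, hz⟩ ⟨⟨⟨c', t'⟩, hG', hM'⟩, hz'⟩ heq
    have ht : t = 0 := hz
    have ht' : t' = 0 := hz'
    have hc : c = c' := congrArg Subtype.val heq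
    subst ht ht' hc
    rfl
  omega

lemma finrank_disjoint (T A A' : Submodule K H) [FiniteDimensional K A]
    (hT : T ≤ A) (hA : A' ≤ A) (hd : ∀ h ∈ T, h ∈ A' → h = 0) :
    Module.finrank K T + Module.finrank K A' ≤ Module.finrank K A := by
  have : FiniteDimensional K T := Submodule.finiteDimensional_of_le hT
  have : FiniteDimensional K A' := Submodule.finiteDimensional_of_le hA
  have h1 := Submodule.finrank_sup_add_finrank_inf_eq T A'
  have h2 : T ⊓ A' = ⊥ := by
    rw [eq_bot_iff]
    intro h hh
    exact hd h hh.1 hh.2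
  rw [h2, finrank_bot] at h1
  have := Submodule.finrank_mono (sup_le hT hA)
  omega

end linalg

section Red
variable (K : Type*) [Field K]

/-- Polynomials of total degree at most `m` and degree less than `d` in the outer variable. -/
def Red (d m : ℕ) : Submodule K K[X][X] where
  carrier := {H | TD H m ∧ H.degree < d}
  add_mem' := fun h h' => ⟨h.1.add h'.1, (degree_add_le _ _).trans_lt (max_lt h.2 h'.2)⟩
  zero_mem' := ⟨TD.zero _, by simp⟩
  smul_mem' := fun c H h => by
    refine ⟨fun n hn => ?_, (degree_smul_le _ _).trans_lt h.2⟩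
    rw [coeff_smul] at hn ⊢
    have h1 : H.coeff n ≠ 0 := fun h0 => hn (by rw [h0, smul_zero])
    have := h.1 n h1
    have := natDegree_smul_le c (H.coeff n)
    omega

variable {K}

/-- dimension count -/
def Dm (d m : ℕ) : ℕ := ∑ β ∈ Finset.range d, (m + 1 - β)

noncomputable def redEquiv (d m : ℕ) : Red K d m ≃ₗ[K] ((β : Fin d) → degreeLT K (m + 1 - β)) where
  toFun H := fun β => ⟨H.1.coeff β, by
    rw [mem_degreeLT]
    by_cases h0 : H.1.coeff β = 0
    · rw [h0, degree_zero]; exact WithBot.bot_lt_coe _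
    · have := H.2.1 β h0
      rw [degree_eq_natDegree h0]
      exact_mod_cast (by omega : (H.1.coeff β).natDegree < m + 1 - β)⟩
  map_add' H H' := by ext; simp
  map_smul' c H := by ext; simp
  invFun g := ⟨∑ β : Fin d, C (g β).1 * X ^ (β : ℕ), by
    refine ⟨TD.sum fun β _ => ?_, ?_⟩
    · intro n hn
      rw [coeff_C_mul, coeff_X_pow] at hn ⊢
      split_ifs at hn ⊢ with h
      · subst h
        simp only [mul_one] at hn ⊢
        have := mem_degreeLT.1 (g β).2
        rw [degree_eq_natDegree hn] at this
        have : (g β).1.natDegree < m + 1 - β := by exact_mod_cast this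
        omega
      · simp at hn
    · refine (degree_sum_le _ _).trans_lt ?_
      rw [Finset.sup_lt_iff (WithBot.bot_lt_coe _)]
      intro β _
      refine (degree_C_mul_X_pow_le _ _).trans_lt ?_
      exact_mod_cast β.2⟩
  left_inv H := by
    ext1
    ext1 n
    simp only [finsetSum_coeff, coeff_C_mul, coeff_X_pow, mul_ite, mul_one, mul_zero]
    by_cases hn : n < d
    · rw [Finset.sum_eq_single (⟨n, hn⟩ : Fin d)]
      · simp
      · intro β _ hβ
        rw [if_neg]
        intro h; exact hβ (Fin.ext h.symm)
      · simp
    · rw [Finset.sum_eq_zero]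
      · symm
        apply coeff_eq_zero_of_degree_lt
        exact H.2.2.trans_le (by exact_mod_cast (by omega : d ≤ n))
      · intro β _
        rw [if_neg]; have := β.2; omega
  right_inv g := by
    ext1 β
    ext1
    simp only [finsetSum_coeff, coeff_C_mul, coeff_X_pow, mul_ite, mul_one, mul_zero]
    rw [Finset.sum_eq_single β]
    · simp
    · intro b _ hb
      rw [if_neg]
      intro h; exact hb (Fin.ext h.symm)
    · simp

instance degLT_fin (n : ℕ) : FiniteDimensional K (degreeLT K n) :=
  Module.Finite.equiv (degreeLTEquiv K n).symm

instance (d m : ℕ) : FiniteDimensional K (Red K d m) :=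
  Module.Finite.equiv (redEquiv d m).symm

lemma finrank_Red (d m : ℕ) : Module.finrank K (Red K d m) = Dm d m := by
  rw [(redEquiv d m).finrank_eq, Module.finrank_pi_fintype, Dm, ← Fin.sum_univ_eq_sum_range]
  refine Finset.sum_congr rfl fun β _ => ?_
  rw [(degreeLTEquiv K _).finrank_eq]
  simp

lemma Dm_le (d m : ℕ) : Dm d m ≤ d * (m + 1) := by
  rw [Dm]
  calc _ ≤ ∑ β ∈ Finset.range d, (m + 1) := Finset.sum_le_sum fun _ _ => Nat.sub_le _ _
    _ = _ := by simp

lemma Dm_sub (d : ℕ) {m m' : ℕ} (h : m' ≤ m) : Dm d m ≤ Dm d m' + d * (m - m') := by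
  rw [Dm, Dm]
  calc _ ≤ ∑ β ∈ Finset.range d, ((m' + 1 - β) + (m - m')) :=
        Finset.sum_le_sum fun _ _ => by omega
    _ = _ := by simp [Finset.sum_add_distrib]

lemma Dm_ge (d m : ℕ) : (d : ℤ) * (m + 1) * 2 - d * (d - 1) ≤ 2 * Dm d m := by
  rw [Dm]
  induction d with
  | zero => simp
  | succ d ih =>
    rw [Finset.sum_range_succ]
    push_cast at ih ⊢
    have : (m : ℤ) + 1 - d ≤ ((m + 1 - d : ℕ) : ℤ) := by omega
    nlinarith

end Red

end NT
end

section
open Polynomial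

namespace NT

section compare2
variable {L : Type*} [Field L]

lemma compare_coeff {p S s S' s' : L[X][X]} {ξ c : L} {α β α' β' : L[X]} {d b e e' i : ℕ}
    (hpm : p.Monic) (hpT : TD p d) (hξ : ξ ≠ 0)
    (hαβ : p.map (evalRingHom ξ) = α * β) (hcop : IsCoprime α β)
    (hST : TD S b) (hS' : S' = C (C c) * rev b S)
    (hβ' : β'.comp (C ξ⁻¹ * X) = C (ξ⁻¹ ^ e) * β)
    (hα' : α'.comp (C ξ⁻¹ * X) = C (ξ⁻¹ ^ e') * α)
    (hα : α.Monic) (hα'm : α'.Monic)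
    (h1 : p ∣ S * (β.map C) ^ i - C (X - C ξ) ^ i * s)
    (h2 : rev d p ∣ S' * (β'.map C) ^ i - C (X - C ξ⁻¹) ^ i * s') (κ : ℕ) :
    c * ξ⁻¹ ^ (e * i) * ξ⁻¹ ^ b * (s.map (evalRingHom ξ) %ₘ α).coeff κ =
      (-ξ⁻¹ ^ 2) ^ i * ξ⁻¹ ^ κ * (s'.map (evalRingHom ξ⁻¹) %ₘ α').coeff κ := by
  have h := compare hpm hpT hξ hαβ hcop hST hS' hβ' h1 h2
  have hξ' : ξ⁻¹ ≠ 0 := inv_ne_zero hξ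
  have hdeg : α'.degree = α.degree := by
    have h3 := congrArg natDegree hα'
    rw [natDegree_comp, natDegree_C_mul_X _ hξ', mul_one,
      natDegree_C_mul (pow_ne_zero _ hξ')] at h3
    rw [degree_eq_natDegree hα.ne_zero, degree_eq_natDegree hα'm.ne_zero, h3]
  set s1 := s.map (evalRingHom ξ)
  set s2 := s'.map (evalRingHom ξ⁻¹)
  have hs1 := modByMonic_add_div s1 α
  have hs2 := modByMonic_add_div s2 α'
  set r1 := s1 %ₘ α with hr1
  set r2 := s2 %ₘ α' with hr2
  set c1 := c * ξ⁻¹ ^ (e * i) * ξ⁻¹ ^ b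
  set c2 := (-ξ⁻¹ ^ 2) ^ i
  have h4 : α ∣ C c1 * r1 - C c2 * r2.comp (C ξ⁻¹ * X) := by
    have h5 : s2.comp (C ξ⁻¹ * X) = r2.comp (C ξ⁻¹ * X) +
        C (ξ⁻¹ ^ e') * α * (s2 /ₘ α').comp (C ξ⁻¹ * X) := by
      rw [← hα', ← mul_comp, ← add_comp, hs2]
    rw [h5] at h
    have h6 : α ∣ α * (C c1 * (s1 /ₘ α) - C c2 * C (ξ⁻¹ ^ e') * (s2 /ₘ α').comp (C ξ⁻¹ * X)) :=
      dvd_mul_right _ _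
    have h7 := dvd_sub h h6
    convert h7 using 1
    linear_combination (C c1) * hs1
  have h5 : C c1 * r1 - C c2 * r2.comp (C ξ⁻¹ * X) = 0 := by
    apply eq_zero_of_dvd_of_degree_lt h4
    refine (degree_sub_le _ _).trans_lt (max_lt ?_ ?_)
    · rw [← smul_eq_C_mul]
      exact (degree_smul_le _ _).trans_lt (degree_modByMonic_lt _ hα)
    · rw [← smul_eq_C_mul]
      refine (degree_smul_le _ _).trans_lt ?_
      have h8 := degree_modByMonic_lt s2 hα'm
      rw [hdeg] at h8
      by_cases h0 : r2 = 0
      · rw [h0, zero_comp, degree_zero]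
        rw [bot_lt_iff_ne_bot, Ne, degree_eq_bot]; exact hα.ne_zero
      · refine lt_of_le_of_lt ?_ h8
        rw [← hr2, degree_eq_natDegree h0]
        refine (degree_le_natDegree).trans ?_
        rw [natDegree_comp, natDegree_C_mul_X _ hξ', mul_one]
  have h6 := congrArg (fun t => t.coeff κ) (sub_eq_zero.1 h5)
  simp only [coeff_C_mul, comp_C_mul_X_coeff] at h6
  rw [h6]; ring
end compare2

section chart
variable {K : Type*} [Field K]

/-- `P` with coefficients in a `K`-algebra. -/
noncomputable def pol (R : Type*) [CommRing R] [Algebra K R] (P : K[X][X]) : R[X][X] :=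
  P.map (mapRingHom (algebraMap K R))

/-- the fibre over `ξ`. -/
noncomputable def fib {R : Type*} [CommRing R] [Algebra K R] (ξ : R) (P : K[X][X]) : R[X] :=
  (pol R P).map (evalRingHom ξ)

/-- the residual fibre. -/
noncomputable def rho {R : Type*} [CommRing R] [Algebra K R] (ξ η : R) (P : K[X][X]) : R[X] :=
  fib ξ P /ₘ (X - C η)

variable {R S : Type*} [CommRing R] [Algebra K R] [CommRing S] [Algebra K S]

lemma pol_map (j : R →ₐ[K] S) (P : K[X][X]) :
    (pol R P).map (mapRingHom (j : R →+* S)) = pol S P := by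
  rw [pol, pol, map_map]
  congr 1
  ext <;> simp

lemma fib_map (j : R →ₐ[K] S) (ξ : R) (P : K[X][X]) :
    (fib ξ P).map (j : R →+* S) = fib (j ξ) P := by
  rw [fib, fib, ← pol_map j, map_map, map_map]
  congr 1
  ext <;> simp

lemma rho_map (j : R →ₐ[K] S) (ξ η : R) (P : K[X][X]) :
    (rho ξ η P).map (j : R →+* S) = rho (j ξ) (j η) P := by
  rw [rho, rho, map_divByMonic _ (monic_X_sub_C η), fib_map]
  simp

lemma pol_monic {P : K[X][X]} (h : P.Monic) : (pol R P).Monic := h.map _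
lemma fib_monic {P : K[X][X]} (h : P.Monic) (ξ : R) : (fib ξ P).Monic := (pol_monic h).map _
lemma pol_natDegree [Nontrivial R] {P : K[X][X]} (h : P.Monic) :
    (pol R P).natDegree = P.natDegree := h.natDegree_map _
lemma fib_natDegree [Nontrivial R] {P : K[X][X]} (h : P.Monic) (ξ : R) :
    (fib ξ P).natDegree = P.natDegree := by
  rw [fib, (pol_monic h).natDegree_map, pol_natDegree h]
lemma pol_TD {P : K[X][X]} {m : ℕ} (h : TD P m) : TD (pol R P) m := h.map _

lemma pol_rev (m : ℕ) (P : K[X][X]) : pol R (rev m P) = rev m (pol R P) := (rev_map _ _ _).symm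

lemma fib_eq_mul {ξ η : R} {P : K[X][X]} (h : (fib ξ P).eval η = 0) :
    fib ξ P = (X - C η) * rho ξ η P := by
  rw [rho, mul_divByMonic_eq_iff_isRoot.2 h]

lemma rho_monic {ξ η : R} {P : K[X][X]} (hm : P.Monic) (h : (fib ξ P).eval η = 0) :
    (rho ξ η P).Monic := by
  have h1 := fib_monic hm ξ
  rw [fib_eq_mul h] at h1
  exact (monic_X_sub_C η).of_mul_monic_left h1

lemma rho_natDegree [Nontrivial R] {ξ η : R} {P : K[X][X]} (hm : P.Monic)
    (h : (fib ξ P).eval η = 0) : (rho ξ η P).natDegree = P.natDegree - 1 := by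
  have h1 := fib_natDegree hm ξ
  rw [fib_eq_mul h, (monic_X_sub_C η).natDegree_mul (rho_monic hm h), natDegree_X_sub_C] at h1
  omega

/-- the order condition -/
def Ord (p : R[X][X]) (ξ : R) (β : R[X]) (i : ℕ) (S s : R[X][X]) : Prop :=
  p ∣ S * (β.map C) ^ i - C (X - C ξ) ^ i * s

lemma Ord.step {p : R[X][X]} {ξ : R} {α β : R[X]} {i : ℕ} {S s : R[X][X]}
    (h : Ord p ξ β i S s) (hp : p.map (evalRingHom ξ) = α * β)
    (hs : α ∣ s.map (evalRingHom ξ)) : ∃ s', Ord p ξ β (i + 1) S s' := by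
  obtain ⟨s', hs'⟩ := NT.step hp hs
  refine ⟨s', ?_⟩
  have := dvd_add (h.mul_right (β.map C)) (hs'.mul_left (C (X - C ξ) ^ i))
  rw [Ord]
  convert this using 1
  ring

lemma Ord.map (j : R →+* S) {p : R[X][X]} {ξ : R} {β : R[X]} {i : ℕ} {T s : R[X][X]}
    (h : Ord p ξ β i T s) :
    Ord (p.map (mapRingHom j)) (j ξ) (β.map j) i (T.map (mapRingHom j))
      (s.map (mapRingHom j)) := by
  have h1 := Polynomial.map_dvd (mapRingHom j) h
  rw [Ord]
  convert h1 using 1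
  have : (mapRingHom j).comp (C : R →+* R[X]) = (C : S →+* S[X]).comp j := by ext; simp
  simp [Polynomial.map_map, this]

lemma Ord.zero (p : R[X][X]) (ξ : R) (β : R[X]) (T : R[X][X]) : Ord p ξ β 0 T T := by
  simp [Ord]

lemma Ord.add {p : R[X][X]} {ξ : R} {β : R[X]} {i : ℕ} {T s T' s' : R[X][X]}
    (h : Ord p ξ β i T s) (h' : Ord p ξ β i T' s') : Ord p ξ β i (T + T') (s + s') := by
  have := dvd_add h h'
  rw [Ord]
  convert this using 1
  ring

lemma Ord.smul {p : R[X][X]} {ξ : R} {β : R[X]} {i : ℕ} {T s : R[X][X]} (c : K)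
    (h : Ord p ξ β i T s) : Ord p ξ β i (c • T) (c • s) := by
  have : p ∣ c • (T * (β.map C) ^ i - C (X - C ξ) ^ i * s) := by
    rw [Algebra.smul_def]; exact h.mul_left _
  rw [Ord]
  convert this using 1
  rw [smul_sub, smul_mul_assoc, mul_smul_comm]

end chart

end NT
end

section
open Polynomial

namespace NT

section curve
variable {K L : Type*} [Field K] [Field L] [Algebra K L]

structure Curve (P : K[X][X]) (d : ℕ) (e einf : K[X][X] →ₐ[K] L) : Prop where
  monic : P.Monic
  deg : P.natDegree = d
  td : TD P d
  pos : 0 < d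
  ker : ∀ H, e H = 0 ↔ P ∣ H
  ix : e (C X) * einf (C X) = 1
  iy : einf X = e X * einf (C X)

lemma alg_eq (e : K[X][X] →ₐ[K] L) (H : K[X][X]) :
    e H = eval₂ (eval₂RingHom (algebraMap K L) (e (C X))) (e X) H := by
  have : (e : K[X][X] →+* L) =
      eval₂RingHom (eval₂RingHom (algebraMap K L) (e (C X))) (e X) := by
    ext a
    · change e (C (C a)) = eval₂ _ _ (C (C a))
      rw [show (C (C a) : K[X][X]) = algebraMap K _ a from rfl, e.commutes,
        show algebraMap K K[X][X] a = C (C a) from rfl]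
      simp
    · simp
    · simp
  exact RingHom.congr_fun this H

lemma reflect_reflect' {R : Type*} [CommRing R] (N : ℕ) (f : R[X]) :
    reflect N (reflect N f) = f := by
  ext n
  simp

lemma rev_rev {R : Type*} [CommRing R] {m : ℕ} {s : R[X][X]} (h : TD s m) :
    rev m (rev m s) = s := by
  ext1 n
  rw [rev_coeff, rev_coeff]
  split_ifs with hn
  · exact reflect_reflect' _ _
  · symm
    apply coeff_eq_zero_of_natDegree_lt
    have := h.natDegree_le
    omega

lemma exists_TD {R : Type*} [CommRing R] (s : R[X][X]) : ∃ m, TD s m := by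
  refine ⟨∑ n ∈ s.support, ((s.coeff n).natDegree + n), fun n hn => ?_⟩
  exact Finset.single_le_sum (f := fun n => (s.coeff n).natDegree + n)
    (fun _ _ => Nat.zero_le _) (mem_support_iff.2 hn)

lemma degree_rev {R : Type*} [CommRing R] {m d : ℕ} {s : R[X][X]} (h : s.degree < d) :
    (rev m s).degree < d := by
  rw [degree_lt_iff_coeff_zero] at h ⊢
  intro n hn
  rw [rev_coeff]
  split_ifs
  · rw [h n hn]; simp
  · rfl

namespace Curve
variable {P : K[X][X]} {d : ℕ} {e einf : K[X][X] →ₐ[K] L} (hC : Curve P d e einf)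
include hC

lemma x_ne : e (C X) ≠ 0 := left_ne_zero_of_mul_eq_one hC.ix

lemma inf_x : einf (C X) = (e (C X))⁻¹ := eq_inv_of_mul_eq_one_right hC.ix

lemma rev_eq {H : K[X][X]} {m : ℕ} (h : TD H m) : einf (rev m H) * e (C X) ^ m = e H := by
  rw [alg_eq e H, alg_eq einf, hC.iy]
  exact rev_eval _ hC.ix h

lemma inf_P : einf (rev d P) = 0 := by
  have h := hC.rev_eq hC.td
  rw [(hC.ker P).2 dvd_rfl] at h
  exact (mul_eq_zero.1 h).resolve_right (pow_ne_zero _ hC.x_ne)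

lemma inj_red {H : K[X][X]} (h : H.degree < d) (h0 : e H = 0) : H = 0 := by
  rw [hC.ker] at h0
  apply eq_zero_of_dvd_of_degree_lt h0
  rw [degree_eq_natDegree hC.monic.ne_zero, hC.deg]
  exact h

lemma degP : P.degree = d := by rw [degree_eq_natDegree hC.monic.ne_zero, hC.deg]

lemma exists_red (H : K[X][X]) : ∃ H' : K[X][X], H'.degree < d ∧ e H' = e H := by
  refine ⟨H %ₘ P, ?_, ?_⟩
  · rw [← hC.degP]; exact degree_modByMonic_lt _ hC.monic
  · have := modByMonic_add_div H P
    conv_rhs => rw [← this, map_add, map_mul, (hC.ker P).2 dvd_rfl, zero_mul, add_zero]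

lemma exists_red_inf (H : K[X][X]) : ∃ H' : K[X][X], H'.degree < d ∧ einf H' = einf H := by
  have hm := rev_monic hC.td hC.monic hC.deg
  refine ⟨H %ₘ (rev d P), ?_, ?_⟩
  · have := degree_modByMonic_lt H hm
    rwa [degree_eq_natDegree hm.ne_zero, rev_natDegree hC.td hC.monic hC.deg] at this
  · have := modByMonic_add_div H (rev d P)
    conv_rhs => rw [← this, map_add, map_mul, hC.inf_P, zero_mul, add_zero]

omit hC in
lemma degree_CX_mul {H : K[X][X]} {n : ℕ} (h : H.degree < d) : (C (X ^ n) * H : K[X][X]).degree < (d : WithBot ℕ) := by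
  rw [← smul_eq_C_mul]
  exact (degree_smul_le _ _).trans_lt h

/-- The degree lemma. -/
lemma mem_of_charts {H H' : K[X][X]} {s n : ℕ} (hsn : s ≤ n)
    (h : e H * e (C X) ^ s = einf H' * e (C X) ^ n) :
    e H ∈ (Red K d (n - s)).map e.toLinearMap := by
  obtain ⟨H1, hd1, he1⟩ := hC.exists_red H
  obtain ⟨H2, hd2, he2⟩ := hC.exists_red_inf H'
  obtain ⟨M, hM⟩ := exists_TD H2
  have h1 := hC.rev_eq hM.rev
  rw [rev_rev hM] at h1
  refine ⟨H1, ⟨?_, hd1⟩, he1⟩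
  have h2 : e (C (X ^ M) * H1 - C (X ^ (n - s)) * rev M H2) = 0 := by
    rw [map_sub, map_mul, map_mul, C_pow, C_pow, map_pow, map_pow, sub_eq_zero, ← h1, he2, he1]
    have hx := pow_ne_zero s hC.x_ne
    apply mul_right_cancel₀ hx
    have : e (C X) ^ n = e (C X) ^ (n - s) * e (C X) ^ s := by
      rw [← pow_add]; congr 1; omega
    rw [this] at h
    linear_combination e (C X) ^ M * h
  have h3 := hC.inj_red ((degree_sub_le _ _).trans_lt
    (max_lt (degree_CX_mul hd1) (degree_CX_mul (degree_rev hd2)))) h2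
  rw [sub_eq_zero] at h3
  intro k hk
  have h4 := congrArg (fun t => t.coeff k) h3
  simp only [coeff_C_mul] at h4
  have h5 : (X ^ M * H1.coeff k : K[X]).natDegree = M + (H1.coeff k).natDegree := by
    rw [natDegree_mul (pow_ne_zero _ X_ne_zero) hk, natDegree_X_pow]
  have h6 : (X ^ (n - s) * (rev M H2).coeff k : K[X]).natDegree + k ≤ n - s + M := by
    have hne : (rev M H2).coeff k ≠ 0 := by
      intro h0
      rw [h0, mul_zero] at h4
      exact mul_ne_zero (pow_ne_zero _ X_ne_zero) hk h4
    rw [natDegree_mul (pow_ne_zero _ X_ne_zero) hne, natDegree_X_pow]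
    have := hM.rev k hne
    omega
  rw [← h4, h5] at h6
  omega

lemma finrank_map_Red (m : ℕ) :
    Module.finrank K ((Red K d m).map e.toLinearMap) = Dm d m := by
  rw [← finrank_Red (K := K)]
  let f : Red K d m →ₗ[K] L := e.toLinearMap.comp (Red K d m).subtype
  have hf : Function.Injective f := by
    rw [injective_iff_map_eq_zero]
    intro H hH
    exact Subtype.ext (hC.inj_red H.2.2 hH)
  have : (Red K d m).map e.toLinearMap = LinearMap.range f := by
    ext z; simp [f, Submodule.mem_map]
  rw [this]
  exact LinearMap.finrank_range_of_inj hf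

end Curve

end curve

end NT
end

section
open Polynomial

namespace NT

section filt
variable {K L : Type*} [Field K] [Field L] [Algebra K L]

/-- the inclusion of a subalgebra as a ring hom -/
noncomputable def jj (A : Subalgebra K L) : A →+* L := (A.val : A →+* L)

lemma jj_inj (A : Subalgebra K L) : Function.Injective (jj A) := Subtype.val_injective

lemma jj_apply (A : Subalgebra K L) (a : A) : jj A a = (a : L) := rfl

structure Loc (P : K[X][X]) (d : ℕ) (e einf : K[X][X] →ₐ[K] L) (N eα eβ : ℕ)
    (ξ : e.range) (α β : e.range[X]) (ξ' : einf.range) (α' β' : einf.range[X]) : Prop where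
  hξ : (ξ : L) = e (C X) ^ N
  hξ' : (ξ' : L) = (e (C X) ^ N)⁻¹
  hαβ : fib ξ P = α * β
  hαβ' : fib ξ' (rev d P) = α' * β'
  mα : α.Monic
  mα' : α'.Monic
  dα : α.natDegree = eα
  cop : IsCoprime (α.map (jj e.range)) (β.map (jj e.range))
  tα : (α'.map (jj einf.range)).comp (C (e (C X) ^ N)⁻¹ * X) =
    C ((e (C X) ^ N)⁻¹ ^ eα) * α.map (jj e.range)
  tβ : (β'.map (jj einf.range)).comp (C (e (C X) ^ N)⁻¹ * X) =
    C ((e (C X) ^ N)⁻¹ ^ eβ) * β.map (jj e.range)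

variable {W : Type*} [AddCommGroup W] [Module K W]

structure Sec (e einf : K[X][X] →ₐ[K] L) (a b : ℕ)
    (Sm : W →ₗ[K] e.range[X][X]) (Sm' : W →ₗ[K] einf.range[X][X]) : Prop where
  td : ∀ c, TD ((Sm c).map (mapRingHom (jj e.range))) b
  rel : ∀ c, (Sm' c).map (mapRingHom (jj einf.range)) =
    C (C (e (C X) ^ a)⁻¹) * rev b ((Sm c).map (mapRingHom (jj e.range)))

lemma smul_eq_CC {R : Type*} [CommRing R] [Algebra K R] (c : K) (s : R[X][X]) :
    c • s = C (C (algebraMap K R c)) * s := by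
  rw [Algebra.smul_def]; rfl

lemma map_ev_mod_smul {R : Type*} [CommRing R] [Algebra K R] (c : K) (s : R[X][X]) (ξ : R)
    (α : R[X]) : (c • s).map (evalRingHom ξ) %ₘ α =
      (algebraMap K R c) • (s.map (evalRingHom ξ) %ₘ α) := by
  rw [smul_eq_CC, Polynomial.map_mul, map_C, coe_evalRingHom, eval_C, ← smul_eq_C_mul,
    smul_modByMonic]

variable (P : K[X][X]) (d : ℕ) (e einf : K[X][X] →ₐ[K] L)
    (Sm : W →ₗ[K] e.range[X][X]) (Sm' : W →ₗ[K] einf.range[X][X])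

def Filt (ξ : e.range) (β : e.range[X]) (ξ' : einf.range) (β' : einf.range[X]) (i : ℕ) :
    Submodule K W where
  carrier := {c | (∃ s, Ord (pol _ P) ξ β i (Sm c) s) ∧
    ∃ s', Ord (pol _ (rev d P)) ξ' β' i (Sm' c) s'}
  add_mem' := by
    rintro c c' ⟨⟨s, hs⟩, t, ht⟩ ⟨⟨s', hs'⟩, t', ht'⟩
    exact ⟨⟨s + s', by rw [map_add]; exact hs.add hs'⟩, t + t', by
      rw [map_add]; exact ht.add ht'⟩
  zero_mem' := ⟨⟨0, by simp [Ord]⟩, 0, by simp [Ord]⟩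
  smul_mem' := by
    rintro k c ⟨⟨s, hs⟩, t, ht⟩
    exact ⟨⟨k • s, by rw [map_smul]; exact hs.smul k⟩, k • t, by
      rw [map_smul]; exact ht.smul k⟩

def Rel (ξ : e.range) (α β : e.range[X]) (ξ' : einf.range) (β' : einf.range[X]) (n i : ℕ) :
    Submodule K (W × (Fin n → L)) where
  carrier := {z | ∃ s s', Ord (pol _ P) ξ β i (Sm z.1) s ∧
    Ord (pol _ (rev d P)) ξ' β' i (Sm' z.1) s' ∧
    ∀ κ : Fin n, z.2 κ = jj e.range ((s.map (evalRingHom ξ) %ₘ α).coeff κ)}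
  add_mem' := by
    rintro z z' ⟨s, t, hs, ht, h⟩ ⟨s', t', hs', ht', h'⟩
    refine ⟨s + s', t + t', by rw [Prod.fst_add, map_add]; exact hs.add hs', by
      rw [Prod.fst_add, map_add]; exact ht.add ht', fun κ => ?_⟩
    rw [Polynomial.map_add, add_modByMonic, coeff_add, map_add, ← h, ← h']
    rfl
  zero_mem' := ⟨0, 0, by simp [Ord], by simp [Ord], fun κ => by simp⟩
  smul_mem' := by
    rintro k z ⟨s, t, hs, ht, h⟩
    refine ⟨k • s, k • t, by rw [Prod.smul_fst, map_smul]; exact hs.smul k, by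
      rw [Prod.smul_fst, map_smul]; exact ht.smul k, fun κ => ?_⟩
    rw [map_ev_mod_smul, coeff_smul, smul_eq_mul, map_mul, ← h, Prod.smul_snd, Pi.smul_apply,
      Algebra.smul_def]
    rfl

variable {P d e einf Sm Sm'}
variable {N eα eβ a b : ℕ} {ξ : e.range} {α β : e.range[X]} {ξ' : einf.range}
  {α' β' : einf.range[X]}

lemma map_ev_map {R S : Type*} [CommRing R] [CommRing S] (j : R →+* S) (s : R[X][X]) (ξ : R) :
    (s.map (evalRingHom ξ)).map j = (s.map (mapRingHom j)).map (evalRingHom (j ξ)) := by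
  rw [map_map, map_map]
  congr 1
  ext <;> simp

lemma fib_jj (A : Subalgebra K L) (ξ : A) (P : K[X][X]) :
    (fib ξ P).map (jj A) = fib (ξ : L) P := fib_map A.val ξ P

lemma pol_jj (A : Subalgebra K L) (P : K[X][X]) :
    (pol A P).map (mapRingHom (jj A)) = pol L P := pol_map A.val P

lemma coeff_relation (hC : Curve P d e einf) (hL : Loc P d e einf N eα eβ ξ α β ξ' α' β')
    (hS : Sec e einf a b Sm Sm') {c : W} {i : ℕ} {s s'}
    (h1 : Ord (pol _ P) ξ β i (Sm c) s) (h2 : Ord (pol _ (rev d P)) ξ' β' i (Sm' c) s') (κ : ℕ) :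
    jj e.range ((s.map (evalRingHom ξ) %ₘ α).coeff κ) * e (C X) ^ (N * (2 * i + κ)) =
    (-1) ^ i * jj einf.range ((s'.map (evalRingHom ξ') %ₘ α').coeff κ) *
      e (C X) ^ (a + N * (b + eβ * i)) := by
  have hx := hC.x_ne
  set x := e (C X) with hxdef
  have hX : x ^ N ≠ 0 := pow_ne_zero _ hx
  have g1 := h1.map (jj e.range)
  have g2 := h2.map (jj einf.range)
  rw [pol_jj, jj_apply, hL.hξ] at g1
  rw [pol_jj, jj_apply, hL.hξ', pol_rev] at g2
  have key := compare_coeff (d := d) (pol_monic hC.monic) (pol_TD hC.td) hX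
    (α := α.map (jj e.range)) (β := β.map (jj e.range))
    (α' := α'.map (jj einf.range)) (β' := β'.map (jj einf.range)) (by
      rw [← Polynomial.map_mul, ← hL.hαβ, fib_jj, hL.hξ]; rfl) hL.cop (hS.td c) (hS.rel c)
    hL.tβ hL.tα (hL.mα.map _) (hL.mα'.map _) g1 g2 κ
  have f1 : ((s.map (mapRingHom (jj e.range))).map (evalRingHom (x ^ N)) %ₘ
      α.map (jj e.range)) = (s.map (evalRingHom ξ) %ₘ α).map (jj e.range) := by
    rw [map_modByMonic _ hL.mα, map_ev_map, jj_apply, hL.hξ]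
  have f2 : ((s'.map (mapRingHom (jj einf.range))).map (evalRingHom (x ^ N)⁻¹) %ₘ
      α'.map (jj einf.range)) = (s'.map (evalRingHom ξ') %ₘ α').map (jj einf.range) := by
    rw [map_modByMonic _ hL.mα', map_ev_map, jj_apply, hL.hξ']
  rw [← hxdef] at key
  rw [f1, f2, coeff_map, coeff_map] at key
  set r := jj e.range ((s.map (evalRingHom ξ) %ₘ α).coeff κ)
  set r' := jj einf.range ((s'.map (evalRingHom ξ') %ₘ α').coeff κ)
  have q1 : x ^ (a + N * (b + eβ * i)) = x ^ a * ((x ^ N) ^ b * (x ^ N) ^ (eβ * i)) := by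
    rw [pow_add, pow_mul, pow_add]
  have q2 : x ^ (N * (2 * i + κ)) = ((x ^ N) ^ 2) ^ i * (x ^ N) ^ κ := by
    rw [pow_mul, pow_add, pow_mul]
  rw [q1, q2]
  set X' := x ^ N
  have hxa : x ^ a ≠ 0 := pow_ne_zero _ hx
  have q3 : (-X'⁻¹ ^ 2) ^ i = (-1) ^ i * (X'⁻¹ ^ 2) ^ i := by rw [← mul_pow]; ring
  rw [q3] at key
  have u1 : X'⁻¹ ^ (eβ * i) * X' ^ (eβ * i) = 1 := by
    rw [← mul_pow, inv_mul_cancel₀ hX, one_pow]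
  have u2 : X'⁻¹ ^ b * X' ^ b = 1 := by
    rw [← mul_pow, inv_mul_cancel₀ hX, one_pow]
  have u3 : X'⁻¹ ^ κ * X' ^ κ = 1 := by
    rw [← mul_pow, inv_mul_cancel₀ hX, one_pow]
  have u4 : (X'⁻¹ ^ 2) ^ i * (X' ^ 2) ^ i = 1 := by
    rw [← mul_pow, ← mul_pow, inv_mul_cancel₀ hX, one_pow, one_pow]
  have u5 : (x ^ a)⁻¹ * x ^ a = 1 := inv_mul_cancel₀ hxa
  calc r * ((X' ^ 2) ^ i * X' ^ κ)
      = ((x ^ a)⁻¹ * x ^ a) * (X'⁻¹ ^ (eβ * i) * X' ^ (eβ * i)) * (X'⁻¹ ^ b * X' ^ b) *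
        (r * ((X' ^ 2) ^ i * X' ^ κ)) := by rw [u1, u2, u5]; ring
    _ = ((x ^ a)⁻¹ * X'⁻¹ ^ (eβ * i) * X'⁻¹ ^ b * r) *
        (x ^ a * X' ^ (eβ * i) * X' ^ b * ((X' ^ 2) ^ i * X' ^ κ)) := by ring
    _ = _ := by rw [key]
    _ = (-1) ^ i * r' * (x ^ a * (X' ^ b * X' ^ (eβ * i))) *
        ((X'⁻¹ ^ 2) ^ i * (X' ^ 2) ^ i) * (X'⁻¹ ^ κ * X' ^ κ) := by ring
    _ = _ := by rw [u3, u4]; ring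

lemma Rel_mem (hC : Curve P d e einf) (hL : Loc P d e einf N eα eβ ξ α β ξ' α' β')
    (hS : Sec e einf a b Sm Sm') {c : W} {i : ℕ} {h : Fin eα → L}
    (hR : (c, h) ∈ Rel P d e einf Sm Sm' ξ α β ξ' β' eα i) (κ : Fin eα)
    (hle : N * (2 * i + κ) ≤ a + N * (b + eβ * i)) :
    h κ ∈ (Red K d (a + N * (b + eβ * i) - N * (2 * i + κ))).map e.toLinearMap := by
  obtain ⟨s, s', h1, h2, h3⟩ := hR
  have h4 := coeff_relation hC hL hS h1 h2 κ
  obtain ⟨H, hH⟩ := ((s.map (evalRingHom ξ) %ₘ α).coeff κ).2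
  obtain ⟨H', hH'⟩ := ((s'.map (evalRingHom ξ') %ₘ α').coeff κ).2
  rw [jj_apply, jj_apply] at h4
  have h3' : h κ = _ := h3 κ
  rw [h3', jj_apply, ← hH]
  have h5 : e H * e (C X) ^ (N * (2 * i + κ)) =
      einf ((-1) ^ i * H') * e (C X) ^ (a + N * (b + eβ * i)) := by
    rw [map_mul, map_pow, map_neg, map_one]
    change (e.toRingHom H : L) * _ = _ * (einf.toRingHom H') * _
    rw [hH, hH']; exact h4
  exact hC.mem_of_charts hle h5

lemma Rel_zero (hC : Curve P d e einf) (hL : Loc P d e einf N eα eβ ξ α β ξ' α' β')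
    (hS : Sec e einf a b Sm Sm') {c : W} {i : ℕ}
    (hR : (c, (0 : Fin eα → L)) ∈ Rel P d e einf Sm Sm' ξ α β ξ' β' eα i) :
    c ∈ Filt P d e einf Sm Sm' ξ β ξ' β' (i + 1) := by
  obtain ⟨s, s', h1, h2, h3⟩ := hR
  have h0 : s.map (evalRingHom ξ) %ₘ α = 0 := by
    ext κ
    by_cases hκ : κ < eα
    · have := h3 ⟨κ, hκ⟩
      have h4 : jj e.range ((s.map (evalRingHom ξ) %ₘ α).coeff κ) = 0 := this.symm
      exact congrArg Subtype.val ((map_eq_zero_iff _ (jj_inj e.range)).1 h4)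
    · rw [coeff_zero, coeff_eq_zero_of_degree_lt]
      refine (degree_modByMonic_lt _ hL.mα).trans_le ?_
      rw [degree_eq_natDegree hL.mα.ne_zero, hL.dα]
      exact_mod_cast (by omega : eα ≤ κ)
  have h0' : s'.map (evalRingHom ξ') %ₘ α' = 0 := by
    ext κ
    have h4 := coeff_relation hC hL hS h1 h2 κ
    rw [h0, coeff_zero, map_zero, zero_mul] at h4
    have h5 := (mul_eq_zero.1 h4.symm).resolve_right (pow_ne_zero _ hC.x_ne)
    have h6 := (mul_eq_zero.1 h5).resolve_left (pow_ne_zero _ (by simp))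
    exact congrArg Subtype.val ((map_eq_zero_iff _ (jj_inj einf.range)).1 h6)
  rw [modByMonic_eq_zero_iff_dvd hL.mα] at h0
  rw [modByMonic_eq_zero_iff_dvd hL.mα'] at h0'
  exact ⟨h1.step hL.hαβ h0, h2.step hL.hαβ' h0'⟩

end filt

end NT
end

section
open Polynomial

namespace NT

section pts
variable {K L : Type*} [Field K] [Field L] [Algebra K L]

lemma fib_eq_eval₂ {R : Type*} [CommRing R] [Algebra K R] (ξ : R) (P : K[X][X]) :
    fib ξ P = eval₂ (eval₂RingHom ((C : R →+* R[X]).comp (algebraMap K R)) (C ξ)) X P := by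
  rw [fib, pol, map_map, ← eval₂_C_X (p := P.map _), eval₂_map]
  congr 1
  ext <;> simp

lemma fib_rev_comp {P : K[X][X]} {d : ℕ} (h : TD P d) {ξ : L} (hξ : ξ ≠ 0) :
    (fib ξ⁻¹ (rev d P)).comp (C ξ⁻¹ * X) = C (ξ⁻¹ ^ d) * fib ξ P := by
  have h1 := rev_eval (S := L[X]) ((C : L →+* L[X]).comp (algebraMap K L)) (x := C ξ)
    (z := C ξ⁻¹) (y := X) (by rw [← C_mul, mul_inv_cancel₀ hξ, C_1]) h
  rw [← fib_eq_eval₂] at h1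
  rw [← h1]
  have h2 : (fib ξ⁻¹ (rev d P)).comp (C ξ⁻¹ * X) =
      eval₂ (eval₂RingHom ((C : L →+* L[X]).comp (algebraMap K L)) (C ξ⁻¹)) (X * C ξ⁻¹)
        (rev d P) := by
    rw [comp, fib, pol, map_map, eval₂_map, mul_comm]
    congr 1
    ext <;> simp
  rw [← h2]
  have h3 : C (ξ⁻¹ ^ d) * C ξ ^ d = 1 := by
    rw [← C_pow, ← C_mul, ← mul_pow, inv_mul_cancel₀ hξ, one_pow, C_1]
  linear_combination (-(fib ξ⁻¹ (rev d P)).comp (C ξ⁻¹ * X)) * h3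

variable {P : K[X][X]} {d : ℕ} {e einf : K[X][X] →ₐ[K] L}

/-- coordinates -/
noncomputable def xr (e : K[X][X] →ₐ[K] L) : e.range := e.rangeRestrict (C X)
noncomputable def yr (e : K[X][X] →ₐ[K] L) : e.range := e.rangeRestrict X

lemma rho_jj (A : Subalgebra K L) (ξ η : A) (P : K[X][X]) :
    (rho ξ η P).map (jj A) = rho (ξ : L) (η : L) P := rho_map A.val ξ η P

structure Pt (P : K[X][X]) (e : K[X][X] →ₐ[K] L) (N : ℕ) : Prop where
  root : (fib (e (C X) ^ N) P).eval (e X ^ N) = 0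
  der : (derivative (fib (e (C X) ^ N) P)).eval (e X ^ N) ≠ 0

variable {N : ℕ}

lemma Pt.root_r (h : Pt P e N) : (fib (xr e ^ N) P).eval (yr e ^ N) = 0 := by
  apply jj_inj
  rw [map_zero, ← h.root, ← eval_map_apply, fib_jj]
  rfl

lemma Pt.rho_eval (h : Pt P e N) :
    (rho (e (C X) ^ N) (e X ^ N) P).eval (e X ^ N) ≠ 0 := by
  have h1 := h.der
  rw [fib_eq_mul h.root, derivative_mul, derivative_X_sub_C, eval_add, eval_mul, eval_mul,
    eval_sub, eval_X, eval_C, sub_self, zero_mul, add_zero, eval_one, one_mul] at h1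
  exact h1

lemma Pt.cop (h : Pt P e N) :
    IsCoprime (X - C (e X ^ N)) (rho (e (C X) ^ N) (e X ^ N) P) := by
  rw [(irreducible_X_sub_C _).coprime_iff_not_dvd, dvd_iff_isRoot]
  exact h.rho_eval

variable (hC : Curve P d e einf)
include hC

lemma Pt.root_inf (h : Pt P e N) :
    (fib ((e (C X) ^ N)⁻¹) (rev d P)).eval ((e (C X) ^ N)⁻¹ * e X ^ N) = 0 := by
  have h1 := congrArg (eval (e X ^ N)) (fib_rev_comp hC.td (pow_ne_zero N hC.x_ne))
  rw [eval_comp, eval_mul, eval_mul, h.root, mul_zero, eval_C, eval_X] at h1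
  exact h1

lemma xr_inf : ((xr einf ^ N : einf.range) : L) = (e (C X) ^ N)⁻¹ := by
  change einf (C X) ^ N = _
  rw [hC.inf_x, inv_pow]

lemma yr_inf : ((yr einf ^ N : einf.range) : L) = (e (C X) ^ N)⁻¹ * e X ^ N := by
  change einf X ^ N = _
  rw [hC.iy, hC.inf_x, mul_pow, inv_pow, mul_comm]

lemma Pt.root_r_inf (h : Pt P e N) : (fib (xr einf ^ N) (rev d P)).eval (yr einf ^ N) = 0 := by
  apply jj_inj
  rw [map_zero, ← h.root_inf hC, ← eval_map_apply, fib_jj, xr_inf hC, jj_apply, yr_inf hC]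

lemma lin_comp : ((X - C (yr einf ^ N)).map (jj einf.range)).comp (C (e (C X) ^ N)⁻¹ * X) =
    C ((e (C X) ^ N)⁻¹ ^ 1) * (X - C (yr e ^ N)).map (jj e.range) := by
  rw [Polynomial.map_sub, Polynomial.map_sub, map_X, map_X, map_C, map_C, jj_apply, yr_inf hC,
    jj_apply]
  change _ = C ((e (C X) ^ N)⁻¹ ^ 1) * (X - C (e X ^ N))
  rw [sub_comp, X_comp, C_comp, C_mul, pow_one]
  ring

lemma rho_comp (h : Pt P e N) :
    ((rho (xr einf ^ N) (yr einf ^ N) (rev d P)).map (jj einf.range)).comp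
      (C (e (C X) ^ N)⁻¹ * X) =
    C ((e (C X) ^ N)⁻¹ ^ (d - 1)) * (rho (xr e ^ N) (yr e ^ N) P).map (jj e.range) := by
  have hX := pow_ne_zero N hC.x_ne
  have h1 := fib_rev_comp hC.td hX
  have h2 := congrArg (fun t => (t.map (jj einf.range)).comp (C (e (C X) ^ N)⁻¹ * X))
    (fib_eq_mul (h.root_r_inf hC))
  have h3 := congrArg (fun t => t.map (jj e.range)) (fib_eq_mul h.root_r)
  simp only [Polynomial.map_mul, mul_comp] at h2 h3
  rw [fib_jj, xr_inf hC, h1, lin_comp hC] at h2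
  rw [fib_jj] at h3
  have h4 : ((xr e ^ N : e.range) : L) = e (C X) ^ N := rfl
  rw [h4] at h3
  rw [h3] at h2
  have h5 : (X - C (yr e ^ N)).map (jj e.range) ≠ 0 := ((monic_X_sub_C _).map _).ne_zero
  have h6 : C ((e (C X) ^ N)⁻¹ ^ 1) ≠ 0 := by
    rw [Ne, C_eq_zero]; exact pow_ne_zero _ (inv_ne_zero hX)
  apply mul_left_cancel₀ (mul_ne_zero h6 h5)
  rw [← h2]
  have h7 : C ((e (C X) ^ N)⁻¹ ^ d) = C ((e (C X) ^ N)⁻¹ ^ 1) * C ((e (C X) ^ N)⁻¹ ^ (d - 1)) := by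
    rw [← C_mul, ← pow_add]; congr 2; have := hC.pos; omega
  rw [h7]; ring

lemma loc_gamma (h : Pt P e N) : Loc P d e einf N 1 (d - 1)
    (xr e ^ N) (X - C (yr e ^ N)) (rho (xr e ^ N) (yr e ^ N) P)
    (xr einf ^ N) (X - C (yr einf ^ N)) (rho (xr einf ^ N) (yr einf ^ N) (rev d P)) where
  hξ := rfl
  hξ' := xr_inf hC
  hαβ := fib_eq_mul h.root_r
  hαβ' := fib_eq_mul (h.root_r_inf hC)
  mα := monic_X_sub_C _
  mα' := monic_X_sub_C _
  dα := natDegree_X_sub_C _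
  cop := by
    have := h.cop
    rw [rho_jj, Polynomial.map_sub, map_X, map_C]
    exact this
  tα := lin_comp hC
  tβ := rho_comp hC h

lemma loc_delta (h : Pt P e N) : Loc P d e einf N (d - 1) 1
    (xr e ^ N) (rho (xr e ^ N) (yr e ^ N) P) (X - C (yr e ^ N))
    (xr einf ^ N) (rho (xr einf ^ N) (yr einf ^ N) (rev d P)) (X - C (yr einf ^ N)) where
  hξ := rfl
  hξ' := xr_inf hC
  hαβ := by rw [mul_comm]; exact fib_eq_mul h.root_r
  hαβ' := by rw [mul_comm]; exact fib_eq_mul (h.root_r_inf hC)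
  mα := rho_monic hC.monic h.root_r
  mα' := rho_monic (rev_monic hC.td hC.monic hC.deg) (h.root_r_inf hC)
  dα := by rw [rho_natDegree hC.monic h.root_r, hC.deg]
  cop := by
    have := h.cop
    rw [rho_jj, Polynomial.map_sub, map_X, map_C]
    exact this.symm
  tα := rho_comp hC h
  tβ := lin_comp hC

end pts

end NT
end

section
open Polynomial

namespace NT

section revlin
variable {R : Type*} [CommRing R]

lemma rev_add (m : ℕ) (s t : R[X][X]) : rev m (s + t) = rev m s + rev m t := by
  ext1 n
  rw [coeff_add, rev_coeff, rev_coeff, rev_coeff, coeff_add]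
  split_ifs <;> simp

lemma rev_zero (m : ℕ) : rev m (0 : R[X][X]) = 0 := by
  ext1 n
  rw [rev_coeff]
  split_ifs <;> simp

lemma rev_sum (m : ℕ) {ι : Type*} (A : Finset ι) (f : ι → R[X][X]) :
    rev m (∑ z ∈ A, f z) = ∑ z ∈ A, rev m (f z) := by
  classical
  induction A using Finset.induction_on with
  | empty => simp [rev_zero]
  | insert z A hz ih => rw [Finset.sum_insert hz, Finset.sum_insert hz, rev_add, ih]

lemma rev_CC_mul (m : ℕ) (c : R) (s : R[X][X]) : rev m (C (C c) * s) = C (C c) * rev m s := by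
  ext1 n
  rw [coeff_C_mul, rev_coeff, rev_coeff, coeff_C_mul]
  split_ifs <;> simp [reflect_C_mul]

lemma rev_monomial {m n β : ℕ} (h : n + β ≤ m) (c : R) :
    rev m (C (C c * X ^ n) * X ^ β) = C (C c * X ^ (m - β - n)) * X ^ β := by
  ext1 k
  rw [rev_coeff, coeff_C_mul, coeff_C_mul, coeff_X_pow]
  by_cases hk : k = β
  · subst hk
    simp only [if_true, mul_one]
    rw [if_pos (by omega), reflect_C_mul_X_pow, revAt_le (by omega)]
  · simp [hk]

lemma TD_monomial {m n β : ℕ} (h : n + β ≤ m) (c : R) : TD (C (C c * X ^ n) * X ^ β) m := by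
  intro k hk
  rw [coeff_C_mul, coeff_X_pow] at hk ⊢
  by_cases hkb : k = β
  · subst hkb
    simp only [if_true, mul_one]
    have := natDegree_C_mul_X_pow_le c n
    omega
  · simp [hkb] at hk

end revlin

section sec
variable {K L : Type*} [Field K] [Field L] [Algebra K L]

def idx (d b : ℕ) : Finset (ℕ × ℕ) :=
  (Finset.range (b + 1) ×ˢ Finset.range d).filter (fun z => z.1 + z.2 ≤ b)

lemma mem_idx {d b : ℕ} {z : ℕ × ℕ} : z ∈ idx d b ↔ z.1 + z.2 ≤ b ∧ z.2 < d := by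
  rcases z with ⟨n, β⟩
  simp only [idx, Finset.mem_filter, Finset.mem_product, Finset.mem_range]
  omega

lemma card_idx (d b : ℕ) : (idx d b).card = Dm d b := by
  rw [idx, Finset.card_filter, Finset.sum_product_right, Dm]
  refine Finset.sum_congr rfl fun β _ => ?_
  rw [← Finset.card_filter]
  have : (Finset.range (b + 1)).filter (fun n => n + β ≤ b) = Finset.range (b + 1 - β) := by
    ext n
    simp only [Finset.mem_filter, Finset.mem_range]
    omega
  rw [this, Finset.card_range]

variable (K) in
abbrev WW (d a b : ℕ) := (idx d b) → Red K d a

lemma finrank_WW (d a b : ℕ) : Module.finrank K (WW K d a b) = Dm d b * Dm d a := by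
  rw [(LinearEquiv.piCongrRight (fun _ : idx d b => redEquiv (K := K) d a)).finrank_eq,
    Module.finrank_pi_fintype]
  simp only [← (redEquiv (K := K) d a).finrank_eq, finrank_Red, Finset.sum_const, smul_eq_mul]
  rw [Finset.card_univ, Fintype.card_coe, card_idx]

instance (d a b : ℕ) : FiniteDimensional K (WW K d a b) :=
  Module.Finite.equiv (LinearEquiv.piCongrRight (fun _ : idx d b => redEquiv (K := K) d a)).symm

noncomputable def SmF {R : Type*} [CommRing R] (d a b : ℕ) (π : K[X][X] →+* R)
    (c : WW K d a b) : R[X][X] :=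
  ∑ z : idx d b, C (C (π (c z).1) * X ^ z.1.1) * X ^ z.1.2

noncomputable def Sm (e : K[X][X] →ₐ[K] L) (d a b : ℕ) : WW K d a b →ₗ[K] e.range[X][X] where
  toFun c := SmF d a b (e.rangeRestrict : K[X][X] →+* e.range) c
  map_add' c c' := by
    simp only [SmF, ← Finset.sum_add_distrib]
    refine Finset.sum_congr rfl fun z _ => ?_
    simp [add_mul]
  map_smul' k c := by
    simp only [SmF, RingHom.id_apply, Finset.smul_sum]
    refine Finset.sum_congr rfl fun z _ => ?_
    rw [smul_eq_CC]
    have : (e.rangeRestrict : K[X][X] →+* e.range) ((k • c) z).1 =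
        algebraMap K e.range k * (e.rangeRestrict : K[X][X] →+* e.range) (c z).1 := by
      change e.rangeRestrict (k • (c z).1) = _
      rw [map_smul, Algebra.smul_def]; rfl
    rw [this]
    simp only [C_mul]
    ring

noncomputable def Sm' (einf : K[X][X] →ₐ[K] L) (d a b : ℕ) :
    WW K d a b →ₗ[K] einf.range[X][X] where
  toFun c := ∑ z : idx d b, C (C (einf.rangeRestrict (rev a (c z).1)) *
    X ^ (b - z.1.2 - z.1.1)) * X ^ z.1.2
  map_add' c c' := by
    simp only [← Finset.sum_add_distrib]
    refine Finset.sum_congr rfl fun z _ => ?_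
    simp [add_mul, rev_add]
  map_smul' k c := by
    simp only [RingHom.id_apply, Finset.smul_sum]
    refine Finset.sum_congr rfl fun z _ => ?_
    rw [smul_eq_CC]
    have : einf.rangeRestrict (rev a ((k • c) z).1) =
        algebraMap K einf.range k * einf.rangeRestrict (rev a (c z).1) := by
      change einf.rangeRestrict (rev a (k • (c z).1)) = _
      rw [smul_eq_CC, rev_CC_mul, ← smul_eq_CC, map_smul, Algebra.smul_def]
    rw [this]
    simp only [C_mul]
    ring

variable {P : K[X][X]} {d : ℕ} {e einf : K[X][X] →ₐ[K] L}

lemma Sm_map {a b : ℕ} (c : WW K d a b) : (Sm e d a b c).map (mapRingHom (jj e.range)) =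
    ∑ z : idx d b, C (C (e (c z).1) * X ^ z.1.1) * X ^ z.1.2 := by
  change (SmF d a b (e.rangeRestrict : K[X][X] →+* e.range) c).map _ = _
  rw [SmF, Polynomial.map_sum]
  refine Finset.sum_congr rfl fun z _ => ?_
  simp
  rfl

lemma sec_WW (hC : Curve P d e einf) (a b : ℕ) : Sec (W := WW K d a b) e einf a b (Sm e d a b) (Sm' einf d a b) where
  td c := by
    rw [Sm_map]
    exact TD.sum fun z _ => TD_monomial (mem_idx.1 z.2).1 _
  rel c := by
    rw [Sm_map, rev_sum, Finset.mul_sum]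
    change (∑ z : idx d b, C (C (einf.rangeRestrict (rev a (c z).1)) *
      X ^ (b - z.1.2 - z.1.1)) * X ^ z.1.2).map _ = _
    rw [Polynomial.map_sum]
    refine Finset.sum_congr rfl fun z _ => ?_
    rw [rev_monomial (mem_idx.1 z.2).1, ← hC.rev_eq (c z).2.1]
    have h1 : jj einf.range (einf.rangeRestrict (rev a (c z).1)) = einf (rev a (c z).1) := rfl
    simp only [Polynomial.map_mul, Polynomial.map_pow, map_X, map_C, coe_mapRingHom, h1, C_mul]
    have h2 : (C (C (e (C X) ^ a)⁻¹) : L[X][X]) * C (C (e (C X) ^ a)) = 1 := by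
      rw [← C_mul, ← C_mul, inv_mul_cancel₀ (pow_ne_zero _ hC.x_ne), C_1, C_1]
    linear_combination (-C (C (einf (rev a (c z).1))) * C (X ^ (b - z.1.2 - z.1.1)) *
      X ^ z.1.2) * h2

end sec

end NT
end

section
open Polynomial

namespace NT

section gd
variable {R : Type*} [CommRing R]

/-- evaluation at a point -/
noncomputable def E2 (ξ η : R) : R[X][X] →+* R := (evalRingHom η).comp (mapRingHom (evalRingHom ξ))

lemma E2_apply (ξ η : R) (t : R[X][X]) : E2 ξ η t = (t.map (evalRingHom ξ)).eval η := rfl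

lemma E2_C (ξ η : R) (f : R[X]) : E2 ξ η (C f) = f.eval ξ := by simp [E2_apply]

lemma E2_mapC (ξ η : R) (f : R[X]) : E2 ξ η (f.map C) = f.eval η := by
  rw [E2_apply, map_C_map_eval]

variable [IsDomain R]

lemma gd {p S s t : R[X][X]} {ξ x η y : R} {ρ : R[X]} {i v : ℕ} (hpm : p.Monic)
    (hp : p.map (evalRingHom ξ) = (X - C η) * ρ) (hξx : ξ ≠ x) (hρ : ρ.eval η ≠ 0)
    (h1 : Ord p x (X - C y) v S t) (h2 : Ord p ξ ρ i S s) :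
    ∃ h', (s.map (evalRingHom ξ)).eval η * (η - y) ^ v = (ξ - x) ^ v * h' := by
  have hEp : E2 ξ η p = 0 := by rw [E2_apply, hp]; simp
  have aux : ∀ k ≤ i, ∀ w, Ord p ξ ρ k t w →
    E2 ξ η (C (X - C ξ)) ^ (i - k) * E2 ξ η s * (η - y) ^ v =
    (ξ - x) ^ v * ρ.eval η ^ (i - k) * E2 ξ η w := by
    intro k hk w hw
    have h3 : p ∣ C (X - C ξ) ^ k * (C (X - C ξ) ^ (i - k) * s * ((X - C y).map C) ^ v -
        C (X - C x) ^ v * (ρ.map C) ^ (i - k) * w) := by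
      have f1 := h2.mul_right (((X - C y).map C) ^ v)
      have f2 := h1.mul_right ((ρ.map C) ^ i)
      have f3 := (hw : p ∣ _).mul_right (C (X - C x) ^ v * (ρ.map C) ^ (i - k))
      have f4 := dvd_sub (dvd_sub f2 f1) (dvd_neg.2 f3)
      convert f4 using 1
      have e1 : (C (X - C ξ) : R[X][X]) ^ i = C (X - C ξ) ^ k * C (X - C ξ) ^ (i - k) := by
        rw [← pow_add]; congr 1; omega
      have e2 : (ρ.map C) ^ i = (ρ.map C) ^ k * (ρ.map C) ^ (i - k) := by
        rw [← pow_add]; congr 1; omega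
      rw [e1, e2]
      ring
    rw [← C_pow] at h3
    have h4 := dvd_cancel hpm (pow_ne_zero _ (X_sub_C_ne_zero ξ)) h3
    have h5 := map_dvd (E2 ξ η) h4
    rw [hEp, zero_dvd_iff, map_sub, sub_eq_zero] at h5
    simp only [map_mul, map_pow, E2_mapC] at h5
    rw [E2_C ξ η (X - C x)] at h5
    simpa using h5
  have key : ∀ k ≤ i, ∃ w, Ord p ξ ρ k t w ∧
      E2 ξ η (C (X - C ξ)) ^ (i - k) * E2 ξ η s * (η - y) ^ v =
      (ξ - x) ^ v * ρ.eval η ^ (i - k) * E2 ξ η w := by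
    intro k hk
    induction k with
    | zero => exact ⟨t, Ord.zero _ _ _ _, aux 0 hk t (Ord.zero _ _ _ _)⟩
    | succ k ih =>
      obtain ⟨w, hw, hE⟩ := ih (by omega)
      have h0 : E2 ξ η w = 0 := by
        rw [E2_C, eval_sub, eval_X, eval_C, sub_self, zero_pow (by omega), zero_mul, zero_mul] at hE
        have := mul_eq_zero.1 hE.symm
        refine this.resolve_left (mul_ne_zero (pow_ne_zero _ (sub_ne_zero.2 hξx)) (pow_ne_zero _ hρ))
      obtain ⟨w', hw'⟩ := hw.step hp (by rw [dvd_iff_isRoot]; exact h0)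
      exact ⟨w', hw', aux _ hk w' hw'⟩
  obtain ⟨w, -, hE⟩ := key i le_rfl
  refine ⟨E2 ξ η w, ?_⟩
  rw [Nat.sub_self, pow_zero, pow_zero, one_mul, mul_one] at hE
  exact hE

end gd

end NT
end

section
open Polynomial

namespace NT

section norm
variable {K : Type*} [Field K]

lemma sum_rootMultiplicity_le (s : Finset K) {f : K[X]} :
    ∑ a ∈ s, f.rootMultiplicity a ≤ f.natDegree := by
  classical
  calc ∑ a ∈ s, f.rootMultiplicity a = ∑ a ∈ s, f.roots.count a := by
        refine Finset.sum_congr rfl fun a _ => (count_roots f).symm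
    _ ≤ ∑ a ∈ s ∪ f.roots.toFinset, f.roots.count a :=
        Finset.sum_le_sum_of_subset Finset.subset_union_left
    _ = f.roots.card := Multiset.sum_count_eq_card (by
        intro a ha; simp only [Finset.mem_union, Multiset.mem_toFinset]; exact Or.inr ha)
    _ ≤ f.natDegree := card_roots' f

/-- total contact number -/
noncomputable def Om (Fq : Finset K) (P : K[X][X]) : ℕ :=
  ∑ x0 ∈ Fq, ∑ c ∈ Fq, (P.eval (C c)).rootMultiplicity x0

variable {P : K[X][X]} {d q m v : ℕ} {Fq : Finset K}

lemma rootMult_prod {ι : Type*} (s : Finset ι) (f : ι → K[X]) (hf : ∀ i ∈ s, f i ≠ 0) (a : K) :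
    (∏ i ∈ s, f i).rootMultiplicity a = ∑ i ∈ s, (f i).rootMultiplicity a := by
  classical
  induction s using Finset.induction_on with
  | empty => simp [rootMultiplicity_eq_zero]
  | insert z A hz ih =>
    rw [Finset.prod_insert hz, Finset.sum_insert hz, rootMultiplicity_mul, ih]
    · exact fun i hi => hf i (Finset.mem_insert_of_mem hi)
    · rw [← Finset.prod_insert hz]
      exact Finset.prod_ne_zero_iff.2 hf

lemma norm_bound (hPm : P.Monic) (hPd : P.natDegree = d) (hPT : TD P d) (hirr : Irreducible P)
    (hcard : Fq.card = q) (hFq : ∏ c ∈ Fq, (X - C c) = (X ^ q - X : K[X]))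
    (hPc : ∀ c ∈ Fq, P.eval (C c) ≠ 0) {H H' : K[X][X]} (hH : TD H m) (hPH : ¬ P ∣ H)
    (hd : P ∣ H * (X ^ q - X) ^ v - C (X ^ q - X) ^ v * H') :
    d * q * v ≤ d * m + v * Om Fq P := by
  classical
  have hN := Nm_ne_zero hPm hirr hPH
  have hdeg := natDegree_Nm_le hPm hPd hPT hH
  have h1 := Nm_congr hPm hd
  rw [Nm_mul hPm, Nm_mul hPm, Nm_pow hPm, Nm_pow hPm, Nm_C hPm, hPd] at h1
  have hFqY : ∏ c ∈ Fq, (X - C (C c)) = (X ^ q - X : K[X][X]) := by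
    have := congrArg (Polynomial.map (C : K →+* K[X])) hFq
    simpa [Polynomial.map_prod] using this
  have h2 : Nm P (X ^ q - X) = ∏ c ∈ Fq, ((-1) ^ d * P.eval (C c)) := by
    rw [← hFqY, Nm_prod hPm]
    refine Finset.prod_congr rfl fun c _ => ?_
    rw [Nm_X_sub_C hPm, hPd]
  have hne : ∀ c ∈ Fq, ((-1) ^ d * P.eval (C c) : K[X]) ≠ 0 := fun c hc =>
    mul_ne_zero (pow_ne_zero _ (by simp)) (hPc c hc)
  have h3 : ∀ x0 ∈ Fq, d * v ≤ (Nm P H).rootMultiplicity x0 +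
      v * ∑ c ∈ Fq, (P.eval (C c)).rootMultiplicity x0 := by
    intro x0 hx0
    have hne2 : Nm P (X ^ q - X) ^ v ≠ 0 := by
      rw [h2]; exact pow_ne_zero _ (Finset.prod_ne_zero_iff.2 hne)
    have h4 : (Nm P H * Nm P (X ^ q - X) ^ v).rootMultiplicity x0 =
      (Nm P H).rootMultiplicity x0 + v * ∑ c ∈ Fq, (P.eval (C c)).rootMultiplicity x0 := by
      rw [rootMultiplicity_mul (mul_ne_zero hN hne2), ← count_roots (Nm P (X ^ q - X) ^ v),
        roots_pow, Multiset.count_nsmul, count_roots, h2, rootMult_prod _ _ hne]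
      congr 2
      refine Finset.sum_congr rfl fun c hc => ?_
      rw [rootMultiplicity_mul (hne c hc)]
      have : ((-1) ^ d : K[X]).rootMultiplicity x0 = 0 := by
        apply rootMultiplicity_eq_zero
        simp [IsRoot]
      rw [this, zero_add]
    rw [← h4, le_rootMultiplicity_iff (mul_ne_zero hN hne2), h1]
    refine Dvd.dvd.mul_right ?_ _
    rw [← pow_mul, mul_comm d v]
    apply pow_dvd_pow_of_dvd
    rw [← hFq]
    exact Finset.dvd_prod_of_mem _ hx0
  have h5 := Finset.sum_le_sum h3
  rw [Finset.sum_const, hcard, smul_eq_mul, Finset.sum_add_distrib, ← Finset.mul_sum] at h5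
  have h6 := sum_rootMultiplicity_le Fq (f := Nm P H)
  have h7 : Om Fq P = ∑ x0 ∈ Fq, ∑ c ∈ Fq, (P.eval (C c)).rootMultiplicity x0 := rfl
  rw [← h7] at h5
  calc d * q * v = q * (d * v) := by ring
    _ ≤ _ := h5
    _ ≤ d * m + v * Om Fq P := by omega

end norm

end NT
end

section
open Polynomial

namespace NT

section drop
variable {K L : Type*} [Field K] [Field L] [Algebra K L]
variable {P : K[X][X]} {d : ℕ} {e einf : K[X][X] →ₐ[K] L}

lemma Red_mono {d m m' : ℕ} (h : m ≤ m') : Red K d m ≤ Red K d m' :=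
  fun _ hH => ⟨hH.1.mono h, hH.2⟩

variable (P d e einf) in
/-- order `j` along the residual of the diagonal -/
noncomputable def FD (a b j : ℕ) : Submodule K (WW K d a b) :=
  Filt (W := WW K d a b) P d e einf (Sm e d a b) (Sm' einf d a b) (xr e ^ 1) (X - C (yr e ^ 1))
    (xr einf ^ 1) (X - C (yr einf ^ 1)) j

variable (P d e einf) in
/-- order `i` along the graph of Frobenius -/
noncomputable def FG (q a b i : ℕ) : Submodule K (WW K d a b) :=
  Filt (W := WW K d a b) P d e einf (Sm e d a b) (Sm' einf d a b) (xr e ^ q) (rho (xr e ^ q) (yr e ^ q) P)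
    (xr einf ^ q) (rho (xr einf ^ q) (yr einf ^ q) (rev d P)) i

lemma FD_zero (a b : ℕ) : FD P d e einf a b 0 = ⊤ := by
  rw [eq_top_iff]
  exact fun c _ => ⟨⟨_, Ord.zero _ _ _ _⟩, _, Ord.zero _ _ _ _⟩

lemma FG_zero (q a b : ℕ) : FG P d e einf q a b 0 = ⊤ := by
  rw [eq_top_iff]
  exact fun c _ => ⟨⟨_, Ord.zero _ _ _ _⟩, _, Ord.zero _ _ _ _⟩

lemma FD_drop (hC : Curve P d e einf) (h1 : Pt P e 1) {a b j : ℕ} (hj : j + d ≤ a + b) :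
    Module.finrank K (FD P d e einf a b j) ≤ Module.finrank K (FD P d e einf a b (j + 1)) +
      (d - 1) * (d * (a + b - j + 1)) := by
  have hL := loc_delta hC h1
  have hS := sec_WW hC a b
  let f0 : Red K d (a + b - j) →ₗ[K] L := e.toLinearMap.comp (Red K d (a + b - j)).subtype
  let f : (Fin (d - 1) → Red K d (a + b - j)) →ₗ[K] (Fin (d - 1) → L) :=
    LinearMap.pi fun κ => f0.comp (LinearMap.proj κ)
  have hfin : FiniteDimensional K (Fin (d - 1) → Red K d (a + b - j)) :=
    Module.Finite.equiv (LinearEquiv.piCongrRight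
      (fun _ : Fin (d - 1) => redEquiv (K := K) d (a + b - j))).symm
  have hT : Module.finrank K (LinearMap.range f) ≤ (d - 1) * (d * (a + b - j + 1)) := by
    refine (LinearMap.finrank_range_le f).trans ?_
    rw [(LinearEquiv.piCongrRight
      (fun _ : Fin (d - 1) => redEquiv (K := K) d (a + b - j))).finrank_eq,
      Module.finrank_pi_fintype]
    simp only [← (redEquiv (K := K) d (a + b - j)).finrank_eq, finrank_Red, Finset.sum_const,
      smul_eq_mul, Finset.card_univ, Fintype.card_fin]
    exact Nat.mul_le_mul_left _ (Dm_le _ _)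
  refine (finrank_relation (FD P d e einf a b j) (FD P d e einf a b (j + 1)) (LinearMap.range f)
    (Rel (W := WW K d a b) P d e einf (Sm e d a b) (Sm' einf d a b) (xr e ^ 1) (rho (xr e ^ 1) (yr e ^ 1) P)
      (X - C (yr e ^ 1)) (xr einf ^ 1) (X - C (yr einf ^ 1)) (d - 1) j) ?_ ?_).trans (Nat.add_le_add_left hT _)
  · rintro c ⟨⟨s, hs⟩, s', hs'⟩
    have hR : ((c, fun κ => jj e.range ((s.map (evalRingHom (xr e ^ 1)) %ₘ
        (rho (xr e ^ 1) (yr e ^ 1) P)).coeff κ)) : WW K d a b × (Fin (d - 1) → L)) ∈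
        Rel (W := WW K d a b) P d e einf (Sm e d a b) (Sm' einf d a b) (xr e ^ 1) (rho (xr e ^ 1) (yr e ^ 1) P)
      (X - C (yr e ^ 1)) (xr einf ^ 1) (X - C (yr einf ^ 1)) (d - 1) j :=
      ⟨s, s', hs, hs', fun _ => rfl⟩
    refine ⟨_, ?_, hR⟩
    have hm := fun κ : Fin (d - 1) => Rel_mem hC hL hS hR κ (by have := κ.2; omega)
    choose g hg hg' using hm
    refine ⟨fun κ => ⟨g κ, Red_mono (by have := κ.2; omega) (hg κ)⟩, ?_⟩
    funext κ
    exact hg' κ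
  · intro c _ h0
    exact Rel_zero hC hL hS h0

lemma FD_codim (hC : Curve P d e einf) (h1 : Pt P e 1) {a b : ℕ} (v : ℕ) (hj : v + d ≤ a + b) :
    Dm d b * Dm d a ≤ Module.finrank K (FD P d e einf a b v) +
      ∑ j ∈ Finset.range v, (d - 1) * (d * (a + b - j + 1)) := by
  induction v with
  | zero => rw [FD_zero, finrank_top, finrank_WW]; simp
  | succ v ih =>
    have := ih (by omega)
    have := FD_drop hC h1 (a := a) (b := b) (j := v) (by omega)
    rw [Finset.sum_range_succ]
    omega

end drop

end NT
end

section
open Polynomial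

namespace NT

section dropG
variable {K L : Type*} [Field K] [Field L] [Algebra K L]
variable {P : K[X][X]} {d : ℕ} {e einf : K[X][X] →ₐ[K] L}

lemma not_dvd_C {R : Type*} [CommRing R] [IsDomain R] {P : R[X]} (hd : 0 < P.natDegree)
    {f : R} (hf : f ≠ 0) : ¬ P ∣ C f := by
  intro h
  have := natDegree_le_of_dvd h (C_ne_zero.2 hf)
  rw [natDegree_C] at this
  omega

lemma FG_drop (hC : Curve P d e einf) {q : ℕ} (hq : 2 ≤ q) (h1 : Pt P e q)
    (hirr : Irreducible P) {Fq : Finset K}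
    (hcard : Fq.card = q) (hFq : ∏ c ∈ Fq, (X - C c) = (X ^ q - X : K[X]))
    (hPc : ∀ c ∈ Fq, P.eval (C c) ≠ 0)
    {a b v i m' M : ℕ} (hM : M + 2 * q * i = a + q * (b + (d - 1) * i)) (hm' : m' ≤ M)
    (hlt : d * m' + v * Om Fq P < d * q * v) :
    Module.finrank K (FD P d e einf a b v ⊓ FG P d e einf q a b i : Submodule K (WW K d a b)) +
      Dm d m' ≤
    Module.finrank K (FD P d e einf a b v ⊓ FG P d e einf q a b (i + 1) :
      Submodule K (WW K d a b)) + Dm d M := by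
  have hL := loc_gamma hC h1
  have hS := sec_WW hC a b
  have hxx : xr e ^ q ≠ xr e ^ 1 := by
    intro h
    have h2 : e (C X) ^ q = e (C X) ^ 1 := congrArg Subtype.val h
    rw [← sub_eq_zero, pow_one, ← map_pow e, ← map_sub e, hC.ker, ← C_pow, ← C_sub] at h2
    refine not_dvd_C (by rw [hC.deg]; exact hC.pos) ?_ h2
    exact FiniteField.X_pow_card_sub_X_ne_zero K (by omega)
  have hrho : (rho (xr e ^ q) (yr e ^ q) P).eval (yr e ^ q) ≠ 0 := by
    intro h
    apply h1.rho_eval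
    have := congrArg (jj e.range) h
    rw [map_zero, ← eval_map_apply, rho_jj] at this
    exact this
  let Rl := Rel (W := WW K d a b) P d e einf (Sm e d a b) (Sm' einf d a b) (xr e ^ q)
    (X - C (yr e ^ q)) (rho (xr e ^ q) (yr e ^ q) P)
    (xr einf ^ q) (rho (xr einf ^ q) (yr einf ^ q) (rev d P)) 1 i
  let G1 : Submodule K (WW K d a b × L) := Rl.comap
    (LinearMap.prodMap LinearMap.id (LinearMap.pi fun _ : Fin 1 => LinearMap.id))
  let Mi : Submodule K (WW K d a b) := FD P d e einf a b v ⊓ FG P d e einf q a b i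
  let T : Submodule K L := (G1 ⊓ Mi.comap (LinearMap.fst K _ _)).map (LinearMap.snd K _ _)
  let A := (Red K d M).map e.toLinearMap
  let A' := (Red K d m').map e.toLinearMap
  have hA : FiniteDimensional K A := inferInstance
  have hTA : T ≤ A := by
    rintro _ ⟨⟨c, h⟩, ⟨hG, hc⟩, rfl⟩
    have hR : ((c, fun _ => h) : WW K d a b × (Fin 1 → L)) ∈ Rl := hG
    have := Rel_mem hC hL hS hR 0 (by simp; nlinarith)
    have hexp : a + q * (b + (d - 1) * i) - q * (2 * i + ((0 : Fin 1) : ℕ)) = M := by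
      rw [← hM, Fin.val_zero, add_zero]
      have : q * (2 * i) = 2 * q * i := by ring
      omega
    rw [hexp] at this
    exact this
  have hdis : ∀ h ∈ T, h ∈ A' → h = 0 := by
    rintro _ ⟨⟨c, h⟩, ⟨hG, hc⟩, rfl⟩ ⟨H, hH, hHe⟩
    change h = 0
    obtain ⟨s, s', hs, hs', hh⟩ := (hG : ((c, fun _ => h) : WW K d a b × (Fin 1 → L)) ∈ Rl)
    obtain ⟨⟨⟨t, ht⟩, -⟩, -⟩ := hc
    have h0 : h = jj e.range ((s.map (evalRingHom (xr e ^ q))).eval (yr e ^ q)) := by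
      have := hh 0
      rw [modByMonic_X_sub_C_eq_C_eval] at this
      simpa using this
    obtain ⟨h', hh'⟩ := gd (pol_monic hC.monic) hL.hαβ hxx hrho ht hs
    obtain ⟨H', hH'⟩ := h'.2
    have h3 := congrArg (jj e.range) hh'
    rw [map_mul, ← h0, map_mul, map_pow, map_pow, map_sub, map_sub] at h3
    have hHe' : e H = h := hHe
    have h4 : e H * (e X ^ q - e X) ^ v = (e (C X) ^ q - e (C X)) ^ v * e H' := by
      rw [hHe']
      have e1 : jj e.range (yr e ^ q) = e X ^ q := rfl
      have e2 : jj e.range (yr e ^ 1) = e X := by rw [pow_one]; rfl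
      have e3 : jj e.range (xr e ^ q) = e (C X) ^ q := rfl
      have e4 : jj e.range (xr e ^ 1) = e (C X) := by rw [pow_one]; rfl
      have e5 : jj e.range h' = e H' := hH'.symm
      rw [e1, e2, e3, e4, e5] at h3
      exact h3
    have h5 : P ∣ H * (X ^ q - X) ^ v - C (X ^ q - X) ^ v * H' := by
      rw [← hC.ker]
      simp only [map_sub, map_mul, map_pow]
      rw [h4, sub_self]
    by_contra hne
    have hPH : ¬ P ∣ H := by
      rw [← hC.ker, hHe']; exact hne
    have := norm_bound hC.monic hC.deg hC.td hirr hcard hFq hPc hH.1 hPH h5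
    omega
  have hfT : FiniteDimensional K T := Submodule.finiteDimensional_of_le hTA
  have key := finrank_disjoint T A A' hTA (Submodule.map_mono (Red_mono hm')) hdis
  rw [hC.finrank_map_Red, hC.finrank_map_Red] at key
  have key2 := finrank_relation (V := WW K d a b) Mi (FD P d e einf a b v ⊓ FG P d e einf q a b (i + 1)) T G1 ?_ ?_
  · have : Module.finrank K Mi = Module.finrank K (FD P d e einf a b v ⊓ FG P d e einf q a b i : Submodule K (WW K d a b)) := rfl
    omega
  · rintro c ⟨hc1, ⟨s, hs⟩, s', hs'⟩
    have hR : ((c, jj e.range ((s.map (evalRingHom (xr e ^ q)) %ₘ (X - C (yr e ^ q))).coeff 0)) :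
        WW K d a b × L) ∈ G1 := ⟨s, s', hs, hs', fun κ => by
          rw [Subsingleton.elim κ 0]; rfl⟩
    exact ⟨_, ⟨_, ⟨hR, ⟨hc1, ⟨s, hs⟩, s', hs'⟩⟩, rfl⟩, hR⟩
  · intro c hc h0
    exact ⟨hc.1, Rel_zero hC hL hS h0⟩

/-- total codimension estimate -/
lemma FG_codim (hC : Curve P d e einf) {q : ℕ} (hq : 2 ≤ q) (h1 : Pt P e q)
    (hirr : Irreducible P) {Fq : Finset K}
    (hcard : Fq.card = q) (hFq : ∏ c ∈ Fq, (X - C c) = (X ^ q - X : K[X]))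
    (hPc : ∀ c ∈ Fq, P.eval (C c) ≠ 0)
    {a b v m' : ℕ} (M : ℕ → ℕ) (u : ℕ)
    (hM : ∀ i < u, M i + 2 * q * i = a + q * (b + (d - 1) * i)) (hm' : ∀ i < u, m' ≤ M i)
    (hlt : d * m' + v * Om Fq P < d * q * v) :
    Module.finrank K (FD P d e einf a b v) ≤
    Module.finrank K (FD P d e einf a b v ⊓ FG P d e einf q a b u :
      Submodule K (WW K d a b)) + ∑ i ∈ Finset.range u, d * (M i - m') := by
  induction u with
  | zero => rw [FG_zero, inf_top_eq]; simp
  | succ u ih =>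
    have h2 := ih (fun i hi => hM i (by omega)) (fun i hi => hm' i (by omega))
    have h3 := FG_drop hC hq h1 hirr hcard hFq hPc (hM u (by omega)) (hm' u (by omega)) hlt
    have h4 := Dm_sub d (hm' u (by omega))
    rw [Finset.sum_range_succ]
    omega

end dropG

end NT
end

section
open Polynomial

namespace NT

section mult
variable {L : Type*} [Field L]

lemma mult_graph {p S s : L[X][X]} {ξ η : L} {ρ : L[X]} {u : ℕ} (hp : p.Monic)
    (hpd : p.natDegree ≠ 0)
    (hpf : p.map (evalRingHom ξ) = (X - C η) * ρ) (hρ : ρ.eval η ≠ 0)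
    (h : Ord p ξ ρ u S s) (hN : Nm p S ≠ 0) : u ≤ (Nm p S).rootMultiplicity ξ := by
  by_contra hlt
  push Not at hlt
  set k := (Nm p S).rootMultiplicity ξ with hk
  obtain ⟨N1, hN1, hN2⟩ := exists_eq_pow_rootMultiplicity_mul_and_not_dvd (Nm p S) hN ξ
  rw [← hk] at hN1
  rw [dvd_iff_isRoot] at hN2
  obtain ⟨α, β, hab⟩ := Nm_mem hp S hpd
  have hEp : E2 ξ η p = 0 := by rw [E2_apply, hpf]; simp
  have h3 : p ∣ C ((X - C ξ) ^ k) * (C N1 * (ρ.map C) ^ u - C (X - C ξ) ^ (u - k) * s * β) := by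
    have f1 := (h : p ∣ _).mul_right β
    have f2 : p ∣ p * α * (ρ.map C) ^ u := (dvd_mul_right p α).mul_right _
    convert dvd_add f1 f2 using 1
    have e1 : (C (X - C ξ) : L[X][X]) ^ u = C (X - C ξ) ^ k * C (X - C ξ) ^ (u - k) := by
      rw [← pow_add]; congr 1; omega
    have e2 : (C ((X - C ξ) ^ k) : L[X][X]) * C N1 = p * α + S * β := by
      rw [hab, ← C_mul, ← hN1]
    rw [e1]
    rw [C_pow] at e2 ⊢
    linear_combination ((ρ.map C) ^ u) * e2
  have h4 := dvd_cancel hp (pow_ne_zero _ (X_sub_C_ne_zero ξ)) h3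
  have h5 := map_dvd (E2 ξ η) h4
  rw [hEp, zero_dvd_iff, map_sub, sub_eq_zero] at h5
  simp only [map_mul, map_pow, E2_mapC] at h5
  rw [E2_C, E2_C, eval_sub, eval_X, eval_C, sub_self, zero_pow (by omega), zero_mul, zero_mul] at h5
  exact mul_ne_zero hN2 (pow_ne_zero _ hρ) h5

lemma rootMultiplicity_pow' {f : L[X]} (hf : f ≠ 0) (x : L) (n : ℕ) :
    (f ^ n).rootMultiplicity x = n * f.rootMultiplicity x := by
  classical
  rw [← count_roots, ← count_roots, roots_pow, Multiset.count_nsmul]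

lemma mult_resid {p S t : L[X][X]} {x y : L} {v d : ℕ} (hp : p.Monic) (hpd : p.natDegree = d)
    (h : Ord p x (X - C y) v S t) (hN : Nm p S ≠ 0)
    (hQ : (p.eval (C y)).eval x = 0) (hQ' : (derivative (p.eval (C y))).eval x ≠ 0) :
    (d - 1) * v ≤ (Nm p S).rootMultiplicity x := by
  have h1 := Nm_congr hp h
  have e1 : ((X - C y : L[X]).map C) = X - C (C y) := by simp
  rw [Nm_mul hp, Nm_mul hp, Nm_pow hp, Nm_pow hp, Nm_C hp, e1, Nm_X_sub_C hp, hpd] at h1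
  set Q := p.eval (C y) with hQdef
  have hQ0 : Q ≠ 0 := by rintro h0; rw [h0] at hQ'; simp at hQ'
  have hQ1 : ((-1) ^ d * Q : L[X]) ≠ 0 := mul_ne_zero (pow_ne_zero _ (by simp)) hQ0
  have hl : Nm p S * ((-1) ^ d * Q) ^ v ≠ 0 := mul_ne_zero hN (pow_ne_zero _ hQ1)
  have hr : ((X - C x) ^ d) ^ v * Nm p t ≠ 0 := by rw [← h1]; exact hl
  have h2 := congrArg (rootMultiplicity x) h1
  have hrm1 : ((-1) ^ d * Q).rootMultiplicity x = 1 := by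
    have : ((-1) ^ d : L[X]) = C ((-1) ^ d) := by simp
    rw [rootMultiplicity_mul hQ1, this, rootMultiplicity_C, zero_add]
    apply le_antisymm
    · by_contra hc
      push Not at hc
      have := (one_lt_rootMultiplicity_iff_isRoot hQ0).1 hc
      exact hQ' this.2
    · exact (rootMultiplicity_pos hQ0).2 hQ
  rw [rootMultiplicity_mul hl, rootMultiplicity_mul hr, rootMultiplicity_pow' hQ1, ← pow_mul,
    rootMultiplicity_X_sub_C_pow, hrm1] at h2
  have : (d - 1) * v + v = d * v ∨ d = 0 := by
    rcases d with _ | d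
    · right; rfl
    · left; simp; ring
  rcases this with h | h
  · omega
  · subst h; simp
end mult

section dX
variable {R : Type*} [CommRing R]

/-- coefficientwise derivative -/
noncomputable def dX (P : R[X][X]) : R[X][X] :=
  ∑ i ∈ Finset.range (P.natDegree + 1), monomial i (derivative (P.coeff i))

lemma coeff_dX (P : R[X][X]) (n : ℕ) : (dX P).coeff n = derivative (P.coeff n) := by
  rw [dX, finsetSum_coeff]
  simp only [coeff_monomial]
  rw [Finset.sum_ite_eq']
  split_ifs with h
  · rfl
  · rw [Finset.mem_range, not_lt] at h
    rw [coeff_eq_zero_of_natDegree_lt (by omega), derivative_zero]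

lemma dX_add (P Q : R[X][X]) : dX (P + Q) = dX P + dX Q := by
  ext1 n; simp [coeff_dX]

lemma dX_mul (P Q : R[X][X]) : dX (P * Q) = dX P * Q + P * dX Q := by
  ext1 n
  rw [coeff_dX, coeff_mul, coeff_add, coeff_mul, coeff_mul, derivative_sum, ← Finset.sum_add_distrib]
  refine Finset.sum_congr rfl fun z _ => ?_
  rw [derivative_mul, coeff_dX, coeff_dX]

lemma dX_C (f : R[X]) : dX (C f) = C (derivative f) := by
  ext1 n
  rw [coeff_dX, coeff_C, coeff_C]
  split_ifs <;> simp

lemma dX_X : dX (X : R[X][X]) = 0 := by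
  ext1 n
  rw [coeff_dX, coeff_X]
  split_ifs <;> simp

lemma eval_dX (P : R[X][X]) (c : R) : (dX P).eval (C c) = derivative (P.eval (C c)) := by
  induction P using Polynomial.induction_on' with
  | add p q hp hq => rw [dX_add, eval_add, eval_add, derivative_add, hp, hq]
  | monomial n f =>
    have : dX (monomial n f) = monomial n (derivative f) := by
      ext1 k
      rw [coeff_dX, coeff_monomial, coeff_monomial]
      split_ifs <;> simp
    rw [this, eval_monomial, eval_monomial, derivative_mul, ← C_pow, derivative_C, mul_zero, add_zero]

lemma dX_map {S : Type*} [CommRing S] (φ : R →+* S) (P : R[X][X]) :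
    (dX P).map (mapRingHom φ) = dX (P.map (mapRingHom φ)) := by
  ext1 n
  rw [coeff_dX, coeff_map, coeff_map, coeff_dX, coe_mapRingHom, derivative_map]
end dX

section final
variable {K L : Type*} [Field K] [IsAlgClosed K] [Field L] [Algebra K L]
variable {P : K[X][X]} {d : ℕ} {e einf : K[X][X] →ₐ[K] L}

omit [IsAlgClosed K] in
lemma e_eq_E2 (e : K[X][X] →ₐ[K] L) (H : K[X][X]) :
    E2 (e (C X)) (e X) (pol L H) = e H := by
  rw [alg_eq e H, E2_apply, pol, map_map, eval_map]
  congr 1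
  ext <;> simp

lemma exists_point (hirr : Irreducible P) (hm : P.Monic) (hd : 0 < P.natDegree) {f : K[X][X]}
    (hf : ¬ P ∣ f) : ∃ x0 y0 : K, E2 x0 y0 P = 0 ∧ E2 x0 y0 f ≠ 0 := by
  have hN := Nm_ne_zero hm hirr hf
  have : ∃ x0, (Nm P f).eval x0 ≠ 0 := by
    by_contra hc
    push Not at hc
    exact hN (Polynomial.funext fun r => by rw [hc, eval_zero])
  obtain ⟨x0, hx0⟩ := this
  obtain ⟨y0, hy0⟩ := IsAlgClosed.exists_root (P.map (evalRingHom x0)) (by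
    rw [hm.degree_map, degree_eq_natDegree hm.ne_zero]
    exact_mod_cast hd.ne')
  refine ⟨x0, y0, hy0, fun h0 => hx0 ?_⟩
  obtain ⟨a, b, hab⟩ := Nm_mem hm f hd.ne'
  have := congrArg (E2 x0 y0) hab
  rw [map_add, map_mul, map_mul, h0, E2_C, show E2 x0 y0 P = 0 from hy0] at this
  rw [← this]; ring

lemma Nm_Sm_ne (hC : Curve P d e einf) (hirr : Irreducible P) {a b : ℕ} {c : WW K d a b}
    (hc : c ≠ 0) : Nm (pol L P) ((Sm e d a b c).map (mapRingHom (jj e.range))) ≠ 0 := by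
  have : ∃ z, c z ≠ 0 := by
    by_contra h; push Not at h; exact hc (funext h)
  obtain ⟨z0, hz0⟩ := this
  have hdeg : P.degree = d := hC.degP
  have hnd : ¬ P ∣ (c z0).1 := by
    intro h
    have : (c z0).1 = 0 := hC.inj_red (c z0).2.2 ((hC.ker _).2 h)
    exact hz0 (Subtype.ext this)
  obtain ⟨x0, y0, hP0, hf0⟩ := exists_point hirr hC.monic (by rw [hC.deg]; exact hC.pos) hnd
  intro h0
  let B := K[X][X]
  let Sh : B[X][X] := SmF d a b (RingHom.id B) c
  have hm : (pol B P).Monic := pol_monic hC.monic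
  have e1 : (Sm e d a b c).map (mapRingHom (jj e.range)) = Sh.map (mapRingHom (e : B →+* L)) := by
    rw [Sm_map]
    change _ = Polynomial.map _ (SmF d a b (RingHom.id B) c)
    rw [SmF, Polynomial.map_sum]
    refine Finset.sum_congr rfl fun z _ => ?_
    simp
  have e2 : (Nm (pol B P) Sh).map (e : B →+* L) = 0 := by
    rw [← h0, e1, ← pol_map e P, Nm_map hm]
    rfl
  have e3 : (Nm (pol B P) Sh).map (E2 x0 y0) = 0 := by
    ext n
    have := congrArg (fun t => t.coeff n) e2
    simp only [coeff_map, coeff_zero] at this ⊢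
    obtain ⟨w, hw⟩ := (hC.ker _).1 this
    rw [hw, map_mul, hP0, zero_mul]
  have e4 : Nm ((pol B P).map (mapRingHom (E2 x0 y0))) (Sh.map (mapRingHom (E2 x0 y0))) = 0 := by
    rw [Nm_map hm]; exact e3
  have e5 : (pol B P).map (mapRingHom (E2 x0 y0)) = P := by
    rw [pol, map_map]
    convert Polynomial.map_id using 2
    ext t
    · simp only [RingHom.comp_apply, coe_mapRingHom, map_C, RingHom.id_apply]
      rw [show algebraMap K B t = C (C t) from rfl, E2_C, eval_C]
    · simp
  rw [e5] at e4
  refine Nm_ne_zero hC.monic hirr ?_ e4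
  have e6 : Sh.map (mapRingHom (E2 x0 y0)) =
      ∑ z : idx d b, C (C (E2 x0 y0 (c z).1) * X ^ z.1.1) * X ^ z.1.2 := by
    change Polynomial.map _ (SmF d a b (RingHom.id B) c) = _
    rw [SmF, Polynomial.map_sum]
    refine Finset.sum_congr rfl fun z _ => ?_
    simp
  intro hdv
  have e7 : Sh.map (mapRingHom (E2 x0 y0)) = 0 := by
    refine eq_zero_of_dvd_of_degree_lt hdv ?_
    rw [hdeg, e6]
    refine (degree_sum_le _ _).trans_lt ?_
    refine (Finset.sup_lt_iff (WithBot.bot_lt_coe d)).2 ?_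
    intro z _
    refine (degree_C_mul_X_pow_le _ _).trans_lt ?_
    exact WithBot.coe_lt_coe.2 (mem_idx.1 z.2).2
  have e8 : ((Sh.map (mapRingHom (E2 x0 y0))).coeff z0.1.2).coeff z0.1.1 = E2 x0 y0 (c z0).1 := by
    rw [e6, finsetSum_coeff, finsetSum_coeff, Finset.sum_eq_single z0]
    · rw [coeff_C_mul, coeff_X_pow, if_pos rfl, mul_one, coeff_C_mul, coeff_X_pow, if_pos rfl, mul_one]
    · intro z _ hz
      rw [coeff_C_mul, coeff_X_pow]
      split_ifs with h1
      · rw [mul_one, coeff_C_mul, coeff_X_pow]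
        split_ifs with h2
        · exact absurd (Subtype.ext (Prod.ext h2.symm h1.symm)) hz
        · simp
      · simp
    · simp
  rw [e7] at e8
  exact hf0 e8.symm

lemma final_contra (hC : Curve P d e einf) (hirr : Irreducible P) {q : ℕ}
    (hq : 2 ≤ q) (h2 : Pt P e q) (hPX : ¬ P ∣ dX P) {a b u v : ℕ} (hlt : b * d < u + v * (d - 1)) :
    (FD P d e einf a b v ⊓ FG P d e einf q a b u : Submodule K (WW K d a b)) = ⊥ := by
  classical
  rw [eq_bot_iff]
  rintro c ⟨⟨⟨t, ht⟩, -⟩, ⟨s, hs⟩, -⟩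
  rw [Submodule.mem_bot]
  by_contra hc
  have hN := Nm_Sm_ne hC hirr hc
  have ht' := ht.map (jj e.range)
  have hs' := hs.map (jj e.range)
  rw [pol_jj] at ht' hs'
  rw [Polynomial.map_sub, map_X, map_C] at ht'
  rw [rho_jj] at hs'
  have hm : (pol L P).Monic := pol_monic hC.monic
  have hmd : (pol L P).natDegree = d := by rw [pol_natDegree hC.monic, hC.deg]
  have g1 := mult_graph hm (by rw [hmd]; exact hC.pos.ne') (fib_eq_mul h2.root) h2.rho_eval hs' hN
  have hx1 : jj e.range (xr e ^ 1) = e (C X) := by rw [pow_one]; rfl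
  have hy1 : jj e.range (yr e ^ 1) = e X := by rw [pow_one]; rfl
  rw [hx1, hy1] at ht'
  have hE : ∀ p : L[X][X], ∀ x y : L, (p.eval (C y)).eval x = E2 x y p := by
    intro p x y
    have : (evalRingHom x).comp (evalRingHom (C y)) = E2 x y := by
      ext <;> simp [E2]
    exact congrArg (fun φ => φ p) this
  have g2 := mult_resid hm hmd ht' hN (by
      rw [hE, e_eq_E2, hC.ker]) (by
      rw [← eval_dX, hE, pol, ← dX_map, ← pol, e_eq_E2, Ne, hC.ker]; exact hPX)
  have g3 := natDegree_Nm_le hm hmd (pol_TD hC.td) ((sec_WW hC a b).td c)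
  have hxx : e (C X) ^ q ≠ e (C X) := by
    intro h
    rw [← sub_eq_zero, ← map_pow e, ← map_sub e, hC.ker, ← C_pow, ← C_sub] at h
    refine not_dvd_C (by rw [hC.deg]; exact hC.pos) ?_ h
    exact FiniteField.X_pow_card_sub_X_ne_zero K (by omega)
  have g4 := sum_rootMultiplicity_le {e (C X) ^ q, e (C X)}
    (f := Nm (pol L P) ((Sm e d a b c).map (mapRingHom (jj e.range))))
  rw [Finset.sum_pair hxx] at g4
  have : b * d = d * b := mul_comm _ _
  have : v * (d - 1) = (d - 1) * v := mul_comm _ _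
  omega

end final

end NT
end

section
open Polynomial

namespace NT

section ineq

lemma sum_range_id_real (v : ℕ) : ∑ j ∈ Finset.range v, (j : ℝ) = v * (v - 1) / 2 := by
  induction v with
  | zero => simp
  | succ v ih => rw [Finset.sum_range_succ, ih]; push_cast; ring

lemma aux_d3 {d b h : ℝ} (hd : 1 ≤ d) (hb : d ≤ b) (hh : -(d * d) ≤ h) : 0 ≤ d * b + h := by
  nlinarith

set_option maxHeartbeats 2000000 in
/-- the arithmetic at the end of the codimension count -/
lemma arith_core {d q Om u0 v0 : ℕ} (hd : 1 ≤ d) (hu0 : 1 ≤ u0) (hv0 : 1 ≤ v0)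
    (hZ : Om < d * q)
    (H : ∀ a b u v m' : ℕ, ∀ M : ℕ → ℕ, v + d ≤ a + b →
      (∀ i < u, M i + 2 * q * i = a + q * (b + (d - 1) * i)) → (∀ i < u, m' ≤ M i) →
      d * m' + v * Om < d * q * v → b * d < u + v * (d - 1) →
      Dm d b * Dm d a ≤ ∑ j ∈ Finset.range v, (d - 1) * (d * (a + b - j + 1)) +
        ∑ i ∈ Finset.range u, d * (M i - m')) :
    (u0 * v0 : ℝ) * (q + 1 - d - Om) ≤ ((d : ℝ) - 1) * (d - 2) / 2 * (v0 ^ 2 + q * u0 ^ 2) := by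
  set E : ℝ := (u0 * v0 : ℝ) * (q + 1 - d - Om) -
    ((d : ℝ) - 1) * (d - 2) / 2 * (v0 ^ 2 + q * u0 ^ 2) with hE
  suffices hs : E ≤ 0 by linarith
  set h : ℝ := d * (3 - d) / 2 with hh
  set t : ℝ := u0 + v0 * (d - 1) with ht
  set α : ℝ := q * (v0 + 2 * u0) with hα
  set A : ℝ → ℝ := fun s => (d - 1) * v0 * (d ^ 2 + d - s) + (d - 1) * d * v0 / 2 +
    u0 * (d ^ 2 - q * s) - d * q * (d - 3) * u0 / 2 + u0 * d - t * (d ^ 2 + h) - (h - s) * (d * α) with hA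
  set B : ℝ → ℝ := fun s => - (h - s) * (d ^ 2 + h) with hB
  have key : ∀ n : ℕ, d * d + d + 1 ≤ n → ∃ s : ℝ, 1 ≤ s ∧ s ≤ d ∧ (n : ℝ) ^ 2 * E ≤ n * A s + B s := by
    intro n hn
    set u := n * u0 with hu
    set v := n * v0 with hv
    have hun : n ≤ u := Nat.le_mul_of_pos_right _ hu0
    have hvn : n ≤ v := Nat.le_mul_of_pos_right _ hv0
    set T := u + v * (d - 1) with hT
    set b := (T - 1) / d with hb
    set a := q * v + 2 * q * u + d with ha
    have hTpos : 1 ≤ T := by omega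
    have hb1 : b * d ≤ T - 1 := Nat.div_mul_le_self _ _
    have hb2 : T - 1 < b * d + d := by
      have := Nat.lt_div_mul_add (a := T - 1) (b := d) (by omega)
      exact this
    have hbd : d ≤ b := by
      rw [hb, Nat.le_div_iff_mul_le (by omega)]
      omega
    set Z := d * q - Om with hZd
    have hZ1 : 1 ≤ Z := by omega
    set m' := (v * Z - 1) / d with hm
    have hvZ : 1 ≤ v * Z := Nat.one_le_iff_ne_zero.2 (Nat.mul_ne_zero (by omega) (by omega))
    have hm1 : m' * d ≤ v * Z - 1 := Nat.div_mul_le_self _ _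
    have hm2 : v * Z - 1 < m' * d + d := by
      have := Nat.lt_div_mul_add (a := v * Z - 1) (b := d) (by omega)
      exact this
    set M : ℕ → ℕ := fun i => a + q * (b + (d - 1) * i) - 2 * q * i with hM
    have hle : ∀ i < u, 2 * q * i + q * v ≤ a := by
      intro i hi
      have : 2 * q * i ≤ 2 * q * u := Nat.mul_le_mul_left _ hi.le
      omega
    have hMe : ∀ i < u, M i + 2 * q * i = a + q * (b + (d - 1) * i) := by
      intro i hi
      have := hle i hi
      simp only [hM]
      omega
    have hmq : m' ≤ q * v := by
      have : m' * d ≤ (q * v) * d := by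
        refine hm1.trans ((Nat.sub_le _ _).trans ?_)
        have : v * Z ≤ v * (d * q) := Nat.mul_le_mul_left _ (Nat.sub_le _ _)
        calc v * Z ≤ v * (d * q) := this
          _ = q * v * d := by ring
      exact Nat.le_of_mul_le_mul_right this hd
    have hMm : ∀ i < u, m' ≤ M i := by
      intro i hi
      have := hle i hi
      have := hMe i hi
      omega
    have hvq : v ≤ q * v := by
      refine Nat.le_mul_of_pos_left _ ?_
      rcases Nat.eq_zero_or_pos q with h0 | h0
      · subst h0; simp at hZ
      · exact h0
    have hvZ' : v * Z + v * Om = d * q * v := by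
      rw [← mul_add, hZd, Nat.sub_add_cancel hZ.le]; ring
    have HH := H a b u v m' M (by omega) hMe hMm (by
      have : d * m' = m' * d := mul_comm _ _
      omega) (by omega)
    refine ⟨(T : ℝ) - b * d, ?_, ?_, ?_⟩
    · have : b * d + 1 ≤ T := by omega
      have : (b : ℝ) * d + 1 ≤ T := by exact_mod_cast this
      linarith
    · have : T ≤ b * d + d := by omega
      have : (T : ℝ) ≤ b * d + d := by exact_mod_cast this
      linarith
    set s : ℝ := (T : ℝ) - b * d with hs
    have hd1 : ((d - 1 : ℕ) : ℝ) = (d : ℝ) - 1 := by push_cast [hd]; ring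
    have hTr : (T : ℝ) = n * t := by
      rw [hT, hu, hv, ht]; push_cast; rw [hd1]; ring
    have har : (a : ℝ) = n * α + d := by
      rw [ha, hu, hv, hα]; push_cast; ring
    have hur : (u : ℝ) = n * u0 := by rw [hu]; push_cast; ring
    have hvr : (v : ℝ) = n * v0 := by rw [hv]; push_cast; ring
    have hdb : (d : ℝ) * b = n * t - s := by rw [hs, hTr]; ring
    have S1 : ((∑ j ∈ Finset.range v, (d - 1) * (d * (a + b - j + 1)) : ℕ) : ℝ) =
        (d - 1) * (v * (d * a + d * b + d)) - (d - 1) * d * (v * (v - 1) / 2) := by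
      rw [← sum_range_id_real v, Finset.mul_sum, Nat.cast_sum]
      have : ((d : ℝ) - 1) * (v * (d * a + d * b + d)) =
        ∑ j ∈ Finset.range v, ((d : ℝ) - 1) * (d * a + d * b + d) := by
        rw [Finset.sum_const, Finset.card_range, nsmul_eq_mul]; ring
      rw [this, ← Finset.sum_sub_distrib]
      refine Finset.sum_congr rfl fun j hj => ?_
      rw [Finset.mem_range] at hj
      have hj2 : j ≤ a + b := by omega
      push_cast [hj2]
      rw [hd1]; ring
    have S2 : ((∑ i ∈ Finset.range u, d * (M i - m') : ℕ) : ℝ) ≤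
        u * (d * a + q * (d * b)) + d * q * (d - 3) * (u * (u - 1) / 2) -
          u * (v * (d * q - Om) - d) := by
      rw [← sum_range_id_real u, Finset.mul_sum, Nat.cast_sum]
      have : (u : ℝ) * (d * a + q * (d * b)) + ∑ i ∈ Finset.range u, (d : ℝ) * q * (d - 3) * i -
          u * (v * (d * q - Om) - d) =
        ∑ j ∈ Finset.range u, (((d : ℝ) * a + q * (d * b)) - (v * (d * q - Om) - d) +
          d * q * (d - 3) * j) := by
        rw [Finset.sum_add_distrib, Finset.sum_const, Finset.card_range, nsmul_eq_mul]; ring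
      rw [this]
      refine Finset.sum_le_sum fun i hi => ?_
      rw [Finset.mem_range] at hi
      have e1 := hMm i hi
      have e2 : (M i : ℝ) + 2 * q * i = a + q * (b + (d - 1) * i) := by
        have := hMe i hi
        rw [← hd1]
        exact_mod_cast this
      have e3 : (v : ℝ) * (d * q - Om) ≤ d * m' + d := by
        have : d * q * v ≤ d * m' + d + v * Om := by
          have : d * m' = m' * d := mul_comm _ _
          omega
        have : (d : ℝ) * q * v ≤ d * m' + d + v * Om := by exact_mod_cast this
        linarith
      push_cast [e1]
      have e4 : (M i : ℝ) = a + q * (b + (d - 1) * i) - 2 * q * i := by linarith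
      rw [e4]
      linarith
    have D1 : (d : ℝ) * b + h ≤ Dm d b := by
      have := Dm_ge d b
      have : (d : ℝ) * (b + 1) * 2 - d * (d - 1) ≤ 2 * Dm d b := by exact_mod_cast this
      rw [hh]; linarith
    have D2 : (d : ℝ) * a + h ≤ Dm d a := by
      have := Dm_ge d a
      have : (d : ℝ) * (a + 1) * 2 - d * (d - 1) ≤ 2 * Dm d a := by exact_mod_cast this
      rw [hh]; linarith
    have hdr : (1 : ℝ) ≤ d := by exact_mod_cast hd
    have hhl : -((d : ℝ) * d) ≤ h := by rw [hh]; linarith [mul_nonneg (show (0:ℝ) ≤ d by linarith) (show (0:ℝ) ≤ d by linarith)]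
    have D3 : 0 ≤ (d : ℝ) * b + h := by
      have : (d : ℝ) ≤ b := by exact_mod_cast hbd
      exact aux_d3 hdr this hhl
    have D4 : 0 ≤ (d : ℝ) * a + h := by
      have : d ≤ a := by omega
      have : (d : ℝ) ≤ a := by exact_mod_cast this
      exact aux_d3 hdr this hhl
    have D5 : ((d : ℝ) * b + h) * (d * a + h) ≤ Dm d b * Dm d a :=
      mul_le_mul D1 D2 D4 (D3.trans D1)
    have HR : ((Dm d b * Dm d a : ℕ) : ℝ) ≤ ((∑ j ∈ Finset.range v, (d - 1) * (d * (a + b - j + 1)) +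
        ∑ i ∈ Finset.range u, d * (M i - m') : ℕ) : ℝ) := by exact_mod_cast HH
    rw [Nat.cast_add, S1, Nat.cast_mul] at HR
    have HF := D5.trans (HR.trans (add_le_add_right S2 _))
    rw [hdb, har, hur, hvr] at HF
    simp only [hA, hB, hE]
    have hfin : ∀ L R X Y : ℝ, L ≤ R → Y - X = R - L → X ≤ Y := by intros; linarith
    refine hfin _ _ _ _ HF ?_
    rw [hh, ht, hα]
    ring
  by_contra hpos
  push Not at hpos
  -- linear bound
  set c : ℝ := |A 0| + d * (|((d : ℝ) - 1) * v0| + |(q : ℝ) * u0| + |d * α|) + |h * (d ^ 2 + h)| + d * |d ^ 2 + h| with hc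
  obtain ⟨n0, hn0⟩ := exists_nat_gt (c / E)
  set n := max n0 (d * d + d + 1) with hn
  obtain ⟨s, hs1, hs2, hs3⟩ := key n (le_max_right _ _)
  have hnn : (1 : ℝ) ≤ n := by
    have : 1 ≤ n := le_trans (by omega) (le_max_right _ _)
    exact_mod_cast this
  have hcE : c < n * E := by
    have : (n0 : ℝ) ≤ n := by exact_mod_cast le_max_left _ _
    rw [div_lt_iff₀ hpos] at hn0
    nlinarith
  have hs0 : 0 ≤ s := by linarith
  have hA1 : A s ≤ |A 0| + d * (|((d : ℝ) - 1) * v0| + |(q : ℝ) * u0| + |d * α|) := by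
    have e1 : A s = A 0 + s * (-((d - 1) * v0) - (q * u0) + (d * α)) := by
      simp only [hA]; ring
    rw [e1]
    have e2 : (-((d - 1) * v0) - (q * u0) + (d * α) : ℝ) ≤ |((d : ℝ) - 1) * v0| + |(q : ℝ) * u0| + |d * α| := by
      have := neg_abs_le (((d : ℝ) - 1) * v0)
      have := neg_abs_le ((q : ℝ) * u0)
      have := le_abs_self ((d : ℝ) * α)
      linarith
    have e3 : 0 ≤ |((d : ℝ) - 1) * v0| + |(q : ℝ) * u0| + |d * α| := by positivity
    have := le_abs_self (A 0)
    nlinarith [mul_le_mul_of_nonneg_left e2 hs0, mul_le_mul_of_nonneg_right hs2 e3]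
  have hB1 : B s ≤ |h * (d ^ 2 + h)| + d * |d ^ 2 + h| := by
    have e1 : B s = - (h * (d ^ 2 + h)) + s * (d ^ 2 + h) := by simp only [hB]; ring
    rw [e1]
    have := neg_abs_le (h * ((d : ℝ) ^ 2 + h))
    have h1 := le_abs_self ((d : ℝ) ^ 2 + h)
    have h2 := abs_nonneg ((d : ℝ) ^ 2 + h)
    nlinarith [mul_le_mul_of_nonneg_left h1 hs0, mul_le_mul_of_nonneg_right hs2 h2]
  have hB0 : 0 ≤ |h * (d ^ 2 + h)| + d * |d ^ 2 + h| := by positivity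
  nlinarith

lemma arith_sqrt {E g q : ℝ} (hq : 0 < q)
    (H : ∀ u0 v0 : ℕ, 1 ≤ u0 → 1 ≤ v0 → (u0 * v0 : ℝ) * E ≤ g * (v0 ^ 2 + q * u0 ^ 2)) :
    E ≤ 2 * g * Real.sqrt q := by
  by_contra hlt
  push Not at hlt
  have hsq := Real.sqrt_pos.2 hq
  have hsq2 := Real.mul_self_sqrt hq.le
  have hcont : Continuous fun w : ℝ => g * (w ^ 2 + q) - w * E := by fun_prop
  have h0 : g * (Real.sqrt q ^ 2 + q) - Real.sqrt q * E < 0 := by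
    have : g * (Real.sqrt q ^ 2 + q) - Real.sqrt q * E = Real.sqrt q * (2 * g * Real.sqrt q - E) := by
      rw [Real.sq_sqrt hq.le]
      linear_combination (-2 * g) * hsq2
    rw [this]
    exact mul_neg_of_pos_of_neg hsq (by linarith)
  have hev := (hcont.continuousAt (x := Real.sqrt q)).eventually_lt continuousAt_const h0
  rw [Metric.eventually_nhds_iff] at hev
  obtain ⟨ε, hε, hb⟩ := hev
  obtain ⟨w, hw1, hw2⟩ := exists_rat_btwn (show Real.sqrt q < Real.sqrt q + ε by linarith)
  have hw := hb (y := (w : ℝ)) (by rw [Real.dist_eq, abs_lt]; constructor <;> linarith)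
  have hwpos : 0 < w := by exact_mod_cast hsq.trans hw1
  have hnum : 0 < w.num := Rat.num_pos.2 hwpos
  have h1 := H w.den w.num.toNat w.den_pos (by omega)
  have h2 : ((w.num.toNat : ℕ) : ℝ) = w * w.den := by
    have e1 : ((w.num.toNat : ℕ) : ℝ) = ((w.num : ℤ) : ℝ) := by
      exact_mod_cast congrArg (fun z : ℤ => (z : ℝ)) (Int.toNat_of_nonneg hnum.le)
    rw [e1]
    have := Rat.mul_den_eq_num w
    exact_mod_cast this.symm
  rw [h2] at h1
  have hden : (0 : ℝ) < w.den := by exact_mod_cast w.den_pos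
  have : (w.den : ℝ) ^ 2 * (g * (w ^ 2 + q) - w * E) < 0 := mul_neg_of_pos_of_neg (by positivity) hw
  nlinarith

end ineq

end NT
end

section
open Polynomial

namespace NT

universe u

section weil
variable {K : Type u} [Field K]

lemma E2_hom {R S : Type*} [CommRing R] [CommRing S] (φ : R →+* S) (x y : R) (Q : R[X][X]) :
    φ (E2 x y Q) = E2 (φ x) (φ y) (Q.map (mapRingHom φ)) := by
  have : φ.comp (E2 x y) = (E2 (φ x) (φ y)).comp (mapRingHom (mapRingHom φ)) := by
    ext <;> simp [E2]
  exact congrArg (fun ψ => ψ Q) this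

lemma derivative_fib {R : Type*} [CommRing R] [Algebra K R] (ξ : R) (P : K[X][X]) :
    derivative (fib ξ P) = fib ξ (derivative P) := by
  rw [fib, fib, pol, pol, derivative_map, derivative_map]

lemma exists_curve_aux {P : K[X][X]} {d : ℕ} (hm : P.Monic) (hd : P.natDegree = d) (hT : TD P d)
    (hpos : 0 < d) {L : Type*} [Field L] [Algebra K L] (e : K[X][X] →ₐ[K] L)
    (hker : ∀ H, e H = 0 ↔ P ∣ H) : ∃ einf : K[X][X] →ₐ[K] L, Curve P d e einf := by
  have hx : e (C X) ≠ 0 := by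
    rw [Ne, hker]
    exact not_dvd_C (by omega) X_ne_zero
  let einf : K[X][X] →ₐ[K] L :=
    { eval₂RingHom (eval₂RingHom (algebraMap K L) (e (C X))⁻¹) (e X * (e (C X))⁻¹) with
      commutes' := fun a => by
        change eval₂ _ _ (C (C a)) = _
        simp }
  have h1 : einf (C X) = (e (C X))⁻¹ := by
    change eval₂ _ _ (C X) = _
    simp
  have h2 : einf X = e X * (e (C X))⁻¹ := by
    change eval₂ _ _ X = _
    simp
  exact ⟨einf, hm, hd, hT, hpos, hker, by
    rw [h1, mul_inv_cancel₀ hx], by rw [h2, h1]⟩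

lemma exists_field_aux {B A : Type*} [CommRing B] [Algebra K B] [CommRing A] [Algebra K A]
    [IsDomain A] (φ : B →ₐ[K] A) :
    ∃ e : B →ₐ[K] FractionRing A, ∀ H, e H = 0 ↔ φ H = 0 := by
  refine ⟨(IsScalarTower.toAlgHom K A (FractionRing A)).comp φ, fun H => ?_⟩
  have h0 : ((IsScalarTower.toAlgHom K A (FractionRing A)).comp φ) H =
    algebraMap A (FractionRing A) (φ H) := rfl
  rw [h0, map_eq_zero_iff _ (IsFractionRing.injective A (FractionRing A))]

/-- existence of the function field with the two charts -/
lemma exists_curve {P : K[X][X]} {d : ℕ} (hm : P.Monic) (hd : P.natDegree = d) (hT : TD P d)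
    (hpos : 0 < d) (hirr : Irreducible P) :
    ∃ (L : Type u) (_ : Field L) (_ : Algebra K L) (e einf : K[X][X] →ₐ[K] L),
      Curve P d e einf := by
  have hI : (Ideal.span {P}).IsPrime := by
    rw [Ideal.span_singleton_prime hirr.ne_zero]
    exact hirr.prime
  obtain ⟨e, he⟩ := exists_field_aux (B := K[X][X]) (A := K[X][X] ⧸ Ideal.span {P}) (Ideal.Quotient.mkₐ K (Ideal.span {P}))
  obtain ⟨einf, h⟩ := exists_curve_aux hm hd hT hpos e (fun H => by
    rw [he, Ideal.Quotient.mkₐ_eq_mk, Ideal.Quotient.eq_zero_iff_mem, Ideal.mem_span_singleton])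
  exact ⟨_, _, _, e, einf, h⟩

lemma pt_of {L : Type*} [Field L] [Algebra K L] {P : K[X][X]} {d : ℕ} {e einf : K[X][X] →ₐ[K] L}
    (hC : Curve P d e einf) (p m : ℕ) [ExpChar K p]
    (hfrob : P.map (mapRingHom (iterateFrobenius K p m)) = P) (hder : ¬ P ∣ derivative P) :
    Pt P e (p ^ m) := by
  have : ExpChar L p := expChar_of_injective_algebraMap (algebraMap K L).injective p
  have key : ∀ H : K[X][X], H.map (mapRingHom (iterateFrobenius K p m)) = H →
      (fib (e (C X) ^ (p ^ m)) H).eval (e X ^ (p ^ m)) = e H ^ (p ^ m) := by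
    intro H hH
    have h1 := E2_hom (iterateFrobenius L p m) (e (C X)) (e X) (pol L H)
    rw [e_eq_E2, iterateFrobenius_def, iterateFrobenius_def, iterateFrobenius_def] at h1
    rw [h1]
    change E2 _ _ (pol L H) = _
    congr 1
    conv_lhs => rw [← hH]
    rw [pol, pol, map_map, map_map]
    congr 1
    ext t
    · simp [iterateFrobenius_def]
    · simp
  constructor
  · rw [key P hfrob, (hC.ker P).2 dvd_rfl, zero_pow (pow_ne_zero _ (expChar_pos K p).ne')]
  · rw [derivative_fib, key _ (by rw [← derivative_map, hfrob])]
    exact pow_ne_zero _ fun h => hder ((hC.ker _).1 h)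

theorem weil [IsAlgClosed K] {P : K[X][X]} {d p m q : ℕ} [ExpChar K p] (hq : q = p ^ m) (hq2 : 2 ≤ q)
    {Fq : Finset K} (hcard : Fq.card = q) (hFq : ∏ c ∈ Fq, (X - C c) = (X ^ q - X : K[X]))
    (hm : P.Monic) (hd : P.natDegree = d) (hT : TD P d) (hpos : 0 < d) (hirr : Irreducible P)
    (hfrob : P.map (mapRingHom (iterateFrobenius K p m)) = P) (hder : ¬ P ∣ derivative P)
    (hdX : ¬ P ∣ dX P) :
    (q : ℝ) + 1 - d - Om Fq P ≤ ((d : ℝ) - 1) * (d - 2) * Real.sqrt q := by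
  obtain ⟨L, _, _, e, einf, hC⟩ := exists_curve hm hd hT hpos hirr
  have h1 : Pt P e 1 := by
    have := pt_of hC p 0 (by
      convert Polynomial.map_id using 2
      ext <;> simp [iterateFrobenius_def]) hder
    rwa [pow_zero] at this
  have h2 : Pt P e q := by
    rw [hq]; exact pt_of hC p m hfrob hder
  have hPc : ∀ c ∈ Fq, P.eval (C c) ≠ 0 := by
    intro c _ h0
    have hdv : X - C (C c) ∣ P := dvd_iff_isRoot.2 h0
    have has := (irreducible_X_sub_C (C c)).associated_of_dvd hirr hdv
    have := eq_of_monic_of_associated (monic_X_sub_C _) hm has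
    apply hdX
    have : dX P = 0 := by
      rw [← this, sub_eq_add_neg, dX_add, dX_X, ← C_neg, dX_C, ← C_neg, derivative_C, C_0, add_zero]
    rw [this]; exact dvd_zero _
  have hdr : (1 : ℝ) ≤ d := by exact_mod_cast hpos
  have hg : 0 ≤ ((d : ℝ) - 1) * (d - 2) := by
    rcases Nat.lt_or_ge d 2 with h | h
    · have : d = 1 := by omega
      subst this; simp
    · have : (2 : ℝ) ≤ d := by exact_mod_cast h
      exact mul_nonneg (by linarith) (by linarith)
  rcases Nat.lt_or_ge (Om Fq P) (d * q) with hZ | hZ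
  · have := arith_sqrt (E := (q : ℝ) + 1 - d - Om Fq P) (g := ((d : ℝ) - 1) * (d - 2) / 2)
      (q := q) (by exact_mod_cast (by omega : 0 < q)) ?_
    · linarith
    · intro u0 v0 hu0 hv0
      refine arith_core hpos hu0 hv0 hZ ?_
      intro a b u v m' M c1 c2 c3 c4 c5
      have k1 := FD_codim hC h1 v c1
      have k2 := FG_codim hC hq2 h2 hirr hcard hFq hPc M u c2 c3 c4
      rw [final_contra hC hirr hq2 h2 hdX c5, finrank_bot] at k2
      omega
  · have h3 : ((d : ℝ) * q) ≤ Om Fq P := by exact_mod_cast hZ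
    have h4 : (q : ℝ) ≤ d * q := by nlinarith [Nat.cast_nonneg (α := ℝ) q]
    have h5 : 0 ≤ ((d : ℝ) - 1) * (d - 2) * Real.sqrt q := mul_nonneg hg (Real.sqrt_nonneg _)
    linarith

end weil

end NT
end

section
open Polynomial

namespace NT

section comp
lemma exists_top {R : Type*} [CommRing R] {A : R[X][X]} (hA : A ≠ 0) :
    ∃ n l : ℕ, TD A (n + l) ∧ (A.coeff n).coeff l ≠ 0 ∧
      ∀ i j, i + j = n + l → n < i → (A.coeff i).coeff j = 0 := by
  classical
  have hex := exists_TD A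
  let m := Nat.find hex
  have hm : TD A m := Nat.find_spec hex
  have hmin : ∀ k, k < m → ¬ TD A k := fun k hk => Nat.find_min hex hk
  have h1 : ∃ i, i ≤ m ∧ (A.coeff i).coeff (m - i) ≠ 0 := by
    by_contra hcon
    push Not at hcon
    rcases Nat.eq_zero_or_pos m with h0 | h0
    · apply hA
      ext i j
      by_contra hne
      have h2 := TD_iff_coeff.1 hm i j hne
      have hi : i = 0 := by omega
      have hj : j = m - i := by omega
      rw [hj] at hne
      exact hne (hcon i (by omega))
    · apply hmin (m - 1) (by omega)
      rw [TD_iff_coeff] at hm ⊢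
      intro i j hij
      have h2 := hm i j hij
      by_contra h3
      have hj : j = m - i := by omega
      rw [hj] at hij
      exact hij (hcon i (by omega))
  let s := (Finset.range (m + 1)).filter (fun i => (A.coeff i).coeff (m - i) ≠ 0)
  have hs : s.Nonempty := by
    obtain ⟨i, hi, h⟩ := h1
    exact ⟨i, Finset.mem_filter.2 ⟨Finset.mem_range.2 (by omega), h⟩⟩
  obtain ⟨n, hn, hmax⟩ := s.exists_max_image id hs
  rw [Finset.mem_filter, Finset.mem_range] at hn
  refine ⟨n, m - n, by rwa [Nat.add_sub_cancel' (by omega)], hn.2, ?_⟩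
  intro i j hij hni
  by_contra hne
  have hj : j = m - i := by omega
  rw [hj] at hne
  have := hmax i (Finset.mem_filter.2 ⟨Finset.mem_range.2 (by omega), hne⟩)
  simp only [id] at this
  omega

lemma TD_of_mul {R : Type*} [CommRing R] [IsDomain R] {A B : R[X][X]} {d : ℕ}
    (hd : A.natDegree + B.natDegree = d) (h : TD (A * B) d) (h0 : A * B ≠ 0) :
    TD A A.natDegree := by
  obtain ⟨n, l, hT, hne, hz⟩ := exists_top (left_ne_zero_of_mul h0)
  obtain ⟨n', l', hT', hne', hz'⟩ := exists_top (right_ne_zero_of_mul h0)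
  have hTA := hT.natDegree_le
  have hTB := hT'.natDegree_le
  rw [TD_iff_coeff] at hT hT' h
  have key : ((A * B).coeff (n + n')).coeff (l + l') = (A.coeff n).coeff l * (B.coeff n').coeff l' := by
    rw [coeff_mul, finsetSum_coeff, Finset.sum_eq_single (n, n')]
    · rw [coeff_mul, Finset.sum_eq_single (l, l')]
      · rintro ⟨u, v⟩ huv hne2
        rw [Finset.HasAntidiagonal.mem_antidiagonal] at huv
        by_contra hcon
        have h1 := hT n u (left_ne_zero_of_mul hcon)
        have h2 := hT' n' v (right_ne_zero_of_mul hcon)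
        apply hne2
        simp only [Prod.mk.injEq]
        simp only at huv
        omega
      · intro hh; exact (hh (Finset.HasAntidiagonal.mem_antidiagonal.2 rfl)).elim
    · rintro ⟨i, i'⟩ hii hne2
      rw [Finset.HasAntidiagonal.mem_antidiagonal] at hii
      simp only at hii
      rw [coeff_mul]
      refine Finset.sum_eq_zero ?_
      rintro ⟨u, v⟩ huv
      rw [Finset.HasAntidiagonal.mem_antidiagonal] at huv
      simp only at huv
      by_contra hcon
      have h1 := hT i u (left_ne_zero_of_mul hcon)
      have h2 := hT' i' v (right_ne_zero_of_mul hcon)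
      have h3 : ¬ n < i := fun hni => left_ne_zero_of_mul hcon (hz i u (by omega) hni)
      have h4 : ¬ n' < i' := fun hni => right_ne_zero_of_mul hcon (hz' i' v (by omega) hni)
      apply hne2
      simp only [Prod.mk.injEq]
      omega
    · intro hh; exact (hh (Finset.HasAntidiagonal.mem_antidiagonal.2 rfl)).elim
  have h5 := h (n + n') (l + l') (by rw [key]; exact mul_ne_zero hne hne')
  rw [TD_iff_coeff]
  intro i j hij
  have := hT i j hij
  omega

variable {K : Type*} [Field K]

lemma E2_eq_eval (x y : K) (P : K[X][X]) : E2 x y P = (P.eval (C y)).eval x := by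
  have : E2 x y = (evalRingHom x).comp (evalRingHom (C y)) := by
    ext <;> simp [E2]
  rw [this]; rfl

lemma TD.natDegree_eval {P : K[X][X]} {d : ℕ} (h : TD P d) (c : K) :
    (P.eval (Polynomial.C c)).natDegree ≤ d := by
  rw [eval_eq_sum, Polynomial.sum]
  refine natDegree_sum_le_of_forall_le _ _ fun i hi => ?_
  have h1 := h i (mem_support_iff.1 hi)
  rw [← Polynomial.C_pow]
  refine (natDegree_mul_C_le _ _).trans (by omega)

lemma TD.dX {P : K[X][X]} {d : ℕ} (h : TD P d) : TD (dX P) d := by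
  rw [TD_iff_coeff] at *
  intro i j hij
  rw [coeff_dX, coeff_derivative] at hij
  have := h i (j + 1) (left_ne_zero_of_mul hij)
  omega

/-- common zeros of an irreducible polynomial and a nonmultiple -/
lemma card_common [DecidableEq K] {A h : K[X][X]} {d m : ℕ} (hm : A.Monic) (hd : A.natDegree = d)
    (hT : TD A d) (hpos : 0 < d) (hirr : Irreducible A) (hh : TD h m) (hdv : ¬ A ∣ h) (Fq : Finset K) :
    ((Fq ×ˢ Fq).filter (fun z => E2 z.1 z.2 A = 0 ∧ E2 z.1 z.2 h = 0)).card ≤ d * m * d := by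
  have hN := Nm_ne_zero hm hirr hdv
  have hNd := natDegree_Nm_le hm hd hT hh
  obtain ⟨a, b, hab⟩ := Nm_mem hm h (by omega)
  have hsub : ((Fq ×ˢ Fq).filter (fun z => E2 z.1 z.2 A = 0 ∧ E2 z.1 z.2 h = 0)) ⊆
      (Nm A h).roots.toFinset.biUnion (fun x => ((A.map (evalRingHom x)).roots.toFinset.image
        (fun y => (x, y)))) := by
    rintro ⟨x, y⟩ hz
    rw [Finset.mem_filter] at hz
    obtain ⟨-, h1, h2⟩ := hz
    simp only at h1 h2
    rw [Finset.mem_biUnion]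
    refine ⟨x, ?_, ?_⟩
    · rw [Multiset.mem_toFinset, mem_roots hN, IsRoot, ← E2_C x y, ← hab, map_add, map_mul, map_mul,
        h1, h2, zero_mul, zero_mul, add_zero]
    · rw [Finset.mem_image]
      refine ⟨y, ?_, rfl⟩
      rw [Multiset.mem_toFinset, mem_roots (hm.map _).ne_zero]
      exact h1
  refine (Finset.card_le_card hsub).trans ?_
  refine (Finset.card_biUnion_le_card_mul _ _ d ?_).trans ?_
  · intro x _
    refine Finset.card_image_le.trans ((Multiset.toFinset_card_le _).trans ((card_roots' _).trans ?_))
    rw [← hd]; exact natDegree_map_le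
  · refine Nat.mul_le_mul_right _ ((Multiset.toFinset_card_le _).trans ((card_roots' _).trans hNd))

noncomputable def ZZ [DecidableEq K] (Fq : Finset K) (P : K[X][X]) : Finset (K × K) :=
  (Fq ×ˢ Fq).filter (fun z => E2 z.1 z.2 P = 0)

lemma Om_le [DecidableEq K] {A : K[X][X]} {d : ℕ} (hm : A.Monic) (hd : A.natDegree = d)
    (hT : TD A d) (hpos : 0 < d) (hirr : Irreducible A) (hdX : ¬ A ∣ dX A) (Fq : Finset K) :
    Om Fq A ≤ (ZZ Fq A).card + d * d * d * d := by
  have h1 := card_common hm hd hT hpos hirr hT.dX hdX Fq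
  rw [Om, ← Finset.sum_product', ZZ, Finset.card_filter]
  rw [Finset.card_filter] at h1
  calc _ ≤ ∑ z ∈ Fq ×ˢ Fq, ((if E2 z.1 z.2 A = 0 then 1 else 0) +
        (if E2 z.1 z.2 A = 0 ∧ E2 z.1 z.2 (dX A) = 0 then 1 else 0) * d) := ?_
    _ ≤ _ := by
      rw [Finset.sum_add_distrib, ← Finset.sum_mul]
      exact Nat.add_le_add_left (Nat.mul_le_mul_right d h1) _
  refine Finset.sum_le_sum ?_
  rintro ⟨x, y⟩ _
  simp only
  rcases eq_or_ne (E2 x y A) 0 with h | h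
  · rw [if_pos h]
    rcases eq_or_ne (E2 x y (dX A)) 0 with h' | h'
    · rw [if_pos ⟨h, h'⟩]
      have h2 := sum_rootMultiplicity_le {x} (f := A.eval (C y))
      rw [Finset.sum_singleton] at h2
      have := hT.natDegree_eval y
      omega
    · rw [if_neg (fun hh => h' hh.2)]
      rw [E2_eq_eval, eval_dX] at h'
      by_contra hcon
      have h3 : 1 < (A.eval (C y)).rootMultiplicity x := by omega
      apply h'
      by_cases h0 : A.eval (C y) = 0
      · rw [h0]; simp
      · exact ((one_lt_rootMultiplicity_iff_isRoot h0).1 h3).2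
  · have h2 : (A.eval (C y)).rootMultiplicity x = 0 := by
      rw [E2_eq_eval] at h
      exact rootMultiplicity_eq_zero h
    rw [h2]; exact Nat.zero_le _

end comp
end NT
end

section
open Polynomial

namespace NT

section comp2
variable {K : Type*} [Field K]

lemma E2_zero_frob {p m : ℕ} [ExpChar K p] (A : K[X][X]) :
    E2 0 0 (A.map (mapRingHom (iterateFrobenius K p m))) = (E2 0 0 A) ^ (p ^ m) := by
  have h := E2_hom (iterateFrobenius K p m) 0 0 A
  rw [map_zero] at h
  rw [← h, iterateFrobenius_def]

lemma irreducible_frob [IsAlgClosed K] {p m : ℕ} [ExpChar K p] {A : K[X][X]} (h : Irreducible A) :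
    Irreducible (A.map (mapRingHom (iterateFrobenius K p m))) := by
  haveI : PerfectRing K p := PerfectField.toPerfectRing p
  let e : K[X][X] ≃+* K[X][X] := mapEquiv (mapEquiv (iterateFrobeniusEquiv K p m))
  have he : e A = A.map (mapRingHom (iterateFrobenius K p m)) := by
    change A.map _ = _
    congr 1
  rw [← he]
  exact (MulEquiv.irreducible_iff e).2 h

lemma exists_factor {P : K[X][X]} {d : ℕ} {c : K} (hc : P.coeff d = C c) (hc0 : c ≠ 0)
    (hT : TD P d) (h0 : E2 0 0 P = 0) :
    ∃ A B : K[X][X], P = A * B ∧ A.Monic ∧ Irreducible A ∧ E2 0 0 A = 0 := by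
  have hP0 : P ≠ 0 := by
    rintro rfl
    rw [coeff_zero] at hc
    exact hc0 (C_eq_zero.1 hc.symm)
  have hnd : P.natDegree = d := by
    refine le_antisymm hT.natDegree_le (le_natDegree_of_ne_zero ?_)
    rw [hc]; exact C_ne_zero.2 hc0
  obtain ⟨f, hf, hfp⟩ := UniqueFactorizationMonoid.exists_prime_factors P hP0
  have h1 : E2 0 0 f.prod = 0 := by
    obtain ⟨u, hu⟩ := hfp.symm
    rw [← hu, map_mul, h0, zero_mul]
  rw [map_multiset_prod, Multiset.prod_eq_zero_iff, Multiset.mem_map] at h1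
  obtain ⟨b, hb, hb0⟩ := h1
  have hbP : b ∣ P := (Multiset.dvd_prod hb).trans hfp.dvd
  obtain ⟨B, rfl⟩ := hbP
  have hlc : b.leadingCoeff * B.leadingCoeff = C c := by
    rw [← leadingCoeff_mul, leadingCoeff, hnd, hc]
  have hu : IsUnit b.leadingCoeff := by
    have : IsUnit (C c) := isUnit_C.2 (isUnit_iff_ne_zero.2 hc0)
    rw [← hlc] at this
    exact isUnit_of_mul_isUnit_left this
  obtain ⟨u, hu⟩ := hu
  refine ⟨C (↑u⁻¹ : K[X]) * b, C (u : K[X]) * B, ?_, ?_, ?_, ?_⟩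
  · have : (C (↑u⁻¹ : K[X]) * C (u : K[X]) : K[X][X]) = 1 := by
      rw [← C_mul, Units.inv_mul, C_1]
    linear_combination (-b * B) * this
  · apply monic_C_mul_of_mul_leadingCoeff_eq_one
    rw [← hu, Units.inv_mul]
  · have hirr := (hf b hb).irreducible
    have hun : IsUnit (C (↑u⁻¹ : K[X]) : K[X][X]) := isUnit_C.2 (Units.isUnit _)
    exact (irreducible_isUnit_mul hun).2 hirr
  · rw [map_mul, hb0, mul_zero]

theorem component [IsAlgClosed K] [DecidableEq K] {P : K[X][X]} {d p m q : ℕ} [ExpChar K p]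
    (hq : q = p ^ m) (hq2 : 2 ≤ q)
    {Fq : Finset K} (hcard : Fq.card = q) (hFq : ∏ c ∈ Fq, (X - C c) = (X ^ q - X : K[X]))
    {c : K} (hc : P.coeff d = C c) (hc0 : c ≠ 0) (hT : TD P d)
    (hfrob : P.map (mapRingHom (iterateFrobenius K p m)) = P)
    (h0 : E2 0 0 P = 0) (hY : E2 0 0 (derivative P) ≠ 0) (hX : E2 0 0 (dX P) ≠ 0) :
    (q : ℝ) - ((d : ℝ) - 1) * (d - 2) * Real.sqrt q - (d : ℝ) ^ 4 - d ≤ (ZZ Fq P).card := by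
  have hP0 : P ≠ 0 := by
    rintro rfl
    rw [coeff_zero] at hc
    exact hc0 (C_eq_zero.1 hc.symm)
  have hnd : P.natDegree = d := by
    refine le_antisymm hT.natDegree_le (le_natDegree_of_ne_zero ?_)
    rw [hc]; exact C_ne_zero.2 hc0
  obtain ⟨A, B, rfl, hAm, hAi, hA0⟩ := exists_factor hc hc0 hT h0
  rw [derivative_mul, map_add, map_mul, map_mul, hA0, zero_mul, add_zero] at hY
  rw [dX_mul, map_add, map_mul, map_mul, hA0, zero_mul, add_zero] at hX
  have hB0 := right_ne_zero_of_mul hY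
  have hAY := left_ne_zero_of_mul hY
  have hAX := left_ne_zero_of_mul hX
  have hdvd : ∀ H : K[X][X], E2 0 0 H ≠ 0 → ¬ A ∣ H := by
    rintro H hH ⟨t, rfl⟩
    rw [map_mul, hA0, zero_mul] at hH
    exact hH rfl
  have hfA : A.map (mapRingHom (iterateFrobenius K p m)) = A := by
    have hi := irreducible_frob (p := p) (m := m) hAi
    have hdv : A.map (mapRingHom (iterateFrobenius K p m)) ∣ A * B := by
      rw [← hfrob, Polynomial.map_mul]; exact dvd_mul_right _ _
    rcases hi.prime.dvd_or_dvd hdv with h | h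
    · exact eq_of_monic_of_associated (hAm.map _) hAm (hi.associated_of_dvd hAi h)
    · exfalso
      obtain ⟨t, ht⟩ := h
      apply hB0
      rw [ht, map_mul, E2_zero_frob, hA0, zero_pow (pow_ne_zero _ (expChar_pos K p).ne'), zero_mul]
  have hdeg : A.natDegree + B.natDegree = d := by
    rw [← natDegree_mul (left_ne_zero_of_mul hP0) (right_ne_zero_of_mul hP0), hnd]
  have hTA := TD_of_mul hdeg hT hP0
  have hpos : 0 < A.natDegree := by
    by_contra h
    have : A = 1 := hAm.natDegree_eq_zero.1 (by omega)
    rw [this] at hA0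
    simp at hA0
  have hw := weil hq hq2 hcard hFq hAm rfl hTA hpos hAi hfA (hdvd _ hAY) (hdvd _ hAX)
  have hO := Om_le hAm rfl hTA hpos hAi (hdvd _ hAX) Fq
  have hZ : (ZZ Fq A).card ≤ (ZZ Fq (A * B)).card := by
    apply Finset.card_le_card
    intro z hz
    rw [ZZ, Finset.mem_filter] at hz ⊢
    exact ⟨hz.1, by rw [map_mul, hz.2, zero_mul]⟩
  set δ := A.natDegree
  have hδ : (1 : ℝ) ≤ δ := by exact_mod_cast hpos
  have hδd : (δ : ℝ) ≤ d := by exact_mod_cast (by omega : δ ≤ d)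
  have hO' : (Om Fq A : ℝ) ≤ (ZZ Fq A).card + δ * δ * δ * δ := by exact_mod_cast hO
  have hZ' : ((ZZ Fq A).card : ℝ) ≤ (ZZ Fq (A * B)).card := by exact_mod_cast hZ
  have h4 : (δ : ℝ) * δ * δ * δ ≤ (d : ℝ) ^ 4 := by
    have : (δ : ℝ) ^ 4 ≤ (d : ℝ) ^ 4 := by gcongr
    nlinarith
  have h5 : ((δ : ℝ) - 1) * (δ - 2) ≤ ((d : ℝ) - 1) * (d - 2) := by
    rcases eq_or_ne δ d with h | h
    · rw [h]
    · have : (δ : ℝ) + 1 ≤ d := by exact_mod_cast (by omega : δ + 1 ≤ d)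
      nlinarith
  have h6 := mul_le_mul_of_nonneg_right h5 (Real.sqrt_nonneg q)
  linarith

end comp2
end NT
end

section
open Polynomial

namespace NT

section plane
variable {F K : Type*} [Field F] [Field K]

noncomputable def LL (φ : ℕ → F →+* K) (p v w : F) (i : ℕ) : K[X][X] :=
  C (C (φ i p) + C (φ i v) * X) + C (C (φ i w)) * X

noncomputable def HH (φ : ℕ → F →+* K) (r d : ℕ) (f : F[X]) (z : K[X]) (p v w : F) : K[X][X] :=
  C z ^ (d - r) * ∏ i ∈ Finset.range r, LL φ p v w i -
    ∑ i ∈ Finset.range r, ∑ j ∈ Finset.range (d + 1),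
      C (C (φ i (f.coeff j))) * C z ^ (d - j) * LL φ p v w i ^ j

noncomputable def UU (φ : ℕ → F →+* K) (r d : ℕ) (f : F[X]) (z : K[X]) (p u : F) : K[X] :=
  z ^ (d - r) * ∏ i ∈ Finset.range r, (C (φ i p) + C (φ i u) * X) -
    ∑ i ∈ Finset.range r, ∑ j ∈ Finset.range (d + 1),
      C (φ i (f.coeff j)) * z ^ (d - j) * (C (φ i p) + C (φ i u) * X) ^ j

variable {φ : ℕ → F →+* K} {r d : ℕ} {f : F[X]} {z : K[X]} {p v w u : F}

lemma HH_eval : (HH φ r d f z p v w).eval (C 0) = UU φ r d f z p v := by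
  simp [HH, UU, LL, eval_finset_sum, eval_prod]

lemma HH_map : (HH φ r d f z p v w).map (evalRingHom 0) = UU φ r d f (C (z.eval 0)) p w := by
  simp [HH, UU, LL, Polynomial.map_sum, Polynomial.map_prod]

noncomputable def BB (φ : ℕ → F →+* K) (r d : ℕ) (f : F[X]) (c : K) (p : F) (i : ℕ) : K :=
  c ^ (d - r) * ∏ l ∈ (Finset.range r).erase i, φ l p -
    ∑ j ∈ Finset.range (d + 1), φ i (f.coeff j) * c ^ (d - j) * (j * φ i p ^ (j - 1))

noncomputable def AA (φ : ℕ → F →+* K) (r d : ℕ) (f : F[X]) (z : K[X]) (p : F) : K :=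
  (derivative (z ^ (d - r))).eval 0 * ∏ i ∈ Finset.range r, φ i p -
    ∑ i ∈ Finset.range r, ∑ j ∈ Finset.range (d + 1),
      φ i (f.coeff j) * (derivative (z ^ (d - j))).eval 0 * φ i p ^ j

lemma UU_der : (derivative (UU φ r d f z p u)).eval 0 =
    AA φ r d f z p + ∑ i ∈ Finset.range r, BB φ r d f (z.eval 0) p i * φ i u := by
  classical
  rw [UU, derivative_sub, derivative_mul, derivative_prod_finset, derivative_sum]
  simp only [derivative_sum, derivative_mul, derivative_C, zero_mul, zero_add, eval_sub, eval_add,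
    eval_mul, eval_finset_sum, eval_prod, eval_C, eval_X, mul_zero, add_zero, eval_pow,
    derivative_add, derivative_X, mul_one, derivative_pow (C _ + C _ * X), eval_natCast]
  rw [AA, Finset.sum_congr rfl (fun i _ => by
    rw [BB, sub_mul, Finset.sum_mul] :
    ∀ i ∈ Finset.range r, BB φ r d f (z.eval 0) p i * φ i u = _), Finset.sum_sub_distrib]
  simp only [Finset.sum_add_distrib]
  have h1 : eval 0 z ^ (d - r) * ∑ x ∈ Finset.range r, (∏ l ∈ (Finset.range r).erase x, φ l p) * φ x u
     = ∑ x ∈ Finset.range r, eval 0 z ^ (d - r) * (∏ l ∈ (Finset.range r).erase x, φ l p) * φ x u := by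
    rw [Finset.mul_sum]; exact Finset.sum_congr rfl fun _ _ => by ring
  rw [h1]
  have h2 : ∀ a b c d' e : K, a + b - (c + d') = a - c + (b - e) ↔ d' = e := by
    intro a b c d' e; constructor <;> intro h <;> linear_combination -h
  rw [h2]
  exact Finset.sum_congr rfl fun _ _ => Finset.sum_congr rfl fun _ _ => by ring

lemma AA_C (c : K) : AA φ r d f (C c) p = 0 := by
  have h : ∀ n, derivative (C c ^ n) = 0 := by intro n; rw [← C_pow, derivative_C]
  simp only [AA, h, eval_zero, zero_mul, mul_zero, Finset.sum_const_zero, sub_zero]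

lemma HH_dY : E2 0 0 (derivative (HH φ r d f z p v w)) =
    ∑ i ∈ Finset.range r, BB φ r d f (z.eval 0) p i * φ i w := by
  rw [E2_apply, ← derivative_map, HH_map, UU_der, AA_C, zero_add, eval_C]

lemma HH_dX : E2 0 0 (dX (HH φ r d f z p v w)) =
    AA φ r d f z p + ∑ i ∈ Finset.range r, BB φ r d f (z.eval 0) p i * φ i v := by
  rw [E2_eq_eval, eval_dX, HH_eval, UU_der]

lemma HH_E2 (x y : K) : E2 x y (HH φ r d f z p v w) =
    (z.eval x) ^ (d - r) * ∏ i ∈ Finset.range r, (φ i p + φ i v * x + φ i w * y) -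
    ∑ i ∈ Finset.range r, ∑ j ∈ Finset.range (d + 1),
      φ i (f.coeff j) * (z.eval x) ^ (d - j) * (φ i p + φ i v * x + φ i w * y) ^ j := by
  rw [E2_apply]
  simp [HH, LL, Polynomial.map_sum, Polynomial.map_prod, eval_finset_sum, eval_prod]

lemma LL_natDegree (i : ℕ) : (LL φ p v w i).natDegree ≤ 1 := by
  rw [LL, add_comm]; exact natDegree_linear_le

lemma LL_coeff (i : ℕ) : (LL φ p v w i).coeff 1 = C (φ i w) := by
  simp [LL, coeff_C]

lemma LL_TD (i : ℕ) : TD (LL φ p v w i) 1 := by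
  rw [LL]
  refine TD.add (TD.C ?_) ?_
  · rw [add_comm]; exact natDegree_linear_le
  · have := (TD.C (f := C (φ i w)) (m := 0) (by simp)).mul TD.X
    simpa using this

lemma HH_TD (hz : z.natDegree ≤ 1) (hrd : r ≤ d) : TD (HH φ r d f z p v w) d := by
  have hzT : ∀ n, TD (C z ^ n) n := fun n => by
    simpa using (TD.C hz).pow n
  refine TD.sub ?_ (TD.sum fun i _ => TD.sum fun j hj => ?_)
  · have h1 := (hzT (d - r)).mul (TD.prod (s := Finset.range r) (f := LL φ p v w) (m := fun _ => 1)
      (fun i _ => LL_TD i))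
    refine h1.mono ?_
    simp; omega
  · rw [Finset.mem_range] at hj
    have h1 := ((TD.C (f := C (φ i (f.coeff j))) (m := 0) (by simp)).mul (hzT (d - j))).mul
      ((LL_TD (φ := φ) (p := p) (v := v) (w := w) i).pow j)
    exact h1.mono (by omega)

lemma HH_coeff (hrd : r ≤ d) : (HH φ r d f z p v w).coeff d =
    C ((if d = r then ∏ i ∈ Finset.range r, φ i w else 0) -
      ∑ i ∈ Finset.range r, φ i (f.coeff d) * φ i w ^ d) := by
  have hpow : ∀ i j, j ≤ d → (LL φ p v w i ^ j).coeff d = if j = d then C (φ i w ^ d) else 0 := by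
    intro i j hj
    split_ifs with h
    · subst h
      have := coeff_pow_of_natDegree_le (m := j) (LL_natDegree (φ := φ) (p := p) (v := v) (w := w) i)
      rw [mul_one] at this
      rw [this, LL_coeff, C_pow]
    · apply coeff_eq_zero_of_natDegree_lt
      have := natDegree_pow_le_of_le j (LL_natDegree (φ := φ) (p := p) (v := v) (w := w) i)
      omega
  rw [HH, coeff_sub, finsetSum_coeff, C_sub, map_sum]
  congr 1
  · rw [← C_pow, coeff_C_mul]
    split_ifs with h
    · subst h
      have := coeff_prod_of_natDegree_le (s := Finset.range d) (LL φ p v w) 1 (fun i _ => LL_natDegree i)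
      rw [mul_one, Finset.card_range] at this
      rw [this, Nat.sub_self, pow_zero, one_mul, map_prod]
      exact Finset.prod_congr rfl fun i _ => LL_coeff i
    · rw [coeff_eq_zero_of_natDegree_lt, mul_zero, C_0]
      have := natDegree_prod_le (Finset.range r) (LL φ p v w)
      have h2 : ∑ i ∈ Finset.range r, (LL φ p v w i).natDegree ≤ ∑ i ∈ Finset.range r, 1 :=
        Finset.sum_le_sum fun i _ => LL_natDegree i
      simp at h2
      omega
  · refine Finset.sum_congr rfl fun i _ => ?_
    rw [finsetSum_coeff, Finset.sum_eq_single d]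
    · rw [Nat.sub_self, pow_zero, mul_one, coeff_C_mul, hpow i d le_rfl, if_pos rfl, C_mul]
    · intro j hj hjd
      rw [Finset.mem_range] at hj
      rw [← C_pow, ← C_mul, coeff_C_mul, hpow i j (by omega), if_neg hjd, mul_zero]
    · intro h; exact (h (Finset.mem_range.2 (by omega))).elim

lemma sum_shift {M : Type*} [AddCancelCommMonoid M] (g : ℕ → M) (r : ℕ) (hg : g r = g 0) :
    ∑ i ∈ Finset.range r, g (i + 1) = ∑ i ∈ Finset.range r, g i := by
  have h1 := Finset.sum_range_succ g r
  have h2 := Finset.sum_range_succ' g r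
  rw [hg] at h1
  exact add_right_cancel (h2.symm.trans h1)

lemma prod_shift {M : Type*} [CommRing M] [IsDomain M] (g : ℕ → M) (r : ℕ) (hg : g r = g 0) :
    ∏ i ∈ Finset.range r, g (i + 1) = ∏ i ∈ Finset.range r, g i := by
  by_cases h0 : g 0 = 0
  · rcases Nat.eq_zero_or_pos r with hr0 | hr0
    · subst hr0; simp
    · rw [Finset.prod_eq_zero (i := r - 1) (by simp; omega) (by
            rw [Nat.sub_add_cancel hr0, hg, h0]),
          Finset.prod_eq_zero (i := 0) (by simpa using hr0) h0]
  have h1 := Finset.prod_range_succ g r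
  have h2 := Finset.prod_range_succ' g r
  rw [hg] at h1
  exact mul_right_cancel₀ h0 (h2.symm.trans h1)

lemma HH_frob (Φ : K →+* K) (hΦ : ∀ i x, Φ (φ i x) = φ (i + 1) x) (hr : φ r = φ 0)
    (hz : z.map Φ = z) : (HH φ r d f z p v w).map (mapRingHom Φ) = HH φ r d f z p v w := by
  have hL : ∀ i, (LL φ p v w i).map (mapRingHom Φ) = LL φ p v w (i + 1) := by
    intro i; simp [LL, hΦ]
  have hLr : LL φ p v w r = LL φ p v w 0 := by simp [LL, hr]
  have hCz : (C z : K[X][X]).map (mapRingHom Φ) = C z := by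
    rw [map_C, coe_mapRingHom, hz]
  have hCC : ∀ i x, (C (C (φ i x)) : K[X][X]).map (mapRingHom Φ) = C (C (φ (i + 1) x)) := by
    intro i x; rw [map_C, coe_mapRingHom, map_C, hΦ]
  have e1 : (C z ^ (d - r) * ∏ i ∈ Finset.range r, LL φ p v w i).map (mapRingHom Φ) =
      C z ^ (d - r) * ∏ i ∈ Finset.range r, LL φ p v w i := by
    have a := prod_shift (LL φ p v w) r hLr
    rw [Polynomial.map_mul, Polynomial.map_pow, hCz, Polynomial.map_prod]
    exact congrArg _ ((Finset.prod_congr rfl fun i _ => hL i).trans a)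
  have e2 : (∑ i ∈ Finset.range r, ∑ j ∈ Finset.range (d + 1),
      C (C (φ i (f.coeff j))) * C z ^ (d - j) * LL φ p v w i ^ j).map (mapRingHom Φ) =
      ∑ i ∈ Finset.range r, ∑ j ∈ Finset.range (d + 1),
      C (C (φ i (f.coeff j))) * C z ^ (d - j) * LL φ p v w i ^ j := by
    have a := sum_shift (fun i => ∑ j ∈ Finset.range (d + 1),
      C (C (φ i (f.coeff j))) * C z ^ (d - j) * LL φ p v w i ^ j) r (by simp only [hr, hLr])
    rw [Polynomial.map_sum]
    refine Eq.trans (Finset.sum_congr rfl fun i _ => ?_) a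
    rw [Polynomial.map_sum]
    refine Finset.sum_congr rfl fun j _ => ?_
    rw [Polynomial.map_mul, Polynomial.map_mul, Polynomial.map_pow, Polynomial.map_pow, hCz, hCC, hL]
  rw [HH, Polynomial.map_sub, e1, e2]

end plane
end NT
end

section
open Polynomial

namespace NT

section count
variable {F : Type*} [Field F] [Fintype F] [DecidableEq F]

/-- the subfield of order q -/
def AF (F : Type*) [Field F] [Fintype F] [DecidableEq F] (q : ℕ) : Finset F :=
  Finset.univ.filter (fun c => c ^ q = c)

lemma mem_AF {q : ℕ} {c : F} : c ∈ AF F q ↔ c ^ q = c := by simp [AF]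

omit [Fintype F] [DecidableEq F] in
lemma pow_pow_AF {q : ℕ} {c : F} (hc : c ^ q = c) (i : ℕ) : c ^ q ^ i = c := by
  induction i with
  | zero => simp
  | succ n ih => rw [pow_succ, pow_mul, ih, hc]

variable {p m q r : ℕ} [ExpChar F p]

noncomputable def psi (F : Type*) [Field F] (p m : ℕ) [ExpChar F p] (i : ℕ) : F →+* F :=
  iterateFrobenius F p (m * i)

omit [Fintype F] [DecidableEq F] in
lemma psi_apply (hq : q = p ^ m) (i : ℕ) (x : F) : psi F p m i x = x ^ q ^ i := by
  rw [psi, iterateFrobenius_def, hq, pow_mul]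

variable {K : Type*} [Field K] [IsAlgClosed K] [DecidableEq K] [Algebra F K] [ExpChar K p]

omit [IsAlgClosed K] [DecidableEq K] [DecidableEq F] in
lemma mem_range_of_pow_card {c : K} (hc : c ^ Fintype.card F = c) : ∃ a : F, algebraMap F K a = c := by
  have h1 := FiniteField.roots_X_pow_card_sub_X F
  have hm : (X ^ Fintype.card F - X : F[X]).Monic := by
    apply monic_X_pow_sub
    rw [degree_X]; exact_mod_cast Fintype.one_lt_card
  have h2 := prod_multiset_X_sub_C_of_monic_of_roots_card_eq hm (by
    rw [h1, FiniteField.X_pow_card_sub_X_natDegree_eq F Fintype.one_lt_card]; rfl)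
  rw [h1] at h2
  have h3 : (∏ a : F, (X - C a)) = (X ^ Fintype.card F - X : F[X]) := h2
  have h4 := congrArg (fun P => eval₂ (algebraMap F K) c P) h3
  simp only [eval₂_sub, eval₂_X_pow, eval₂_X, hc, sub_self, eval₂_finsetProd, eval₂_C] at h4
  obtain ⟨a, -, ha⟩ := Finset.prod_eq_zero_iff.1 h4
  exact ⟨a, (sub_eq_zero.1 ha).symm⟩

lemma Fq_facts (hq : q = p ^ m) (hp : p.Prime) (hm : 0 < m)
    (hF : Fintype.card F = q ^ r) :
    (∏ c ∈ (AF F q).image (algebraMap F K), (X - C c) = X ^ q - X) ∧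
    ((AF F q).image (algebraMap F K)).card = q ∧ (AF F q).card = q := by
  have : Fact p.Prime := ⟨hp⟩
  have : CharP K p := by
    rcases ‹ExpChar K p› with _ | h
    · exact absurd hp (by norm_num)
    · assumption
  have hq1 : 1 < q := by rw [hq]; exact Nat.one_lt_pow hm.ne' hp.one_lt
  set P : K[X] := X ^ q - X
  have hsep : P.Separable := galois_poly_separable p q (by rw [hq]; exact dvd_pow_self p hm.ne')
  have hmon : P.Monic := by
    apply monic_X_pow_sub
    rw [degree_X]; exact_mod_cast hq1
  have hdeg : P.natDegree = q := FiniteField.X_pow_card_sub_X_natDegree_eq K hq1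
  have hspl : P.Splits := IsAlgClosed.splits P
  have hnd : P.roots.Nodup := nodup_roots hsep
  have himg : (AF F q).image (algebraMap F K) = P.roots.toFinset := by
    ext c
    rw [Multiset.mem_toFinset, mem_roots hmon.ne_zero, IsRoot.def, Finset.mem_image]
    simp only [P, eval_sub, eval_pow, eval_X]
    constructor
    · rintro ⟨a, ha, rfl⟩
      rw [mem_AF] at ha
      rw [← map_pow, ha, sub_self]
    · intro h
      have hc : c ^ q = c := sub_eq_zero.1 h
      obtain ⟨a, rfl⟩ := mem_range_of_pow_card (F := F) (c := c) (by rw [hF]; exact pow_pow_AF hc r)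
      refine ⟨a, mem_AF.2 ?_, rfl⟩
      apply (algebraMap F K).injective
      rw [map_pow, hc]
  have hcard : P.roots.toFinset.card = q := by
    rw [Multiset.toFinset_card_of_nodup hnd, ← hspl.natDegree_eq_card_roots, hdeg]
  refine ⟨?_, ?_, ?_⟩
  · rw [himg]
    conv_rhs => rw [hspl.eq_prod_roots_of_monic hmon]
    rw [Finset.prod, Multiset.toFinset_val, hnd.dedup]
  · rw [himg, hcard]
  · rw [← Finset.card_image_of_injective _ (algebraMap F K).injective, himg, hcard]

/-- value of the plane section at a point -/
noncomputable def hh (p m r d : ℕ) [ExpChar F p] (f z : F[X]) (p0 w v x y : F) : F :=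
  (z.eval x) ^ (d - r) * ∏ i ∈ Finset.range r, (psi F p m i p0 + psi F p m i v * x + psi F p m i w * y) -
    ∑ i ∈ Finset.range r, ∑ j ∈ Finset.range (d + 1),
      psi F p m i (f.coeff j) * (z.eval x) ^ (d - j) *
        (psi F p m i p0 + psi F p m i v * x + psi F p m i w * y) ^ j

/-- number of points on the section with x ≠ 0 -/
noncomputable def cnt (q p m r d : ℕ) [ExpChar F p] (f z : F[X]) (p0 w v : F) : ℕ :=
  ((AF F q ×ˢ AF F q).filter (fun t => t.1 ≠ 0 ∧ hh p m r d f z p0 w v t.1 t.2 = 0)).card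

variable {d : ℕ} {f z : F[X]} {p0 w v : F}

lemma cnt_shift (hq : q = p ^ m) : cnt q p m r d f z p0 w (v + w) = cnt q p m r d f z p0 w v := by
  unfold cnt
  refine Finset.card_bij' (fun t _ => (t.1, t.2 + t.1)) (fun t _ => (t.1, t.2 - t.1)) ?_ ?_ ?_ ?_
  · rintro ⟨x, y⟩ h
    simp only [Finset.mem_filter, Finset.mem_product, mem_AF] at h ⊢
    refine ⟨⟨h.1.1, ?_⟩, h.2.1, ?_⟩
    · rw [hq, add_pow_expChar_pow, ← hq, h.1.1, h.1.2]
    · rw [← h.2.2, hh, hh]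
      have : ∀ i, psi F p m i p0 + psi F p m i v * x + psi F p m i w * (y + x) =
        psi F p m i p0 + psi F p m i (v + w) * x + psi F p m i w * y := by
        intro i; rw [map_add]; ring
      simp only [this]
  · rintro ⟨x, y⟩ h
    simp only [Finset.mem_filter, Finset.mem_product, mem_AF] at h ⊢
    refine ⟨⟨h.1.1, ?_⟩, h.2.1, ?_⟩
    · rw [hq, sub_pow_expChar_pow, ← hq, h.1.1, h.1.2]
    · rw [← h.2.2, hh, hh]
      have : ∀ i, psi F p m i p0 + psi F p m i v * x + psi F p m i w * y =
        psi F p m i p0 + psi F p m i (v + w) * x + psi F p m i w * (y - x) := by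
        intro i; rw [map_add]; ring
      simp only [this]
  · rintro ⟨x, y⟩ h; simp
  · rintro ⟨x, y⟩ h; simp

/-- the point set of interest -/
def SS (q r : ℕ) (f : F[X]) : Finset F :=
  Finset.univ.filter (fun u => ∏ i ∈ Finset.range r, u ^ q ^ i = ∑ i ∈ Finset.range r, (f.eval u) ^ q ^ i)

lemma hh_eq (hq : q = p ^ m) (hrd : r ≤ d) (hf : f.natDegree ≤ d) {x y : F} (hx : x ^ q = x)
    (hy : y ^ q = y) (hz : (z.eval x) ^ q = z.eval x) (hz0 : z.eval x ≠ 0) :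
    hh p m r d f z p0 w v x y = 0 ↔ (p0 + v * x + w * y) / z.eval x ∈ SS q r f := by
  have hpx : ∀ i, psi F p m i x = x := fun i => by rw [psi_apply hq, pow_pow_AF hx]
  have hpy : ∀ i, psi F p m i y = y := fun i => by rw [psi_apply hq, pow_pow_AF hy]
  set ζ := z.eval x with hζ
  have hpz : ∀ i, psi F p m i ζ = ζ := fun i => by rw [psi_apply hq, pow_pow_AF hz]
  set u := (p0 + v * x + w * y) / ζ with hu
  have hlin : ∀ i, psi F p m i p0 + psi F p m i v * x + psi F p m i w * y = ζ * psi F p m i u := by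
    intro i
    have : p0 + v * x + w * y = ζ * u := by rw [hu]; field_simp
    have h2 := congrArg (psi F p m i) this
    simpa only [map_add, map_mul, hpx, hpy, hpz] using h2
  have key : hh p m r d f z p0 w v x y = ζ ^ d * (∏ i ∈ Finset.range r, psi F p m i u -
      ∑ i ∈ Finset.range r, psi F p m i (f.eval u)) := by
    rw [hh, mul_sub, Finset.mul_sum]
    congr 1
    · simp only [hlin, Finset.prod_mul_distrib, Finset.prod_const, Finset.card_range]
      rw [← mul_assoc, ← pow_add, Nat.sub_add_cancel hrd]
    · refine Finset.sum_congr rfl fun i _ => ?_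
      rw [eval_eq_sum_range' (Nat.lt_succ_of_le hf), map_sum, Finset.mul_sum]
      refine Finset.sum_congr rfl fun j hj => ?_
      have hj : j ≤ d := by simpa [Nat.lt_succ_iff] using hj
      rw [hlin, map_mul, map_pow, mul_pow]
      have : ζ ^ d = ζ ^ (d - j) * ζ ^ j := by rw [← pow_add, Nat.sub_add_cancel hj]
      rw [this]; ring
  rw [key, mul_eq_zero, or_iff_right (pow_ne_zero _ hz0), sub_eq_zero, SS, Finset.mem_filter]
  simp only [psi_apply hq, Finset.mem_univ, true_and]

lemma sum_cnt (hq : q = p ^ m) (hrd : r ≤ d) (hf : f.natDegree ≤ d)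
    (hA : (AF F q).card = q) (hq1 : 1 < q) (hz : z = 1 ∨ z = X) :
    ∑ v : F, cnt q p m r d f z p0 w v = q * (q - 1) * (SS q r f).card := by
  have h1 : ∀ v : F, cnt q p m r d f z p0 w v =
      ∑ t ∈ (AF F q ×ˢ AF F q).filter (fun t => t.1 ≠ 0), if hh p m r d f z p0 w v t.1 t.2 = 0 then 1 else 0 := by
    intro v
    rw [cnt, ← Finset.filter_filter, Finset.card_filter]
  rw [Finset.sum_congr rfl fun v _ => h1 v, Finset.sum_comm]
  have h2 : ∀ t ∈ (AF F q ×ˢ AF F q).filter (fun t => t.1 ≠ 0),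
      (∑ v : F, if hh p m r d f z p0 w v t.1 t.2 = 0 then 1 else 0) = (SS q r f).card := by
    rintro ⟨x, y⟩ ht
    simp only [Finset.mem_filter, Finset.mem_product, mem_AF] at ht
    obtain ⟨⟨hx, hy⟩, hx0⟩ := ht
    have hzq : (z.eval x) ^ q = z.eval x ∧ z.eval x ≠ 0 := by
      rcases hz with rfl | rfl <;> simp [hx, hx0]
    rw [← Finset.card_filter]
    refine Finset.card_bij' (fun v _ => (p0 + v * x + w * y) / z.eval x)
      (fun u _ => (u * z.eval x - p0 - w * y) / x) ?_ ?_ ?_ ?_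
    · intro v hv
      rw [Finset.mem_filter] at hv
      exact (hh_eq hq hrd hf hx hy hzq.1 hzq.2).1 hv.2
    · intro u hu
      rw [Finset.mem_filter]
      refine ⟨Finset.mem_univ _, (hh_eq hq hrd hf hx hy hzq.1 hzq.2).2 ?_⟩
      convert hu using 1
      have := hzq.2
      field_simp
      ring
    · intro v hv
      have := hzq.2
      field_simp
      ring
    · intro u hu
      have := hzq.2
      field_simp
      ring
  rw [Finset.sum_congr rfl h2, Finset.sum_const, smul_eq_mul]
  congr 1
  have h3 : (AF F q ×ˢ AF F q).filter (fun t => t.1 ≠ 0) = (AF F q).erase 0 ×ˢ AF F q := by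
    ext ⟨x, y⟩
    simp only [Finset.mem_filter, Finset.mem_product, Finset.mem_erase]
    tauto
  rw [h3, Finset.card_product, Finset.card_erase_of_mem, hA, mul_comm]
  rw [mem_AF, zero_pow (by omega)]


omit [IsAlgClosed K] [DecidableEq K] in
lemma ZZ_le_cnt [DecidableEq K] (hrd : r ≤ d)
    (φ : ℕ → F →+* K) (hφ : ∀ i, φ i = (algebraMap F K).comp (psi F p m i))
    {c : K} (hc : (HH φ r d f (z.map (algebraMap F K)) p0 v w).coeff d = C c) (hc0 : c ≠ 0)
    (hz : z = 1 ∨ z = X) :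
    (ZZ ((AF F q).image (algebraMap F K)) (HH φ r d f (z.map (algebraMap F K)) p0 v w)).card ≤
      cnt q p m r d f z p0 w v + d := by
  set P := HH φ r d f (z.map (algebraMap F K)) p0 v w with hP
  set ι := algebraMap F K with hι
  have hE : ∀ x y : F, E2 (ι x) (ι y) P = ι (hh p m r d f z p0 w v x y) := by
    intro x y
    rw [hP, HH_E2, hh, eval_map_algebraMap, aeval_algebraMap_apply]
    simp only [hφ, RingHom.comp_apply, map_sub, map_mul, map_pow, map_prod, map_sum, map_add, coe_aeval_eq_eval, ← hι]
  set Q := P.map (evalRingHom 0) with hQ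
  have hQd : Q.natDegree ≤ d := natDegree_map_le.trans (HH_TD (by
    rcases hz with rfl | rfl <;> simp) hrd).natDegree_le
  have hQ0 : Q ≠ 0 := by
    intro h
    have : Q.coeff d = c := by rw [hQ, coeff_map, hc]; simp
    rw [h, coeff_zero] at this
    exact hc0 this.symm
  have hsub : ZZ ((AF F q).image ι) P ⊆
      (((AF F q ×ˢ AF F q).filter (fun t => t.1 ≠ 0 ∧ hh p m r d f z p0 w v t.1 t.2 = 0)).image
        (fun t => (ι t.1, ι t.2))) ∪ Q.roots.toFinset.image (fun y => (0, y)) := by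
    rintro ⟨x', y'⟩ h
    simp only [ZZ, Finset.mem_filter, Finset.mem_product, Finset.mem_image] at h
    obtain ⟨⟨⟨x, hx, rfl⟩, ⟨y, hy, rfl⟩⟩, h⟩ := h
    rw [Finset.mem_union]
    by_cases hx0 : x = 0
    · right
      subst hx0
      rw [Finset.mem_image]
      refine ⟨ι y, ?_, by simp⟩
      rw [Multiset.mem_toFinset, mem_roots hQ0, IsRoot.def, hQ, ← E2_apply]
      rw [map_zero] at h
      exact h
    · left
      rw [Finset.mem_image]
      refine ⟨(x, y), ?_, rfl⟩
      rw [hE] at h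
      simp only [Finset.mem_filter, Finset.mem_product]
      exact ⟨⟨hx, hy⟩, hx0, ι.injective (by rw [h, map_zero])⟩
  refine (Finset.card_le_card hsub).trans ((Finset.card_union_le _ _).trans ?_)
  refine Nat.add_le_add Finset.card_image_le (Finset.card_image_le.trans ?_)
  exact (Multiset.toFinset_card_le _).trans ((card_roots' Q).trans hQd)

end count

theorem plane_bound {F : Type*} [Field F] [Fintype F] [DecidableEq F] {p m q r d : ℕ} [ExpChar F p]
    {f z : F[X]} {p0 w : F} (hq : q = p ^ m) (hp : p.Prime) (hm : 0 < m)
    (hF : Fintype.card F = q ^ r) (hrd : r ≤ d) (hf : f.natDegree ≤ d) (hz : z = 1 ∨ z = X)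
    (h0 : (z.eval 0) ^ (d - r) * ∏ i ∈ Finset.range r, p0 ^ q ^ i -
      ∑ i ∈ Finset.range r, ∑ j ∈ Finset.range (d + 1),
        (f.coeff j) ^ q ^ i * (z.eval 0) ^ (d - j) * (p0 ^ q ^ i) ^ j = 0)
    (hβ : ∑ i ∈ Finset.range r, ((z.eval 0) ^ (d - r) * ∏ l ∈ (Finset.range r).erase i, p0 ^ q ^ l -
      ∑ j ∈ Finset.range (d + 1), (f.coeff j) ^ q ^ i * (z.eval 0) ^ (d - j) *
        (j * (p0 ^ q ^ i) ^ (j - 1))) * w ^ q ^ i ≠ 0)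
    (hT : (if d = r then ∏ i ∈ Finset.range r, w ^ q ^ i else 0) -
      ∑ i ∈ Finset.range r, (f.coeff d) ^ q ^ i * (w ^ q ^ i) ^ d ≠ 0) :
    (q : ℝ) ^ r * ((q : ℝ) - ((d : ℝ) - 1) * (d - 2) * Real.sqrt q - (d : ℝ) ^ 4 - 2 * d) ≤
      q * (q - 1) * (SS q r f).card := by
  classical
  let K := AlgebraicClosure F
  have : ExpChar K p := expChar_of_injective_algebraMap (algebraMap F K).injective p
  obtain ⟨hFq, hFqc, hA⟩ := Fq_facts (K := K) hq hp hm hF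
  have hq1 : 1 < q := by rw [hq]; exact Nat.one_lt_pow hm.ne' hp.one_lt
  set ι := algebraMap F K with hι
  set φ : ℕ → F →+* K := fun i => ι.comp (psi F p m i) with hφ
  have hφa : ∀ i x, φ i x = ι (x ^ q ^ i) := fun i x => by
    simp only [hφ, RingHom.comp_apply, psi_apply hq]
  have hΦ : ∀ i x, iterateFrobenius K p m (φ i x) = φ (i + 1) x := by
    intro i x
    rw [hφa, hφa, iterateFrobenius_def, ← hq, ← map_pow, pow_succ, pow_mul]
  have hφr : φ r = φ 0 := by
    ext x
    rw [hφa, hφa, pow_zero, pow_one, ← hF, FiniteField.pow_card]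
  have hzm : (z.map ι).map (iterateFrobenius K p m) = z.map ι := by
    rcases hz with rfl | rfl <;> simp
  have hze : (z.map ι).eval 0 = ι (z.eval 0) := by
    rcases hz with rfl | rfl <;> simp
  have hzd : (z.map ι).natDegree ≤ 1 := by
    rcases hz with rfl | rfl <;> simp
  set M : ℝ := (q : ℝ) - ((d : ℝ) - 1) * (d - 2) * Real.sqrt q - (d : ℝ) ^ 4 - 2 * d with hM
  set c : K := ((if d = r then ∏ i ∈ Finset.range r, φ i w else 0) -
      ∑ i ∈ Finset.range r, φ i (f.coeff d) * φ i w ^ d) with hcdef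
  have hc0 : c ≠ 0 := by
    have : c = ι ((if d = r then ∏ i ∈ Finset.range r, w ^ q ^ i else 0) -
      ∑ i ∈ Finset.range r, (f.coeff d) ^ q ^ i * (w ^ q ^ i) ^ d) := by
      rw [hcdef, map_sub]
      congr 1
      · split_ifs
        · rw [map_prod]; exact Finset.prod_congr rfl fun i _ => hφa i w
        · rw [map_zero]
      · rw [map_sum]
        refine Finset.sum_congr rfl fun i _ => ?_
        rw [hφa, hφa, map_mul, map_pow ι (w ^ q ^ i) d]
    rw [this]
    exact (map_ne_zero ι).2 hT
  have hdY : ∀ v, E2 0 0 (derivative (HH φ r d f (z.map ι) p0 v w)) ≠ 0 := by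
    intro v
    rw [HH_dY, hze]
    have : ∑ i ∈ Finset.range r, BB φ r d f (ι (z.eval 0)) p0 i * φ i w =
      ι (∑ i ∈ Finset.range r, ((z.eval 0) ^ (d - r) * ∏ l ∈ (Finset.range r).erase i, p0 ^ q ^ l -
      ∑ j ∈ Finset.range (d + 1), (f.coeff j) ^ q ^ i * (z.eval 0) ^ (d - j) *
        (j * (p0 ^ q ^ i) ^ (j - 1))) * w ^ q ^ i) := by
      rw [map_sum]
      refine Finset.sum_congr rfl fun i _ => ?_
      rw [BB, map_mul, hφa i w, map_sub, map_mul, map_pow, map_prod, map_sum]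
      simp only [hφa, map_mul, map_pow, map_natCast]
    rw [this]
    exact (map_ne_zero ι).2 hβ
  have hE0 : ∀ v, E2 0 0 (HH φ r d f (z.map ι) p0 v w) = 0 := by
    intro v
    rw [HH_E2, hze]
    have h1 := congrArg ι h0
    rw [map_zero] at h1
    refine Eq.trans ?_ h1
    simp only [hφa, map_sub, map_sum, map_prod, map_mul, map_pow, mul_zero, add_zero]
  have hgood : ∀ v, E2 0 0 (dX (HH φ r d f (z.map ι) p0 v w)) ≠ 0 → M ≤ cnt q p m r d f z p0 w v := by
    intro v hv
    have h1 := component hq hq1 hFqc hFq (HH_coeff hrd) hc0 (HH_TD hzd hrd)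
      (HH_frob _ hΦ hφr hzm) (hE0 v) (hdY v) hv
    have h2 := ZZ_le_cnt (q := q) (m := m) (p := p) hrd φ (fun i => rfl) (HH_coeff hrd) hc0 hz (v := v) (p0 := p0) (f := f) (w := w)
    have h3 : ((ZZ ((AF F q).image ι) (HH φ r d f (z.map ι) p0 v w)).card : ℝ) ≤
      (cnt q p m r d f z p0 w v : ℝ) + d := by exact_mod_cast h2
    rw [hM]; linarith
  have hall : ∀ v, M ≤ cnt q p m r d f z p0 w v := by
    intro v
    by_cases hv : E2 0 0 (dX (HH φ r d f (z.map ι) p0 v w)) = 0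
    · rw [← cnt_shift hq]
      apply hgood
      have h1 := hdY v
      rw [HH_dX] at hv ⊢
      rw [HH_dY] at h1
      simp only [map_add, mul_add, Finset.sum_add_distrib]
      rw [← add_assoc, hv, zero_add]
      exact h1
    · exact hgood v hv
  have hs := sum_cnt (p0 := p0) (w := w) hq hrd hf hA hq1 hz
  have h1 : (Finset.univ : Finset F).card • M ≤ ∑ v : F, (cnt q p m r d f z p0 w v : ℝ) :=
    Finset.card_nsmul_le_sum _ _ _ fun v _ => hall v
  rw [← Nat.cast_sum, hs, Finset.card_univ, hF, nsmul_eq_mul] at h1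
  push_cast [Nat.cast_sub hq1.le] at h1
  exact h1

end NT
end

section
open Polynomial

namespace NT

lemma exists_w {F : Type*} [Field F] [Fintype F] {q r d : ℕ} (hF : Fintype.card F = q ^ r)
    (hr : 2 ≤ r) (hrd : r ≤ d) (hd : d + 1 < q) {a β : F} (hβ : β ≠ 0) (had : a ≠ 0 ∨ d = r) :
    ∃ w : F, ∑ i ∈ Finset.range r, β ^ q ^ i * w ^ q ^ i ≠ 0 ∧
      (if d = r then ∏ i ∈ Finset.range r, w ^ q ^ i else 0) -
        ∑ i ∈ Finset.range r, a ^ q ^ i * (w ^ q ^ i) ^ d ≠ 0 := by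
  have hq1 : 1 < q := by omega
  have hinj : ∀ i, 0 < i → q ^ i ≠ 1 := fun i hi => (Nat.one_lt_pow hi.ne' hq1).ne'
  have hle : ∀ i ∈ Finset.range r, q ^ i ≤ q ^ (r - 1) := by
    intro i hi
    rw [Finset.mem_range] at hi
    exact Nat.pow_le_pow_right (by omega) (by omega)
  set P : F[X] := ∑ i ∈ Finset.range r, C (β ^ q ^ i) * X ^ q ^ i with hP
  obtain ⟨n, hnn⟩ : ∃ n, n = ∑ i ∈ Finset.range r, q ^ i := ⟨_, rfl⟩
  set Q : F[X] := (if d = r then X ^ n else 0) -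
        ∑ i ∈ Finset.range r, C (a ^ q ^ i) * X ^ (q ^ i * d) with hQ
  have hn : d < n := by
    rw [hnn]
    have : q ^ 1 ≤ ∑ i ∈ Finset.range r, q ^ i :=
      Finset.single_le_sum (f := fun i => q ^ i) (fun _ _ => Nat.zero_le _) (Finset.mem_range.2 (by omega))
    rw [pow_one] at this; omega
  have hn2 : n ≤ d * q ^ (r - 1) := by
    rw [hnn]
    refine (Finset.sum_le_card_nsmul _ _ _ hle).trans ?_
    rw [Finset.card_range, smul_eq_mul]
    exact Nat.mul_le_mul_right _ hrd
  have hP0 : P ≠ 0 := by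
    intro h
    have h1 : P.coeff 1 = β := by
      rw [hP, finsetSum_coeff, Finset.sum_eq_single 0]
      · simp
      · intro i _ hi
        rw [coeff_C_mul, coeff_X_pow, if_neg (hinj i (by omega)).symm, mul_zero]
      · intro h; exact (h (Finset.mem_range.2 (by omega))).elim
    rw [h, coeff_zero] at h1
    exact hβ h1.symm
  have hQ0 : Q ≠ 0 := by
    intro h
    by_cases ha : a = 0
    · have hdr := had.resolve_left (not_not.2 ha)
      rw [hQ, if_pos hdr, Finset.sum_eq_zero, sub_zero] at h
      · exact pow_ne_zero _ X_ne_zero h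
      · intro i _
        rw [ha, zero_pow (pow_ne_zero _ (by omega)), C_0, zero_mul]
    have h1 : Q.coeff d = - a := by
      rw [hQ, coeff_sub, finsetSum_coeff, Finset.sum_eq_single 0]
      · have : (if d = r then (X : F[X]) ^ n else 0).coeff d = 0 := by
          split_ifs with hdr
          · rw [coeff_X_pow, if_neg (by omega)]
          · simp
        rw [this]; simp
      · intro i _ hi
        rw [coeff_C_mul, coeff_X_pow, if_neg, mul_zero]
        intro h2
        have h3 : q ^ i * d = 1 * d := by omega
        exact hinj i (by omega) (Nat.eq_of_mul_eq_mul_right (by omega) h3)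
      · intro h; exact (h (Finset.mem_range.2 (by omega))).elim
    rw [h, coeff_zero] at h1
    exact ha (neg_eq_zero.1 h1.symm)
  have hPd : P.natDegree ≤ q ^ (r - 1) :=
    natDegree_sum_le_of_forall_le _ _ fun i hi => (natDegree_C_mul_X_pow_le _ _).trans (hle i hi)
  have hQd : Q.natDegree ≤ d * q ^ (r - 1) := by
    refine natDegree_sub_le_of_le ?_ (natDegree_sum_le_of_forall_le _ _ fun i hi =>
      (natDegree_C_mul_X_pow_le _ _).trans ?_) |>.trans (max_self _).le
    · split_ifs
      · rw [natDegree_X_pow]; exact hn2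
      · simp
    · rw [mul_comm]; exact Nat.mul_le_mul_left _ (hle i hi)
  obtain ⟨w, hw⟩ := exists_eval_ne_zero_of_natDegree_lt_card (P * Q) (mul_ne_zero hP0 hQ0) (by
    rw [Cardinal.mk_fintype, hF]
    have h1 := natDegree_mul_le (p := P) (q := Q)
    have h2 : q ^ r = q * q ^ (r - 1) := by rw [← pow_succ']; congr 1; omega
    have h3 : (d + 1) * q ^ (r - 1) < q * q ^ (r - 1) := Nat.mul_lt_mul_of_pos_right hd (by positivity)
    have h4 : (P * Q).natDegree < q ^ r := by rw [h2]; linarith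
    exact_mod_cast h4)
  rw [eval_mul] at hw
  refine ⟨w, ?_, ?_⟩
  · have := left_ne_zero_of_mul hw
    simpa [hP, eval_finsetSum] using this
  · have := right_ne_zero_of_mul hw
    rw [hQ, eval_sub, eval_finsetSum] at this
    convert this using 2
    · split_ifs
      · rw [eval_pow, eval_X, Finset.prod_pow_eq_pow_sum, hnn]
      · simp
    · refine Finset.sum_congr rfl fun i _ => ?_
      rw [eval_mul, eval_C, eval_pow, eval_X, pow_mul]

section pts
variable {F : Type*} [Field F] [Fintype F] [DecidableEq F] {p m q r d : ℕ} [ExpChar F p]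
  {f : F[X]} {p0 : F}

/-- norm -/
def NN (q r : ℕ) (x : F) : F := ∏ i ∈ Finset.range r, x ^ q ^ i

/-- trace -/
def TR (q r : ℕ) (x : F) : F := ∑ i ∈ Finset.range r, x ^ q ^ i

omit [DecidableEq F] [ExpChar F p] in
lemma NN_pow (hF : Fintype.card F = q ^ r) (x : F) : (NN q r x) ^ q = NN q r x := by
  rw [NN, ← Finset.prod_pow]
  have := prod_shift (fun i => x ^ q ^ i) r (by rw [← hF, FiniteField.pow_card]; simp)
  refine Eq.trans (Finset.prod_congr rfl fun i _ => ?_) this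
  rw [← pow_mul, ← pow_succ]

omit [DecidableEq F] in
lemma TR_pow (hq : q = p ^ m) (hF : Fintype.card F = q ^ r) (x : F) : (TR q r x) ^ q = TR q r x := by
  have h1 : (TR q r x) ^ q = ∑ i ∈ Finset.range r, (x ^ q ^ i) ^ q := by
    have : ∀ y : F, y ^ q = iterateFrobenius F p m y := fun y => by rw [iterateFrobenius_def, hq]
    rw [TR]
    rw [this, map_sum]
    simp only [← this]
  rw [h1, TR]
  have := sum_shift (fun i => x ^ q ^ i) r (by rw [← hF, FiniteField.pow_card]; simp)
  refine Eq.trans (Finset.sum_congr rfl fun i _ => ?_) this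
  rw [← pow_mul, ← pow_succ]

omit [Fintype F] [DecidableEq F] in
lemma erase_eq (hp0 : p0 ≠ 0) {i : ℕ} (hi : i ∈ Finset.range r) :
    ∏ l ∈ (Finset.range r).erase i, p0 ^ q ^ l = NN q r p0 / p0 ^ q ^ i := by
  rw [NN, ← Finset.mul_prod_erase _ _ hi]
  field_simp

/-- affine chart (case iii) -/
lemma bound_affine (hq : q = p ^ m) (hp : p.Prime) (hm : 0 < m)
    (hF : Fintype.card F = q ^ r) (hr : 2 ≤ r) (hrq : r + 1 < q) (hf : f.natDegree ≤ r)
    (hp0 : p0 ≠ 0) (h0 : NN q r p0 = TR q r (f.eval p0))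
    (h1 : NN q r p0 ≠ p0 * (derivative f).eval p0) :
    (q : ℝ) ^ r * ((q : ℝ) - ((r : ℝ) - 1) * (r - 2) * Real.sqrt q - (r : ℝ) ^ 4 - 2 * r) ≤
      q * (q - 1) * (SS q r f).card := by
  set β := NN q r p0 / p0 - (derivative f).eval p0 with hβ
  have hβ0 : β ≠ 0 := by
    intro h
    apply h1
    rw [hβ, sub_eq_zero] at h
    rw [← h]; field_simp
  obtain ⟨w, hw1, hw2⟩ := exists_w (a := f.coeff r) hF hr le_rfl hrq hβ0 (Or.inr rfl)
  refine plane_bound (z := 1) (p0 := p0) hq hp hm hF le_rfl hf (Or.inl rfl) ?_ ?_ hw2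
  · simp only [eval_one, one_pow, one_mul, mul_one]
    rw [sub_eq_zero]
    refine h0.trans ?_
    rw [TR]
    refine Finset.sum_congr rfl fun i _ => ?_
    rw [← psi_apply hq, eval_eq_sum_range' (Nat.lt_succ_of_le hf), map_sum]
    refine Finset.sum_congr rfl fun j _ => ?_
    rw [map_mul, map_pow, psi_apply hq, psi_apply hq]
  · convert hw1 using 1
    refine Finset.sum_congr rfl fun i hi => ?_
    congr 1
    rw [eval_one, one_pow, one_mul, erase_eq hp0 hi, hβ, ← psi_apply hq i (_ - _), map_sub,
      psi_apply hq i (_ / _), div_pow, pow_pow_AF (NN_pow hF p0)]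
    congr 1
    rw [derivative_eval, sum_over_range' f _ (r + 1) (by omega), map_sum]
    · refine Finset.sum_congr rfl fun j _ => ?_
      rw [one_pow, mul_one, map_mul, map_mul, map_natCast, map_pow, psi_apply hq, psi_apply hq]
      ring
    · simp

/-- chart at infinity (cases i and ii) -/
lemma bound_inf (hq : q = p ^ m) (hp : p.Prime) (hm : 0 < m)
    (hF : Fintype.card F = q ^ r) (hr : 2 ≤ r) (hrd : r ≤ d) (hdq : d + 1 < q) (hf : f.natDegree ≤ d)
    (hp0 : p0 ≠ 0) (ha : f.coeff d ≠ 0)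
    (h0 : (if d = r then NN q r p0 else 0) = TR q r (f.coeff d * p0 ^ d))
    (h1 : (if d = r then NN q r p0 else 0) ≠ d * f.coeff d * p0 ^ d) :
    (q : ℝ) ^ r * ((q : ℝ) - ((d : ℝ) - 1) * (d - 2) * Real.sqrt q - (d : ℝ) ^ 4 - 2 * d) ≤
      q * (q - 1) * (SS q r f).card := by
  set β := (if d = r then NN q r p0 else 0) / p0 - d * f.coeff d * p0 ^ (d - 1) with hβ
  have hd1 : p0 ^ d = p0 ^ (d - 1) * p0 := by rw [← pow_succ]; congr 1; omega
  have hβ0 : β ≠ 0 := by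
    intro h
    apply h1
    rw [hβ, sub_eq_zero, div_eq_iff hp0] at h
    rw [h, hd1]; ring
  have hpow0 : (0 : F) ^ (d - r) = if d = r then 1 else 0 := by
    split_ifs with h
    · rw [h]; simp
    · rw [zero_pow (by omega)]
  obtain ⟨w, hw1, hw2⟩ := exists_w (a := f.coeff d) hF hr hrd hdq hβ0 (Or.inl ha)
  refine plane_bound (z := X) (p0 := p0) hq hp hm hF hrd hf (Or.inr rfl) ?_ ?_ hw2
  · rw [eval_X, hpow0, sub_eq_zero, ite_mul, one_mul, zero_mul]
    refine h0.trans ?_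
    rw [TR]
    refine Finset.sum_congr rfl fun i _ => ?_
    rw [Finset.sum_eq_single d]
    · simp only [Nat.sub_self, pow_zero, mul_one, mul_pow]
      rw [← pow_mul, ← pow_mul, mul_comm d]
    · intro j hj hjd
      rw [Finset.mem_range] at hj
      rw [zero_pow (by omega)]; simp
    · intro h; exact (h (Finset.mem_range.2 (by omega))).elim
  · convert hw1 using 1
    refine Finset.sum_congr rfl fun i hi => ?_
    congr 1
    rw [eval_X, hpow0, erase_eq hp0 hi, hβ, ← psi_apply hq i (_ - _), map_sub]
    congr 1
    · rw [psi_apply hq, div_pow]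
      split_ifs
      · rw [pow_pow_AF (NN_pow hF p0), one_mul]
      · rw [zero_pow (pow_ne_zero _ (by omega))]; simp
    · rw [Finset.sum_eq_single d]
      · rw [map_mul, map_mul, map_natCast, map_pow, psi_apply hq, psi_apply hq]
        simp; ring
      · intro j hj hjd
        rw [Finset.mem_range] at hj
        rw [zero_pow (by omega)]; simp
      · intro h; exact (h (Finset.mem_range.2 (by omega))).elim

end pts
end NT
end

section
open Polynomial

namespace NT

section var
variable {F : Type*} [Field F] [Fintype F] [DecidableEq F] {p m q r : ℕ} [ExpChar F p]

omit [DecidableEq F] [Fintype F] in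
lemma TR_add (hq : q = p ^ m) (x y : F) : TR q r (x + y) = TR q r x + TR q r y := by
  simp only [TR, ← psi_apply hq, map_add, Finset.sum_add_distrib]

omit [DecidableEq F] [Fintype F] in
lemma TR_smul {c : F} (hc : c ^ q = c) (x : F) : TR q r (c * x) = c * TR q r x := by
  simp only [TR, mul_pow, pow_pow_AF hc, Finset.mul_sum]

omit [Fintype F] [DecidableEq F] in
lemma NN_mul (x y : F) : NN q r (x * y) = NN q r x * NN q r y := by
  simp only [NN, mul_pow, Finset.prod_mul_distrib]

omit [Fintype F] [DecidableEq F] in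
lemma NN_ne_zero {x : F} (hx : x ≠ 0) : NN q r x ≠ 0 :=
  Finset.prod_ne_zero_iff.2 fun _ _ => pow_ne_zero _ hx

omit [ExpChar F p] in
lemma fiber_le (hq1 : 1 < q) (hr : 1 ≤ r) (c : F) :
    (Finset.univ.filter (fun b : F => TR q r b = c)).card ≤ q ^ (r - 1) := by
  set P : F[X] := ∑ i ∈ Finset.range r, X ^ q ^ i - C c with hP
  have hle : ∀ i ∈ Finset.range r, q ^ i ≤ q ^ (r - 1) := by
    intro i hi
    rw [Finset.mem_range] at hi
    exact Nat.pow_le_pow_right (by omega) (by omega)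
  have hd : P.natDegree ≤ q ^ (r - 1) := by
    refine natDegree_sub_le_of_le (natDegree_sum_le_of_forall_le _ _ fun i hi => ?_) (by simp) |>.trans
      (max_eq_left (Nat.zero_le _)).le
    rw [natDegree_X_pow]; exact hle i hi
  have h0 : P ≠ 0 := by
    intro h
    have h1 : P.coeff 1 = 1 := by
      rw [hP, coeff_sub, finsetSum_coeff, Finset.sum_eq_single 0]
      · simp [coeff_C]
      · intro i _ hi
        rw [coeff_X_pow, if_neg (Nat.one_lt_pow hi hq1).ne]
      · intro h; exact (h (Finset.mem_range.2 (by omega))).elim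
    rw [h, coeff_zero] at h1
    exact zero_ne_one h1
  have hs : Finset.univ.filter (fun b : F => TR q r b = c) ⊆ P.roots.toFinset := by
    intro b hb
    rw [Finset.mem_filter] at hb
    rw [Multiset.mem_toFinset, mem_roots h0, IsRoot.def, hP]
    simp only [eval_sub, eval_finsetSum, eval_pow, eval_X, eval_C]
    exact sub_eq_zero.2 hb.2
  exact (Finset.card_le_card hs).trans ((Multiset.toFinset_card_le _).trans ((card_roots' P).trans hd))

lemma fiber_eq (hq : q = p ^ m) (hq1 : 1 < q) (hr : 1 ≤ r) (hF : Fintype.card F = q ^ r)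
    (hA : (AF F q).card = q) {c : F} (hc : c ^ q = c) :
    (Finset.univ.filter (fun b : F => TR q r b = c)).card = q ^ (r - 1) := by
  refine le_antisymm (fiber_le hq1 hr c) ?_
  have h1 : Fintype.card F = ∑ c ∈ AF F q, (Finset.univ.filter (fun b : F => TR q r b = c)).card := by
    rw [← Finset.card_univ]
    exact Finset.card_eq_sum_card_fiberwise fun b _ => by
      exact_mod_cast mem_AF.2 (TR_pow hq hF b)
  by_contra h
  push Not at h
  have h2 : ∑ c ∈ AF F q, (Finset.univ.filter (fun b : F => TR q r b = c)).card < ∑ c ∈ AF F q, q ^ (r - 1) :=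
    Finset.sum_lt_sum (fun c _ => fiber_le hq1 hr c) ⟨c, mem_AF.2 hc, h⟩
  rw [← h1, hF, Finset.sum_const, hA, smul_eq_mul, ← pow_succ', Nat.sub_add_cancel hr] at h2
  exact lt_irrefl _ h2

lemma fiber_eq' (hq : q = p ^ m) (hq1 : 1 < q) (hr : 1 ≤ r) (hF : Fintype.card F = q ^ r)
    (hA : (AF F q).card = q) {c α : F} (hα : α ≠ 0) (hc : c ^ q = c) :
    (Finset.univ.filter (fun b : F => TR q r (b * α) = c)).card = q ^ (r - 1) := by
  rw [← fiber_eq hq hq1 hr hF hA hc]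
  refine Finset.card_bij' (fun b _ => b * α) (fun b _ => b / α) ?_ ?_ ?_ ?_
  · intro b hb; simpa using hb
  · intro b hb
    simp only [Finset.mem_filter, Finset.mem_univ, true_and] at hb ⊢
    rwa [div_mul_cancel₀ _ hα]
  · intro b _; field_simp
  · intro b _; field_simp

lemma fiber2_le (hq : q = p ^ m) (hq1 : 1 < q) (hr : 2 ≤ r) {c1 c2 α : F} (hα : α ^ q ≠ α) :
    (Finset.univ.filter (fun b : F => TR q r (b * α) = c1 ∧ TR q r b = c2)).card ≤ q ^ (r - 2) := by
  set e : F := α ^ q ^ (r - 1)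
  set P : F[X] := ∑ i ∈ Finset.range (r - 1), C (α ^ q ^ i - e) * X ^ q ^ i - C (c1 - e * c2) with hP
  have hle : ∀ i ∈ Finset.range (r - 1), q ^ i ≤ q ^ (r - 2) := by
    intro i hi
    rw [Finset.mem_range] at hi
    exact Nat.pow_le_pow_right (by omega) (by omega)
  have hd : P.natDegree ≤ q ^ (r - 2) := by
    refine natDegree_sub_le_of_le (natDegree_sum_le_of_forall_le _ _ fun i hi => ?_) (natDegree_C _).le |>.trans
      (max_eq_left (Nat.zero_le _)).le
    exact (natDegree_C_mul_X_pow_le _ _).trans (hle i hi)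
  have h0 : P ≠ 0 := by
    intro h
    have h1 : P.coeff (q ^ (r - 2)) = α ^ q ^ (r - 2) - e := by
      rw [hP, coeff_sub, finsetSum_coeff, Finset.sum_eq_single (r - 2)]
      · rw [coeff_C_mul, coeff_X_pow, if_pos rfl, mul_one, coeff_C, if_neg (pow_ne_zero _ (by omega)), sub_zero]
      · intro i _ hi
        rw [coeff_C_mul_X_pow, if_neg]
        intro h
        exact hi (Nat.pow_right_injective hq1 h).symm
      · intro h; exact (h (Finset.mem_range.2 (by omega))).elim
    rw [h, coeff_zero] at h1
    have h2 : e = (α ^ q) ^ q ^ (r - 2) := by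
      rw [← pow_mul, ← pow_succ', show r - 2 + 1 = r - 1 by omega]
    rw [h2, eq_comm, sub_eq_zero, ← psi_apply hq, ← psi_apply hq] at h1
    exact hα ((psi F p m (r - 2)).injective h1).symm
  have hs : Finset.univ.filter (fun b : F => TR q r (b * α) = c1 ∧ TR q r b = c2) ⊆ P.roots.toFinset := by
    intro b hb
    rw [Finset.mem_filter] at hb
    rw [Multiset.mem_toFinset, mem_roots h0, IsRoot.def, hP]
    simp only [eval_sub, eval_finsetSum, eval_pow, eval_X, eval_C, eval_mul]
    rw [← hb.2.1, ← hb.2.2, TR, TR, Finset.mul_sum, ← Finset.sum_sub_distrib]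
    conv_lhs => enter [2]; rw [show r = r - 1 + 1 by omega]
    rw [Finset.sum_range_succ, mul_pow]
    have : b ^ q ^ (r - 1) * α ^ q ^ (r - 1) - e * b ^ q ^ (r - 1) = 0 := by simp only [e]; ring
    rw [this, add_zero, ← Finset.sum_sub_distrib]
    refine Finset.sum_eq_zero fun i _ => ?_
    rw [mul_pow]; ring
  exact (Finset.card_le_card hs).trans ((Multiset.toFinset_card_le _).trans ((card_roots' P).trans hd))

omit [ExpChar F p] in
lemma card_pow_mem (hA : (AF F q).card = q) (hq1 : 1 < q) {k : ℕ} (hk : 0 < k) (γ : F) :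
    (Finset.univ.filter (fun y : F => y ≠ 0 ∧ ∃ c, c ^ q = c ∧ y ^ k = γ * c)).card ≤ k * (q - 1) := by
  have hs : Finset.univ.filter (fun y : F => y ≠ 0 ∧ ∃ c, c ^ q = c ∧ y ^ k = γ * c) ⊆
      ((AF F q).erase 0).biUnion (fun c => (nthRoots k (γ * c)).toFinset) := by
    intro y hy
    rw [Finset.mem_filter] at hy
    obtain ⟨-, hy0, c, hc, h⟩ := hy
    rw [Finset.mem_biUnion]
    refine ⟨c, Finset.mem_erase.2 ⟨?_, mem_AF.2 hc⟩, ?_⟩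
    · rintro rfl
      rw [mul_zero] at h
      exact pow_ne_zero _ hy0 h
    · rw [Multiset.mem_toFinset, mem_nthRoots hk, h]
  refine (Finset.card_le_card hs).trans ((Finset.card_biUnion_le_card_mul _ _ k fun c _ => 
    (Multiset.toFinset_card_le _).trans (card_nthRoots _ _)).trans ?_)
  rw [Finset.card_erase_of_mem (by rw [mem_AF, zero_pow (by omega)]), hA, mul_comm]

/-- number of nonzero x with TR (b x^k) = c x -/
def nb (q r k : ℕ) (c : F → F) (b : F) : ℕ :=
  (Finset.univ.filter (fun x : F => x ≠ 0 ∧ TR q r (b * x ^ k) = c x)).card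

lemma variance (hq : q = p ^ m) (hq1 : 1 < q) (hr : 2 ≤ r) (hF : Fintype.card F = q ^ r)
    (hA : (AF F q).card = q) {k : ℕ} (hk : 0 < k) {c : F → F} (hc : ∀ x, c x ^ q = c x)
    (O : Finset F) (n : ℕ) (hO : ∀ b ∈ O, nb q r k c b = n) :
    (O.card : ℝ) * ((n : ℝ) - ((q : ℝ) ^ r - 1) / q) ^ 2 ≤
      ((q : ℝ) ^ r - 1) * (k * (q - 1)) * q ^ (r - 1) := by
  set U : Finset F := Finset.univ.erase 0 with hU
  have hUc : U.card = q ^ r - 1 := by rw [hU, Finset.card_erase_of_mem (Finset.mem_univ _), Finset.card_univ, hF]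
  have hnb : ∀ b, nb q r k c b = ∑ x ∈ U, if TR q r (b * x ^ k) = c x then 1 else 0 := by
    intro b
    rw [nb, ← Finset.card_filter]
    congr 1
    ext x; simp [hU]
  have hUne : ∀ x ∈ U, x ≠ 0 := fun x hx => (Finset.mem_erase.1 hx).1
  have s1 : ∑ b : F, nb q r k c b = (q ^ r - 1) * q ^ (r - 1) := by
    simp only [hnb]
    rw [Finset.sum_comm, ← hUc, ← smul_eq_mul, ← Finset.sum_const]
    refine Finset.sum_congr rfl fun x hx => ?_
    rw [← Finset.card_filter]
    exact fiber_eq' hq hq1 (by omega) hF hA (pow_ne_zero _ (hUne x hx)) (hc x)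
  have s2 : ∑ b : F, (nb q r k c b) ^ 2 ≤
      (q ^ r - 1) * ((q ^ r - 1) * q ^ (r - 2) + k * (q - 1) * q ^ (r - 1)) := by
    have e1 : ∀ b, (nb q r k c b) ^ 2 = ∑ x ∈ U, ∑ y ∈ U,
        if TR q r (b * x ^ k) = c x ∧ TR q r (b * y ^ k) = c y then 1 else 0 := by
      intro b
      rw [hnb, sq, Finset.sum_mul_sum]
      refine Finset.sum_congr rfl fun x _ => Finset.sum_congr rfl fun y _ => ?_
      by_cases h1 : TR q r (b * x ^ k) = c x <;> by_cases h2 : TR q r (b * y ^ k) = c y <;> simp [h1, h2]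
    simp only [e1]
    rw [Finset.sum_comm]
    rw [Finset.sum_congr rfl fun x _ => Finset.sum_comm]
    rw [← hUc, ← smul_eq_mul U.card, ← Finset.sum_const]
    refine Finset.sum_le_sum fun x hx => ?_
    have hx0 := pow_ne_zero k (hUne x hx)
    have e2 : ∀ y ∈ U, (∑ b : F, if TR q r (b * x ^ k) = c x ∧ TR q r (b * y ^ k) = c y then 1 else 0) ≤
        q ^ (r - 2) + if (y ≠ 0 ∧ ∃ c, c ^ q = c ∧ y ^ k = x ^ k * c) then q ^ (r - 1) else 0 := by
      intro y hy
      rw [← Finset.card_filter]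
      split_ifs with h
      · refine le_trans (Finset.card_le_card ?_) ((fiber_eq' hq hq1 (by omega : 1 ≤ r) hF hA hx0 (hc x)).le.trans
          (Nat.le_add_left _ _))
        intro b hb
        simp only [Finset.mem_filter, Finset.mem_univ, true_and] at hb ⊢
        exact hb.1
      · rw [add_zero]
        have hα : (y ^ k / x ^ k) ^ q ≠ y ^ k / x ^ k := by
          intro h2
          exact h ⟨hUne y hy, _, h2, by field_simp⟩
        refine le_trans (Finset.card_le_card_of_injOn (fun b => b * x ^ k) ?_ ?_) (fiber2_le (c1 := c y) (c2 := c x) hq hq1 hr hα)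
        · intro b hb
          simp only [Finset.coe_filter, Finset.mem_univ, true_and, Set.mem_setOf_eq] at hb ⊢
          refine ⟨?_, hb.1⟩
          rw [← hb.2]; congr 1; field_simp
        · intro b _ b' _ h
          exact mul_right_cancel₀ hx0 h
    refine (Finset.sum_le_sum e2).trans ?_
    rw [Finset.sum_add_distrib, Finset.sum_const, smul_eq_mul, ← Finset.sum_filter, Finset.sum_const, smul_eq_mul]
    refine Nat.add_le_add_left (Nat.mul_le_mul_right _ ?_) _
    exact (Finset.card_le_card (Finset.filter_subset_filter _ (Finset.subset_univ _))).trans (card_pow_mem hA hq1 hk _)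
  have hqr : 1 ≤ q ^ r := Nat.one_le_pow _ _ (by omega)
  have s1' : ∑ b : F, (nb q r k c b : ℝ) = ((q : ℝ) ^ r - 1) * q ^ (r - 1) := by
    rw [← Nat.cast_sum, s1]; push_cast [Nat.cast_sub hqr]; ring
  have s2' : ∑ b : F, (nb q r k c b : ℝ) ^ 2 ≤
      ((q : ℝ) ^ r - 1) * (((q : ℝ) ^ r - 1) * q ^ (r - 2) + k * (q - 1) * q ^ (r - 1)) := by
    have := (Nat.cast_le (α := ℝ)).2 s2
    push_cast [Nat.cast_sub hqr, Nat.cast_sub hq1.le] at this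
    exact this
  set Q : ℝ := (q : ℝ) ^ r - 1 with hQ
  have hq0 : (q : ℝ) ≠ 0 := by positivity
  have s3 : ∑ b : F, ((nb q r k c b : ℝ) - Q / q) ^ 2 ≤ Q * (k * (q - 1)) * q ^ (r - 1) := by
    have : ∑ b : F, ((nb q r k c b : ℝ) - Q / q) ^ 2 = ∑ b : F, (nb q r k c b : ℝ) ^ 2 -
        2 * (Q / q) * ∑ b : F, (nb q r k c b : ℝ) + q ^ r * (Q / q) ^ 2 := by
      have : ∀ b : F, ((nb q r k c b : ℝ) - Q / q) ^ 2 = (nb q r k c b : ℝ) ^ 2 -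
        2 * (Q / q) * (nb q r k c b : ℝ) + (Q / q) ^ 2 := fun b => by ring
      simp only [this, Finset.sum_add_distrib, Finset.sum_sub_distrib, ← Finset.mul_sum]
      rw [Finset.sum_const, Finset.card_univ, hF]
      simp
    rw [this, s1']
    have e1 : (q : ℝ) ^ (r - 1) = q ^ (r - 2) * q := by rw [← pow_succ]; congr 1; omega
    have e2 : (q : ℝ) ^ r = q ^ (r - 2) * q ^ 2 := by rw [← pow_add]; congr 1; omega
    have e3 : 2 * (Q / q) * (Q * q ^ (r - 1)) = 2 * Q ^ 2 * q ^ (r - 2) := by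
      rw [e1]; field_simp
    have e4 : (q : ℝ) ^ r * (Q / q) ^ 2 = Q ^ 2 * q ^ (r - 2) := by
      rw [e2]; field_simp
    rw [e3, e4]
    linarith
  have s4 : ∑ b ∈ O, ((nb q r k c b : ℝ) - Q / q) ^ 2 ≤ ∑ b : F, ((nb q r k c b : ℝ) - Q / q) ^ 2 :=
    Finset.sum_le_sum_of_subset_of_nonneg (Finset.subset_univ _) fun _ _ _ => sq_nonneg _
  rw [Finset.sum_congr rfl (fun b hb => by rw [hO b hb] : ∀ b ∈ O, ((nb q r k c b : ℝ) - Q / q) ^ 2 = ((n : ℝ) - Q / q) ^ 2),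
    Finset.sum_const, nsmul_eq_mul] at s4
  exact s4.trans s3

end var
end NT
end

section
open Polynomial

namespace NT

section cases12
variable {F : Type*} [Field F] [Fintype F] [DecidableEq F] {p m q r : ℕ} [ExpChar F p]

lemma case_i (hq : q = p ^ m) (hq1 : 1 < q) (hr : 3 ≤ r) (hF : Fintype.card F = q ^ r)
    (hA : (AF F q).card = q) {k : ℕ} (hk : 0 < k) (hqk : 2 * r * k ^ 2 < q) {a : F} (ha : a ≠ 0) :
    ∃ x : F, x ≠ 0 ∧ TR q r (a * x ^ k) = 0 := by
  by_contra hcon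
  push Not at hcon
  have hn0 : nb q r k (fun _ => (0 : F)) a = 0 := by
    rw [nb, Finset.card_eq_zero, Finset.filter_eq_empty_iff]
    rintro x - ⟨h1, h2⟩
    exact hcon x h1 h2
  set U : Finset F := Finset.univ.erase 0 with hU
  have hUc : U.card = q ^ r - 1 := by rw [hU, Finset.card_erase_of_mem (Finset.mem_univ _), Finset.card_univ, hF]
  set O : Finset F := U.image (fun g => a * g ^ k) with hOdef
  have hO : ∀ b ∈ O, nb q r k (fun _ => (0 : F)) b = 0 := by
    intro b hb
    rw [hOdef, Finset.mem_image] at hb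
    obtain ⟨g, hg, rfl⟩ := hb
    have hg0 : g ≠ 0 := (Finset.mem_erase.1 hg).1
    rw [nb, Finset.card_eq_zero, Finset.filter_eq_empty_iff]
    rintro x - ⟨h1, h2⟩
    refine hcon (g * x) (mul_ne_zero hg0 h1) ?_
    rw [← h2, mul_pow, mul_assoc]
  have hOc : U.card ≤ k * O.card := by
    refine Finset.card_le_mul_card_image U k fun b _ => ?_
    have hs : U.filter (fun g => a * g ^ k = b) ⊆ (nthRoots k (b / a)).toFinset := by
      intro g hg
      rw [Finset.mem_filter] at hg
      rw [Multiset.mem_toFinset, mem_nthRoots hk, ← hg.2]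
      field_simp
    exact (Finset.card_le_card hs).trans ((Multiset.toFinset_card_le _).trans (card_nthRoots _ _))
  have hv := variance hq hq1 (by omega) hF hA hk (c := fun _ => (0 : F)) (fun x => by simp [zero_pow (show q ≠ 0 by omega)]) O 0 hO
  have hqr : 1 ≤ q ^ r := Nat.one_le_pow _ _ (by omega)
  have hOr : ((q : ℝ) ^ r - 1) ≤ k * O.card := by
    have := (Nat.cast_le (α := ℝ)).2 hOc
    rw [hUc] at this
    push_cast [Nat.cast_sub hqr] at this
    exact this
  have hqR : (1 : ℝ) < q := by exact_mod_cast hq1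
  have hkR : (0 : ℝ) < k := by exact_mod_cast hk
  have h6 : 6 * (k : ℝ) ^ 2 < q := by
    have h1 : (2 * r * k ^ 2 : ℝ) < q := by exact_mod_cast hqk
    have h2 : (3 : ℝ) ≤ r := by exact_mod_cast hr
    nlinarith [sq_nonneg (k : ℝ)]
  have hk1 : (1 : ℝ) ≤ k := by exact_mod_cast hk
  have hq6 : (6 : ℝ) < q := by nlinarith
  obtain ⟨s, rfl⟩ : ∃ s, r = s + 3 := ⟨r - 3, by omega⟩
  set B : ℝ := (q : ℝ) ^ (s + 3) with hB
  have hBs : B = q ^ s * q ^ 3 := by rw [hB, pow_add]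
  have hqs : (1 : ℝ) ≤ (q : ℝ) ^ s := one_le_pow₀ hqR.le
  have hB4 : 6 ≤ B := by rw [hBs]; nlinarith [pow_le_pow_left₀ (by norm_num) hq6.le 3]
  have e1 : (q : ℝ) ^ (s + 3 - 1) = q ^ s * q ^ 2 := by rw [← pow_add]; congr 1
  rw [e1] at hv
  set W : ℝ := (q : ℝ) ^ s with hW
  have hv2 : (B - 1) * ((B - 1) ^ 2) ≤ (B - 1) * (k ^ 2 * (q - 1) * (W * q ^ 4)) := by
    have h1 : (k * O.card : ℝ) * ((B - 1) ^ 2) ≤ (B - 1) * (k ^ 2 * (q - 1) * (W * q ^ 4)) := by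
      have h2 := mul_le_mul_of_nonneg_left hv (show (0 : ℝ) ≤ k * q ^ 2 by positivity)
      have h3 : (k : ℝ) * q ^ 2 * (O.card * (((0 : ℕ) : ℝ) - (B - 1) / q) ^ 2) = (k * O.card : ℝ) * ((B - 1) ^ 2) := by
        push_cast; field_simp; ring
      rw [h3] at h2
      refine h2.trans (le_of_eq ?_)
      ring
    exact (mul_le_mul_of_nonneg_right hOr (sq_nonneg _)).trans h1
  have hv3 : (B - 1) ^ 2 ≤ k ^ 2 * (q - 1) * (W * q ^ 4) := le_of_mul_le_mul_left hv2 (by linarith)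
  have hv4 : k ^ 2 * (q - 1) * (W * q ^ 4) ≤ W * q ^ 6 / 6 := by
    have h1 : (k : ℝ) ^ 2 * (q - 1) ≤ q / 6 * q := by
      apply mul_le_mul <;> nlinarith
    calc k ^ 2 * (q - 1) * (W * q ^ 4) ≤ q / 6 * q * (W * q ^ 4) :=
          mul_le_mul_of_nonneg_right h1 (by positivity)
      _ = W * q ^ 6 / 6 := by ring
  have hv5 : W * q ^ 6 ≤ B ^ 2 := by
    rw [hBs]
    have : (W * q ^ 3) ^ 2 = W * (W * q ^ 6) := by ring
    rw [this]
    exact le_mul_of_one_le_left (by positivity) hqs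
  nlinarith

set_option maxHeartbeats 2000000 in
lemma case_ii (hq : q = p ^ m) (hq1 : 1 < q) (hr : 4 ≤ r) (hF : Fintype.card F = q ^ r)
    (hA : (AF F q).card = q) (hqk : 2 * r * r ^ 2 < q) {a : F} (ha : a ≠ 0) :
    ∃ x : F, x ≠ 0 ∧ NN q r x = TR q r (a * x ^ r) ∧ NN q r x ≠ r * a * x ^ r := by
  by_contra hcon
  push Not at hcon
  have hr0 : 0 < r := by omega
  set U : Finset F := Finset.univ.erase 0 with hU
  have hUc : U.card = q ^ r - 1 := by rw [hU, Finset.card_erase_of_mem (Finset.mem_univ _), Finset.card_univ, hF]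
  have hn0 : nb q r r (NN q r) a ≤ r * (q - 1) := by
    by_cases hrF : (r : F) = 0
    · have : nb q r r (NN q r) a = 0 := by
        rw [nb, Finset.card_eq_zero, Finset.filter_eq_empty_iff]
        rintro x - ⟨h1, h2⟩
        have := hcon x h1 h2.symm
        rw [hrF, zero_mul, zero_mul] at this
        exact NN_ne_zero h1 this
      omega
    · refine le_trans (Finset.card_le_card ?_) (card_pow_mem hA hq1 hr0 (r * a)⁻¹)
      intro x hx
      simp only [Finset.mem_filter, Finset.mem_univ, true_and] at hx ⊢
      refine ⟨hx.1, NN q r x, NN_pow hF x, ?_⟩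
      rw [hcon x hx.1 hx.2.symm]
      field_simp
  set O : Finset F := U.image (fun g => a * g ^ r / NN q r g) with hOdef
  have hO : ∀ b ∈ O, nb q r r (NN q r) b = nb q r r (NN q r) a := by
    intro b hb
    rw [hOdef, Finset.mem_image] at hb
    obtain ⟨g, hg, rfl⟩ := hb
    have hg0 : g ≠ 0 := (Finset.mem_erase.1 hg).1
    have hN0 : NN q r g ≠ 0 := NN_ne_zero hg0
    have hkey : ∀ x, TR q r (a * g ^ r / NN q r g * x ^ r) = NN q r x ↔
        TR q r (a * (g * x) ^ r) = NN q r (g * x) := by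
      intro x
      have : a * (g * x) ^ r = NN q r g * (a * g ^ r / NN q r g * x ^ r) := by
        rw [mul_pow]; field_simp
      rw [this, TR_smul (NN_pow hF g), NN_mul, mul_right_inj' hN0]
    refine Finset.card_bij' (fun x _ => g * x) (fun x _ => x / g) ?_ ?_ ?_ ?_
    · intro x hx
      simp only [Finset.mem_filter, Finset.mem_univ, true_and] at hx ⊢
      exact ⟨mul_ne_zero hg0 hx.1, (hkey x).1 hx.2⟩
    · intro x hx
      simp only [Finset.mem_filter, Finset.mem_univ, true_and] at hx ⊢
      refine ⟨div_ne_zero hx.1 hg0, (hkey _).2 ?_⟩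
      rw [mul_div_cancel₀ _ hg0]; exact hx.2
    · intro x _; field_simp
    · intro x _; field_simp
  have hOc : U.card ≤ (r * (q - 1)) * O.card := by
    refine Finset.card_le_mul_card_image U _ fun b _ => ?_
    refine le_trans (Finset.card_le_card ?_) (card_pow_mem hA hq1 hr0 (b / a))
    intro g hg
    rw [Finset.mem_filter] at hg
    have hg0 : g ≠ 0 := (Finset.mem_erase.1 hg.1).1
    have hN0 : NN q r g ≠ 0 := NN_ne_zero hg0
    simp only [Finset.mem_filter, Finset.mem_univ, true_and]
    refine ⟨hg0, NN q r g, NN_pow hF g, ?_⟩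
    rw [← hg.2]
    field_simp
  have hv := variance hq hq1 (by omega) hF hA hr0 (NN_pow hF) O _ hO
  set n := nb q r r (NN q r) a with hn
  have hqr : 1 ≤ q ^ r := Nat.one_le_pow _ _ (by omega)
  have hOr : ((q : ℝ) ^ r - 1) ≤ r * (q - 1) * O.card := by
    have := (Nat.cast_le (α := ℝ)).2 hOc
    rw [hUc] at this
    push_cast [Nat.cast_sub hqr, Nat.cast_sub hq1.le] at this
    exact this
  have hnr : (n : ℝ) ≤ r * (q - 1) := by
    have := (Nat.cast_le (α := ℝ)).2 hn0
    push_cast [Nat.cast_sub hq1.le] at this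
    exact this
  have hqR : (1 : ℝ) < q := by exact_mod_cast hq1
  have hrR : (4 : ℝ) ≤ r := by exact_mod_cast hr
  have h8 : 8 * (r : ℝ) ^ 2 < q := by
    have h1 : (2 * r * r ^ 2 : ℝ) < q := by exact_mod_cast hqk
    nlinarith [sq_nonneg (r : ℝ)]
  obtain ⟨s, hs⟩ : ∃ s, r = s + 4 := ⟨r - 4, by omega⟩
  set R : ℝ := (r : ℝ) with hR
  have e1 : (q : ℝ) ^ (r - 1) = q ^ s * q ^ 3 := by rw [← pow_add]; congr 1; omega
  have e2 : (q : ℝ) ^ r = q ^ s * q ^ 4 := by rw [← pow_add]; congr 1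
  rw [e2] at hOr
  rw [e2, e1] at hv
  have hqs : (1 : ℝ) ≤ (q : ℝ) ^ s := one_le_pow₀ hqR.le
  set W : ℝ := (q : ℝ) ^ s with hW
  set T : ℝ := W * q ^ 4 - 1 with hT
  have hq128 : (128 : ℝ) < q := by nlinarith
  have hq3 : (128 : ℝ) ≤ q ^ 3 := by nlinarith [pow_le_pow_left₀ (by norm_num) hq128.le 3]
  have hTpos : 0 < T := by rw [hT]; nlinarith [pow_le_pow_left₀ (by norm_num) hq128.le 4]
  -- T * (n - T/q)^2 ≤ T * (R^2 (q-1)^2 W q^3)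
  have hv2 : T * ((n : ℝ) - T / q) ^ 2 ≤ T * (R ^ 2 * (q - 1) ^ 2 * (W * q ^ 3)) := by
    refine (mul_le_mul_of_nonneg_right hOr (sq_nonneg _)).trans ?_
    have h2 := mul_le_mul_of_nonneg_left hv (show (0 : ℝ) ≤ R * (q - 1) by nlinarith)
    calc _ = R * (q - 1) * (↑O.card * ((n : ℝ) - T / q) ^ 2) := by ring
      _ ≤ _ := h2
      _ = _ := by ring
  have hv3 := le_of_mul_le_mul_left hv2 hTpos
  have hTq : T / q = W * q ^ 3 - 1 / q := by rw [hT]; field_simp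
  have hq1' : 1 / (q : ℝ) ≤ 1 := by rw [div_le_one (by linarith)]; linarith
  have hRq : R * q ≤ W * q ^ 3 / 2 - 1 := by
    have h1 : R * q ≤ q ^ 2 / 8 := by nlinarith
    have h2 : (q : ℝ) ^ 3 ≤ W * q ^ 3 := le_mul_of_one_le_left (by positivity) hqs
    nlinarith
  have h5 : W * q ^ 3 / 2 ≤ T / q - n := by
    rw [hTq]; nlinarith
  have h6 : (W * q ^ 3 / 2) ^ 2 ≤ R ^ 2 * (q - 1) ^ 2 * (W * q ^ 3) := by
    refine le_trans ?_ hv3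
    have : ((n : ℝ) - T / q) ^ 2 = (T / q - n) ^ 2 := by ring
    rw [this]
    exact pow_le_pow_left₀ (by positivity) h5 2
  have h7 : R ^ 2 * (q - 1) ^ 2 * (W * q ^ 3) < q ^ 3 / 8 * (W * q ^ 3) := by
    apply mul_lt_mul_of_pos_right _ (by positivity)
    have h1 : ((q : ℝ) - 1) ^ 2 ≤ q ^ 2 := by nlinarith
    calc R ^ 2 * (q - 1) ^ 2 ≤ R ^ 2 * q ^ 2 := mul_le_mul_of_nonneg_left h1 (sq_nonneg _)
      _ < q / 8 * q ^ 2 := mul_lt_mul_of_pos_right (by linarith) (by positivity)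
      _ = _ := by ring
  have h8 : (W * q ^ 3 / 2) ^ 2 = W * q ^ 3 / 4 * (W * q ^ 3) := by ring
  rw [h8] at h6
  have h9 := lt_of_mul_lt_mul_right (h6.trans_lt h7) (by positivity)
  nlinarith [le_mul_of_one_le_left (show (0 : ℝ) ≤ (q : ℝ) ^ 3 by positivity) hqs]

end cases12
end NT
end

section
namespace NT

lemma digit {q r : ℕ} (hq : 2 ≤ q) (hr : 1 ≤ r) (e : ℕ → ℕ) (he : ∀ i, e (i + r) = e i)
    (hpos : 0 < ∑ l ∈ Finset.range r, e l * q ^ l)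
    (hdvd : (q ^ r - 1) ∣ ∑ l ∈ Finset.range r, e l * q ^ l)
    (hlt : ∑ l ∈ Finset.range r, e l < (r + 1) * (q - 1)) : ∀ i < r, e i = q - 1 := by
  set S : ℕ → ℕ := fun i => ∑ l ∈ Finset.range r, e (i + l) * q ^ l with hS
  have hqr : q ≤ q ^ r := Nat.le_self_pow (by omega) q
  have hrec : ∀ i, q * S (i + 1) = S i + (q ^ r - 1) * e i := by
    intro i
    have h1 := Finset.sum_range_succ (fun l => e (i + l) * q ^ l) r
    have h2 := Finset.sum_range_succ' (fun l => e (i + l) * q ^ l) r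
    rw [h1, he] at h2
    have h3 : q * S (i + 1) = ∑ l ∈ Finset.range r, e (i + (l + 1)) * q ^ (l + 1) := by
      rw [hS, Finset.mul_sum]
      refine Finset.sum_congr rfl fun l _ => ?_
      rw [show i + 1 + l = i + (l + 1) by ring]; ring
    rw [h3]
    simp only [add_zero, pow_zero, mul_one] at h2
    obtain ⟨c, hc⟩ : ∃ c, q ^ r = c + 1 := ⟨q ^ r - 1, by omega⟩
    rw [hc] at h2 ⊢
    simp only [Nat.add_sub_cancel]
    have : S i = ∑ l ∈ Finset.range r, e (i + l) * q ^ l := rfl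
    rw [this]
    nlinarith
  have hcop : Nat.Coprime (q ^ r - 1) q := by
    have h1 : Nat.Coprime (q ^ r - 1) (q ^ r) := by
      have := Nat.coprime_self_add_right (m := q ^ r - 1) (n := 1)
      rw [Nat.sub_add_cancel (by omega)] at this
      exact this.2 (Nat.coprime_one_right _)
    exact Nat.Coprime.coprime_dvd_right (dvd_pow_self q (by omega)) h1
  have hall : ∀ i, 0 < S i ∧ (q ^ r - 1) ∣ S i := by
    intro i
    induction i with
    | zero => simpa [hS] using And.intro hpos hdvd
    | succ n ih =>
      have h := hrec n
      constructor
      · by_contra h0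
        have h0 : S (n + 1) = 0 := by omega
        rw [h0] at h
        have := ih.1
        omega
      · apply hcop.dvd_of_dvd_mul_left
        rw [h]
        exact dvd_add ih.2 (dvd_mul_right _ _)
  choose hSpos c hc using hall
  have hc1 : ∀ i, 1 ≤ c i := by
    intro i
    rcases Nat.eq_zero_or_pos (c i) with h | h
    · have := hSpos i; rw [hc, h] at this; omega
    · exact h
  have hcrec : ∀ i, q * c (i + 1) = c i + e i := by
    intro i
    have h := hrec i
    rw [hc, hc i, ← mul_add, mul_left_comm] at h
    exact Nat.eq_of_mul_eq_mul_left (by omega) h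
  have hcr : c r = c 0 := by
    have : S r = S 0 := by
      simp only [hS]
      refine Finset.sum_congr rfl fun l _ => ?_
      rw [show r + l = 0 + l + r by ring, he]
    rw [hc, hc 0] at this
    exact Nat.eq_of_mul_eq_mul_left (by omega) this
  have hsum : q * ∑ i ∈ Finset.range r, c i = ∑ i ∈ Finset.range r, c i + ∑ i ∈ Finset.range r, e i := by
    rw [← Finset.sum_add_distrib, ← Finset.sum_congr rfl fun i _ => hcrec i, ← Finset.mul_sum,
      sum_shift c r hcr]
  obtain ⟨q', rfl⟩ : ∃ q', q = q' + 1 := ⟨q - 1, by omega⟩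
  simp only [Nat.add_sub_cancel] at hlt ⊢
  have h2 : ∑ i ∈ Finset.range r, c i < r + 1 := by
    have : q' * ∑ i ∈ Finset.range r, c i < q' * (r + 1) := by nlinarith
    exact Nat.lt_of_mul_lt_mul_left this
  have h3 : ∀ i < r, c i = 1 := by
    intro i hi
    by_contra hne
    have hgt : 1 < c i := lt_of_le_of_ne (hc1 i) (Ne.symm hne)
    have : ∑ i ∈ Finset.range r, 1 < ∑ i ∈ Finset.range r, c i :=
      Finset.sum_lt_sum (fun i _ => hc1 i) ⟨i, Finset.mem_range.2 hi, hgt⟩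
    simp at this; omega
  intro i hi
  have h4 := hcrec i
  have h5 : c (i + 1) = 1 := by
    rcases Nat.lt_or_ge (i + 1) r with h | h
    · exact h3 _ h
    · rw [show i + 1 = r by omega, hcr, h3 0 (by omega)]
  rw [h5, h3 i hi] at h4
  omega

section euler
open MvPolynomial
variable {F : Type*} [Field F] {σ : Type*}

noncomputable def Eu (i : σ) (P : MvPolynomial σ F) : MvPolynomial σ F := X i * pderiv i P

lemma coeff_Eu (i : σ) (P : MvPolynomial σ F) (n : σ →₀ ℕ) :
    coeff n (Eu i P) = n i * coeff n P := by
  classical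
  induction P using MvPolynomial.induction_on' with
  | monomial u a =>
    rw [Eu, X_mul_pderiv_monomial, coeff_smul, coeff_monomial]
    split_ifs with h
    · subst h; simp
    · simp
  | add p q hp hq =>
    have : Eu i (p + q) = Eu i p + Eu i q := by simp only [Eu, map_add, mul_add]
    rw [this, coeff_add, hp, hq, coeff_add, mul_add]

lemma Eu_mul (i : σ) (P Q : MvPolynomial σ F) : Eu i (P * Q) = Eu i P * Q + P * Eu i Q := by
  simp only [Eu, Derivation.leibniz, smul_eq_mul]; ring

lemma Eu_pow (i : σ) (P : MvPolynomial σ F) (n : ℕ) : Eu i (P ^ (n + 1)) = C ((n + 1 : ℕ) : F) * (Eu i P * P ^ n) := by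
  simp only [Eu, Derivation.leibniz_pow, nsmul_eq_mul, smul_eq_mul, map_natCast, Nat.add_sub_cancel]; ring

lemma Eu_comm (i j : σ) (P : MvPolynomial σ F) : Eu i (Eu j P) = Eu j (Eu i P) := by
  ext n
  simp only [coeff_Eu]; ring

lemma totalDegree_Eu (i : σ) (P : MvPolynomial σ F) : (Eu i P).totalDegree ≤ P.totalDegree := by
  apply Finset.sup_mono
  intro n hn
  rw [mem_support_iff, coeff_Eu] at hn
  rw [mem_support_iff]
  exact right_ne_zero_of_mul hn

/-- main cancellation, second part alone -/
lemma coeff_cancel2 {i j : σ} (T : MvPolynomial σ F) (s : ℕ) (n : σ →₀ ℕ) (hs : ((s + 1 : ℕ) : F) = 0)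
    (h0 : n i = s + 1) (h1 : n j = s) : coeff n (Eu i T * T ^ s) = 0 := by
  have key : Eu j (Eu i T * T ^ s) = Eu i (Eu j T * T ^ s) := by
    rw [Eu_mul, Eu_mul, Eu_comm i j]
    congr 1
    cases s with
    | zero => simp [Eu]
    | succ t => rw [Eu_pow, Eu_pow]; ring
  have h := congrArg (coeff n) key
  rw [coeff_Eu, coeff_Eu, h0, h1, hs, zero_mul] at h
  rcases mul_eq_zero.1 h with h | h
  · push_cast at hs
    rw [h, zero_add] at hs
    exact absurd hs one_ne_zero
  · exact h

lemma coeff_cancel {i j : σ} (T : MvPolynomial σ F) (s : ℕ) (n : σ →₀ ℕ)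
    (h0 : n i = s + 1) (h1 : n j = s) : coeff n (T ^ (s + 1) - Eu i T * T ^ s) = 0 := by
  by_cases hs : ((s + 1 : ℕ) : F) = 0
  · rw [coeff_sub, coeff_cancel2 T s n hs h0 h1, sub_zero]
    have h := congrArg (coeff n) (Eu_pow j T s)
    rw [coeff_Eu, hs, C_0, zero_mul, coeff_zero, h1] at h
    rcases mul_eq_zero.1 h with h | h
    · push_cast at hs
      rw [h, zero_add] at hs
      exact absurd hs one_ne_zero
    · exact h
  · have h := congrArg (coeff n) (Eu_pow i T s)
    rw [coeff_Eu, coeff_C_mul, h0] at h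
    rw [coeff_sub, mul_left_cancel₀ hs h, sub_self]

end euler
end NT
end

section
open Polynomial

namespace NT

section mono
variable {F : Type*} [Field F] [Fintype F] [DecidableEq F] {q r : ℕ}

lemma mono_zero (hF : Fintype.card F = q ^ r) (hr : 3 ≤ r) {k s : ℕ} (hk : k < r) (hkq : k < q)
    (hs : 2 ≤ s) (hsq : s ≤ q) (m : ℕ → ℕ) (hm : ∑ l ∈ Finset.range r, m l ≤ k * s)
    (hsm : s < q ∨ 1 ≤ m 0) (hne : ¬ (m 0 = s ∧ m 1 = s - 1)) :
    ∑ x : Fˣ, ((x : F)⁻¹ * (x : F) ^ (q ^ (r - 1) * (q - k)) * (NN q r (x : F)) ^ (q - s) *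
      ∏ l ∈ Finset.range r, ((x : F) ^ q ^ l) ^ m l) = 0 := by
  classical
  set n : ℕ → ℕ := fun l => m l + (q - s) + (if l = r - 1 then q - k else 0) - (if l = 0 then 1 else 0) with hn
  have hn0 : ∀ l ∈ Finset.range r, n l + (if l = 0 then 1 else 0) =
      m l + (q - s) + (if l = r - 1 then q - k else 0) := by
    intro l _
    simp only [hn]
    by_cases h1 : l = 0
    · subst h1
      simp only [if_true, show ¬ (0 = r - 1) by omega, if_false]
      omega
    · simp only [h1, if_false]
      omega
  have hr0 : 0 ∈ Finset.range r := Finset.mem_range.2 (by omega)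
  have hrr : r - 1 ∈ Finset.range r := Finset.mem_range.2 (by omega)
  have hterm : ∀ x : Fˣ, ((x : F)⁻¹ * (x : F) ^ (q ^ (r - 1) * (q - k)) * (NN q r (x : F)) ^ (q - s) *
      ∏ l ∈ Finset.range r, ((x : F) ^ q ^ l) ^ m l) = (x : F) ^ (∑ l ∈ Finset.range r, n l * q ^ l) := by
    intro x
    have hx : (x : F) ≠ 0 := x.ne_zero
    rw [mul_assoc, mul_assoc, inv_mul_eq_iff_eq_mul₀ hx]
    have e1 : (x : F) ^ (q ^ (r - 1) * (q - k)) =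
        ∏ l ∈ Finset.range r, (x : F) ^ ((if l = r - 1 then q - k else 0) * q ^ l) := by
      rw [Finset.prod_eq_single_of_mem _ hrr]
      · simp [mul_comm]
      · intro l _ hl; simp [hl]
    have e2 : (x : F) = ∏ l ∈ Finset.range r, (x : F) ^ ((if l = 0 then 1 else 0) * q ^ l) := by
      rw [Finset.prod_eq_single_of_mem _ hr0]
      · simp
      · intro l _ hl; simp [hl]
    have e3 : (x : F) * (x : F) ^ (∑ l ∈ Finset.range r, n l * q ^ l) =
      (∏ l ∈ Finset.range r, (x : F) ^ ((if l = 0 then 1 else 0) * q ^ l)) *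
      ∏ l ∈ Finset.range r, (x : F) ^ (n l * q ^ l) := by
      rw [← e2, Finset.prod_pow_eq_pow_sum]
    rw [e3, e1, NN, ← Finset.prod_pow, ← Finset.prod_mul_distrib, ← Finset.prod_mul_distrib,
      ← Finset.prod_mul_distrib]
    refine Finset.prod_congr rfl fun l hl => ?_
    rw [← pow_mul, ← pow_mul, ← pow_add, ← pow_add, ← pow_add, ← add_mul, add_comm (if l = 0 then 1 else 0),
      hn0 l hl]
    congr 1; ring
  rw [Finset.sum_congr rfl fun x _ => hterm x]
  have h := FiniteField.sum_pow_units F (∑ l ∈ Finset.range r, n l * q ^ l)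
  push_cast at h
  rw [h, if_neg]
  intro hdvd
  rw [hF] at hdvd
  have hsumn : ∑ l ∈ Finset.range r, n l + 1 = ∑ l ∈ Finset.range r, m l + r * (q - s) + (q - k) := by
    have := Finset.sum_congr rfl hn0
    simp only [Finset.sum_add_distrib, Finset.sum_ite_eq', hr0, hrr, if_true, Finset.sum_const,
      Finset.card_range, smul_eq_mul] at this
    exact this
  have hmod : ∀ l ∈ Finset.range r, n (l % r) = n l := fun l hl => by
    rw [Nat.mod_eq_of_lt (Finset.mem_range.1 hl)]
  have hd := digit (q := q) (r := r) (by omega) (by omega) (fun i => n (i % r))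
    (fun i => by simp) (by
      have h1 : 0 < n (r - 1) := by
        have := hn0 (r - 1) hrr
        simp only [if_true, show ¬ (r - 1 = 0) by omega, if_false] at this
        omega
      refine Finset.sum_pos' (fun _ _ => Nat.zero_le _) ⟨r - 1, hrr, ?_⟩
      simp only [hmod _ hrr]
      exact Nat.mul_pos h1 (pow_pos (by omega) _)) (by
      rw [Finset.sum_congr rfl fun l hl => by rw [hmod l hl]]; exact hdvd) (by
      rw [Finset.sum_congr rfl fun l hl => hmod l hl]
      obtain ⟨t, rfl⟩ : ∃ t, q = s + t := ⟨q - s, by omega⟩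
      obtain ⟨w, rfl⟩ : ∃ w, r = k + 1 + w := ⟨r - k - 1, by omega⟩
      obtain ⟨s', rfl⟩ : ∃ s', s = s' + 1 := ⟨s - 1, by omega⟩
      obtain ⟨v, hv⟩ : ∃ v, s' + 1 + t = k + v := ⟨s' + 1 + t - k, by omega⟩
      rw [show s' + 1 + t - (s' + 1) = t by omega, show s' + 1 + t - k = v by omega] at hsumn
      rw [show s' + 1 + t - 1 = s' + t by omega]
      have : 1 ≤ s' := by omega
      nlinarith)
  have h0 := hd 0 (by omega)
  have h1 := hd 1 (by omega)
  rw [hmod 0 hr0] at h0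
  rw [hmod 1 (Finset.mem_range.2 (by omega))] at h1
  have g0 := hn0 0 hr0
  have g1 := hn0 1 (Finset.mem_range.2 (by omega))
  simp only [if_true, show ¬ (0 = r - 1) by omega, if_false] at g0
  simp only [show ¬ (1 = r - 1) by omega, if_false, one_ne_zero] at g1
  apply hne
  omega

open MvPolynomial in
lemma Lam_zero (hF : Fintype.card F = q ^ r) (hr : 3 ≤ r) {k s : ℕ} (hk : k < r) (hkq : k < q)
    (hs : 2 ≤ s) (hsq : s ≤ q) (P : MvPolynomial (Fin r) F) (hP : P.totalDegree ≤ k * s)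
    (hsm : s < q ∨ ∀ n ∈ P.support, 1 ≤ n ⟨0, by omega⟩)
    (hne : ∀ n : Fin r →₀ ℕ, n ⟨0, by omega⟩ = s → n ⟨1, by omega⟩ = s - 1 → MvPolynomial.coeff n P = 0) :
    ∑ x : Fˣ, ((x : F)⁻¹ * (x : F) ^ (q ^ (r - 1) * (q - k)) * (NN q r (x : F)) ^ (q - s) *
      MvPolynomial.eval (fun l : Fin r => (x : F) ^ q ^ (l : ℕ)) P) = 0 := by
  simp only [MvPolynomial.eval_eq', Finset.mul_sum]
  rw [Finset.sum_comm]
  refine Finset.sum_eq_zero fun n hn => ?_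
  set m : ℕ → ℕ := fun l => if h : l < r then n ⟨l, h⟩ else 0 with hm
  have hml : ∀ l : Fin r, n l = m l := fun l => by simp [hm]
  have e : ∀ x : Fˣ, ∏ l : Fin r, ((x : F) ^ q ^ (l : ℕ)) ^ n l = ∏ l ∈ Finset.range r, ((x : F) ^ q ^ l) ^ m l := by
    intro x
    rw [Finset.prod_range]
    exact Finset.prod_congr rfl fun l _ => by rw [hml]
  have := mono_zero (F := F) hF hr hk hkq hs hsq m (by
    have h1 := (MvPolynomial.le_totalDegree hn).trans hP
    rw [Finsupp.sum_fintype _ _ (fun _ => rfl)] at h1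
    rw [Finset.sum_range]
    simpa only [hml] using h1) (by
    rcases hsm with h | h
    · exact Or.inl h
    · right; have := h n hn; rw [hml] at this; exact this) (by
    rintro ⟨h0, h1⟩
    refine (MvPolynomial.mem_support_iff.1 hn) (hne n ?_ ?_)
    · rw [hml]; exact h0
    · rw [hml]; exact h1)
  rw [← mul_zero (MvPolynomial.coeff n P), ← this, Finset.mul_sum]
  refine Finset.sum_congr rfl fun x _ => ?_
  rw [e]; ring

end mono
end NT
end

section
open Polynomial

namespace NT

section tt
variable {F : Type*} [Field F] {p m q r : ℕ} [ExpChar F p]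

noncomputable def TTp (q r k : ℕ) (f : F[X]) : MvPolynomial (Fin r) F :=
  ∑ i : Fin r, ∑ j ∈ Finset.range (k + 1), MvPolynomial.C (f.coeff j ^ q ^ (i : ℕ)) * MvPolynomial.X i ^ j

omit [ExpChar F p] in
lemma totalDegree_TTp (q r k : ℕ) (f : F[X]) : (TTp q r k f).totalDegree ≤ k := by
  refine MvPolynomial.totalDegree_finsetSum_le fun i _ => MvPolynomial.totalDegree_finsetSum_le fun j hj => ?_
  refine (MvPolynomial.totalDegree_mul _ _).trans ?_
  rw [MvPolynomial.totalDegree_C, MvPolynomial.totalDegree_X_pow, zero_add]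
  exact Nat.lt_succ_iff.1 (Finset.mem_range.1 hj)

lemma eval_TTp (hq : q = p ^ m) {k : ℕ} {f : F[X]} (hf : f.natDegree ≤ k) (x : F) :
    MvPolynomial.eval (fun l : Fin r => x ^ q ^ (l : ℕ)) (TTp q r k f) = TR q r (f.eval x) := by
  rw [TTp, TR, Finset.sum_range, map_sum]
  refine Finset.sum_congr rfl fun i _ => ?_
  rw [eval_eq_sum_range' (Nat.lt_succ_iff.2 hf), ← psi_apply hq, map_sum, map_sum]
  refine Finset.sum_congr rfl fun j _ => ?_
  simp only [map_mul, map_pow, MvPolynomial.eval_C, MvPolynomial.eval_X, psi_apply hq]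
  rw [mul_pow, pow_right_comm]

omit [ExpChar F p] in
lemma eval_Eu_TTp (hr : 0 < r) {k : ℕ} {f : F[X]} (hf : f.natDegree ≤ k) (x : F) :
    MvPolynomial.eval (fun l : Fin r => x ^ q ^ (l : ℕ)) (Eu ⟨0, hr⟩ (TTp q r k f)) =
      x * (derivative f).eval x := by
  rw [Eu, TTp, map_mul, MvPolynomial.eval_X]
  simp only [pow_zero, pow_one]
  congr 1
  rw [map_sum, map_sum, Finset.sum_eq_single (⟨0, hr⟩ : Fin r)]
  · rw [derivative_eval, sum_over_range' _ _ (k + 1) (Nat.lt_succ_iff.2 hf), map_sum, map_sum]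
    · refine Finset.sum_congr rfl fun j _ => ?_
      simp [Derivation.leibniz_pow]
      ring
    · simp
  · intro i _ hi
    rw [map_sum, map_sum]
    refine Finset.sum_eq_zero fun j _ => ?_
    simp [Derivation.leibniz_pow, MvPolynomial.pderiv_X_of_ne hi]
  · simp

end tt

lemma ident {F : Type*} [Field F] {q : ℕ} (hq : 2 ≤ q) {N T y : F} (hT : T ^ q = T) (hN : N ^ (q - 1) = 1)
    (h : N = T → N = y) :
    T * N ^ (q - 1) + ∑ t ∈ Finset.range (q - 2), N ^ (q - (t + 2)) * (T ^ (t + 2) - y * T ^ (t + 1))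
      - y * T ^ (q - 1) = 0 := by
  obtain ⟨u, rfl⟩ : ∃ u, q = u + 2 := ⟨q - 2, by omega⟩
  simp only [Nat.add_sub_cancel, show u + 2 - 1 = u + 1 by omega] at *
  have hZ : T * (∑ t ∈ Finset.range (u + 1), T ^ t * N ^ (u - t)) * (N - y) = 0 := by
    have h1 := (Commute.all T N).geom_sum₂_mul (u + 1)
    simp only [Nat.add_sub_cancel] at h1
    by_cases hTN : T = N
    · rw [← h hTN.symm]; simp
    · have h2 : T * (∑ t ∈ Finset.range (u + 1), T ^ t * N ^ (u - t)) * (T - N) = 0 := by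
        rw [mul_assoc, h1, hN, mul_sub, ← pow_succ', hT]; ring
      rcases mul_eq_zero.1 h2 with h3 | h3
      · rw [h3, zero_mul]
      · exact absurd (sub_eq_zero.1 h3) hTN
  rw [mul_sub, mul_assoc, mul_assoc, Finset.sum_mul, Finset.sum_mul] at hZ
  rw [Finset.sum_range_succ', Finset.sum_range_succ] at hZ
  rw [← hZ]
  simp only [mul_add, Finset.mul_sum, mul_sub, Finset.sum_sub_distrib, Nat.sub_self, pow_zero, Nat.sub_zero]
  have e1 : ∑ t ∈ Finset.range u, N ^ (u + 2 - (t + 2)) * T ^ (t + 2) =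
     ∑ t ∈ Finset.range u, T * (T ^ (t + 1) * N ^ (u - (t + 1)) * N) := by
    refine Finset.sum_congr rfl fun t ht => ?_
    have : u + 2 - (t + 2) = u - (t + 1) + 1 := by have := Finset.mem_range.1 ht; omega
    rw [this]; ring
  have e2 : ∑ t ∈ Finset.range u, N ^ (u + 2 - (t + 2)) * (y * T ^ (t + 1)) =
     ∑ t ∈ Finset.range u, T * (T ^ t * N ^ (u - t) * y) := by
    refine Finset.sum_congr rfl fun t ht => ?_
    have : u + 2 - (t + 2) = u - t := by omega
    rw [this]; ring
  rw [e1, e2]; ring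

section case3
variable {F : Type*} [Field F] [Fintype F] [DecidableEq F] {p m q r : ℕ} [ExpChar F p]

lemma s_one (hq : q = p ^ m) (hq1 : 1 < q) (hr : 3 ≤ r) (hF : Fintype.card F = q ^ r)
    {k : ℕ} (hk : 0 < k) (hkq : k < q) {f : F[X]} (hf : f.natDegree ≤ k) :
    ∑ x : Fˣ, ((x : F)⁻¹ * (x : F) ^ (q ^ (r - 1) * (q - k)) * TR q r (f.eval (x : F))) =
      - (f.coeff k) ^ q ^ (r - 1) := by
  have hqr : q ^ r = q ^ (r - 1) * q := by rw [← pow_succ]; congr 1; omega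
  have hle : ∀ i ∈ Finset.range r, q ^ i ≤ q ^ (r - 1) := by
    intro i hi
    rw [Finset.mem_range] at hi
    exact Nat.pow_le_pow_right (by omega) (by omega)
  have e : ∀ x : Fˣ, ((x : F)⁻¹ * (x : F) ^ (q ^ (r - 1) * (q - k)) * TR q r (f.eval (x : F))) =
     ∑ i ∈ Finset.range r, ∑ j ∈ Finset.range (k + 1),
      (f.coeff j) ^ q ^ i * (x : F) ^ (q ^ (r - 1) * (q - k) - 1 + q ^ i * j) := by
    intro x
    have hpos : 0 < q ^ (r - 1) * (q - k) := Nat.mul_pos (pow_pos (by omega) _) (by omega)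
    have h1 : (x : F)⁻¹ * (x : F) ^ (q ^ (r - 1) * (q - k)) = (x : F) ^ (q ^ (r - 1) * (q - k) - 1) := by
      rw [inv_mul_eq_iff_eq_mul₀ x.ne_zero, ← pow_succ']
      congr 1; omega
    rw [h1, TR, Finset.mul_sum]
    refine Finset.sum_congr rfl fun i _ => ?_
    rw [eval_eq_sum_range' (Nat.lt_succ_iff.2 hf), ← psi_apply hq, map_sum, Finset.mul_sum]
    refine Finset.sum_congr rfl fun j _ => ?_
    rw [map_mul, map_pow, psi_apply hq, psi_apply hq, pow_add, pow_mul]; ring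
  rw [Finset.sum_congr rfl fun x _ => e x, Finset.sum_comm, Finset.sum_eq_single (r - 1)]
  · rw [Finset.sum_comm, Finset.sum_eq_single k]
    · rw [← Finset.mul_sum, FiniteField.sum_pow_units, if_pos]
      · ring
      · rw [hF, hqr]
        apply dvd_of_eq
        have : q ^ (r - 1) * q = q ^ (r - 1) * (q - k) + q ^ (r - 1) * k := by
          rw [← mul_add]; congr 1; omega
        have hpos : 0 < q ^ (r - 1) * (q - k) := Nat.mul_pos (pow_pos (by omega) _) (by omega)
        omega
    · intro j hj hjk
      have hj := Finset.mem_range.1 hj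
      rw [← Finset.mul_sum, FiniteField.sum_pow_units, if_neg, mul_zero]
      intro hdvd
      rw [hF, hqr] at hdvd
      have h0 : 1 < q ^ (r - 1) := Nat.one_lt_pow (by omega) hq1
      have h1 : q ^ (r - 1) * q = q ^ (r - 1) * (q - k) + q ^ (r - 1) * k := by
          rw [← mul_add]; congr 1; omega
      have h2 : q ^ (r - 1) * j + q ^ (r - 1) ≤ q ^ (r - 1) * k := by
        rw [← Nat.mul_succ]; exact Nat.mul_le_mul_left _ (by omega)
      have h3 : q ^ (r - 1) * 1 ≤ q ^ (r - 1) * (q - k) := Nat.mul_le_mul_left _ (by omega)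
      have := Nat.le_of_dvd (by omega) hdvd
      omega
    · intro h; exact (h (Finset.mem_range.2 (by omega))).elim
  · intro i hi hir
    rw [Finset.sum_comm]
    refine Finset.sum_eq_zero fun j hj => ?_
    have hi := Finset.mem_range.1 hi
    have hj := Finset.mem_range.1 hj
    rw [← Finset.mul_sum, FiniteField.sum_pow_units, if_neg, mul_zero]
    intro hdvd
    rw [hF, hqr] at hdvd
    have h0 : 1 < q ^ (r - 1) := Nat.one_lt_pow (by omega) hq1
    have h1 : q ^ (r - 1) * q = q ^ (r - 1) * (q - k) + q ^ (r - 1) * k := by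
        rw [← mul_add]; congr 1; omega
    have h2 : q ^ i * j < q ^ (r - 1) * k := by
      have a1 : q ^ (i + 1) ≤ q ^ (r - 1) := Nat.pow_le_pow_right (by omega) (by omega)
      have a2 : q ^ i < q ^ (i + 1) := Nat.pow_lt_pow_right hq1 (by omega)
      calc q ^ i * j ≤ q ^ i * k := Nat.mul_le_mul_left _ (by omega)
        _ < q ^ (r - 1) * k := Nat.mul_lt_mul_of_pos_right (by omega) hk
    have h3 : q ^ (r - 1) * 1 ≤ q ^ (r - 1) * (q - k) := Nat.mul_le_mul_left _ (by omega)
    have := Nat.le_of_dvd (by omega) hdvd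
    omega
  · intro h; exact (h (Finset.mem_range.2 (by omega))).elim

lemma case_iii (hq : q = p ^ m) (hp : p.Prime) (hm : 0 < m) (hr : 3 ≤ r) (hF : Fintype.card F = q ^ r)
    {k : ℕ} (hk : 0 < k) (hkr : k < r) (hrq : r < q) {f : F[X]} (hf : f.natDegree = k) :
    ∃ x : F, x ≠ 0 ∧ NN q r x = TR q r (f.eval x) ∧ NN q r x ≠ x * (derivative f).eval x := by
  by_contra hcon
  push Not at hcon
  have hq0 : (q : F) = 0 := by
    have : CharP F p := by
      rcases ‹ExpChar F p› with _ | h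
      · exact absurd hp (by norm_num)
      · assumption
    rw [hq, Nat.cast_pow, CharP.cast_eq_zero, zero_pow hm.ne']
  set T := TTp q r k f with hT
  set i0 : Fin r := ⟨0, by omega⟩ with hi0
  set i1 : Fin r := ⟨1, by omega⟩ with hi1
  have hTd : T.totalDegree ≤ k := totalDegree_TTp q r k f
  have hEd : (Eu i0 T).totalDegree ≤ k := (totalDegree_Eu _ _).trans hTd
  have hpd : ∀ n, (T ^ n).totalDegree ≤ k * n := fun n => by
    refine (MvPolynomial.totalDegree_pow _ _).trans ?_
    rw [mul_comm]; exact Nat.mul_le_mul_right _ hTd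
  have hEp : ∀ n, (Eu i0 T * T ^ n).totalDegree ≤ k * (n + 1) := fun n => by
    refine (MvPolynomial.totalDegree_mul _ _).trans ?_
    have := hpd n
    rw [mul_add]; omega
  have hL1 : ∀ t ∈ Finset.range (q - 2), _ := fun t ht =>
    Lam_zero (F := F) hF hr hkr (by omega) (s := t + 2) (by omega)
      (by have := Finset.mem_range.1 ht; omega) (T ^ (t + 2) - Eu i0 T * T ^ (t + 1))
      ((MvPolynomial.totalDegree_sub _ _).trans (max_le (hpd _) (hEp _)))
      (Or.inl (by have := Finset.mem_range.1 ht; omega))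
      (fun n h0 h1 => coeff_cancel (i := i0) (j := i1) T (t + 1) n h0 h1)
  have hL2 := Lam_zero (F := F) hF hr hkr (by omega) (s := q) (by omega) le_rfl (Eu i0 T * T ^ (q - 1))
      (by have := hEp (q - 1); rwa [Nat.sub_add_cancel (by omega)] at this)
      (Or.inr (by
        intro n hn
        rw [Eu, mul_assoc, MvPolynomial.mem_support_iff, MvPolynomial.coeff_X_mul'] at hn
        have : i0 ∈ n.support := by
          by_contra h; simp [h] at hn
        rw [Finsupp.mem_support_iff] at this
        exact Nat.one_le_iff_ne_zero.2 this))
      (fun n h0 h1 => coeff_cancel2 (i := i0) (j := i1) T (q - 1) n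
        (by rw [Nat.sub_add_cancel (by omega)]; exact hq0) (by rw [Nat.sub_add_cancel (by omega)]; exact h0) h1)
  have hS1 := s_one (F := F) hq (by omega) hr hF hk (by omega) hf.le
  have key : ∀ x : Fˣ, (x : F)⁻¹ * (x : F) ^ (q ^ (r - 1) * (q - k)) * TR q r (f.eval (x : F)) +
      ∑ t ∈ Finset.range (q - 2), ((x : F)⁻¹ * (x : F) ^ (q ^ (r - 1) * (q - k)) * (NN q r (x : F)) ^ (q - (t + 2)) *
      MvPolynomial.eval (fun l : Fin r => (x : F) ^ q ^ (l : ℕ)) (T ^ (t + 2) - Eu i0 T * T ^ (t + 1))) -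
      ((x : F)⁻¹ * (x : F) ^ (q ^ (r - 1) * (q - k)) * (NN q r (x : F)) ^ (q - q) *
      MvPolynomial.eval (fun l : Fin r => (x : F) ^ q ^ (l : ℕ)) (Eu i0 T * T ^ (q - 1))) = 0 := by
    intro x
    have hx : (x : F) ≠ 0 := x.ne_zero
    have hN1 : NN q r (x : F) ^ (q - 1) = 1 := by
      have h := NN_pow hF (x : F)
      have hN0 := NN_ne_zero (q := q) (r := r) hx
      apply mul_left_cancel₀ hN0
      rw [← pow_succ', Nat.sub_add_cancel (by omega), h, mul_one]
    have h := ident (q := q) (by omega) (TR_pow (r := r) hq hF (f.eval (x : F))) hN1 (hcon (x : F) hx)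
    have h' := congrArg (fun z => (x : F)⁻¹ * (x : F) ^ (q ^ (r - 1) * (q - k)) * z) h
    simp only [mul_zero] at h'
    rw [← h', mul_sub, mul_add, hN1, mul_one, Finset.mul_sum]
    simp only [map_sub, map_mul, map_pow, hT, hi0, eval_TTp hq hf.le, eval_Eu_TTp _ hf.le, Nat.sub_self,
      pow_zero, mul_one]
    congr 2
    refine Finset.sum_congr rfl fun t _ => ?_
    ring
  have hsum := Finset.sum_congr rfl (fun x (_ : x ∈ (Finset.univ : Finset Fˣ)) => key x)
  rw [Finset.sum_sub_distrib, Finset.sum_add_distrib, hS1, hL2, Finset.sum_comm,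
    Finset.sum_eq_zero hL1] at hsum
  simp only [Finset.sum_const_zero, add_zero, sub_zero, neg_eq_zero] at hsum
  have : f.coeff k = 0 := (pow_eq_zero_iff (pow_pos (by omega) _).ne').1 hsum
  rw [← hf, coeff_natDegree, leadingCoeff_eq_zero] at this
  rw [this, natDegree_zero] at hf
  omega

end case3
end NT
end

section
open Polynomial

namespace NT

lemma final_num {q r d k s : ℕ} (hq : 0 < q) (hr : 2 ≤ r) (hd : 1 ≤ d)
    (hbound : (q : ℝ) ^ (r - 1) -
        ((d : ℝ) - 1) * ((d : ℝ) - 2) * (q : ℝ) ^ ((r : ℝ) - 3 / 2) -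
        5 * (d : ℝ) ^ ((13 : ℝ) / 3) * (q : ℝ) ^ (r - 2) > (k : ℝ))
    (hS : (q : ℝ) ^ r * ((q : ℝ) - ((d : ℝ) - 1) * (d - 2) * Real.sqrt q - (d : ℝ) ^ 4 - 2 * d) ≤
      q * (q - 1) * s) : k < s := by
  have hq0 : (0 : ℝ) < q := by exact_mod_cast hq
  have hd1 : (1 : ℝ) ≤ d := by exact_mod_cast hd
  have e1 : (q : ℝ) ^ (r - 1) = (q : ℝ) ^ (r - 2) * q := by
    rw [← pow_succ]; congr 1; omega
  have e2 : (q : ℝ) ^ r = (q : ℝ) ^ (r - 2) * q ^ 2 := by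
    rw [← pow_add]; congr 1; omega
  have e3 : (q : ℝ) ^ ((r : ℝ) - 3 / 2) = (q : ℝ) ^ (r - 2) * Real.sqrt q := by
    rw [Real.sqrt_eq_rpow, ← Real.rpow_natCast, ← Real.rpow_add hq0, Nat.cast_sub hr]
    congr 1; push_cast; ring
  have e4 : (d : ℝ) ^ 4 ≤ (d : ℝ) ^ ((13 : ℝ) / 3) := by
    rw [← Real.rpow_natCast]
    exact Real.rpow_le_rpow_of_exponent_le hd1 (by norm_num)
  have e5 : (d : ℝ) ≤ (d : ℝ) ^ 4 := le_self_pow₀ hd1 (by norm_num)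
  by_contra hcon
  have hsk : (s : ℝ) ≤ k := by exact_mod_cast not_lt.1 hcon
  rw [e1, e3] at hbound
  rw [e2] at hS
  set Q := (q : ℝ) ^ (r - 2) with hQ
  have hQ0 : 0 < Q := pow_pos hq0 _
  set W := (d : ℝ) ^ ((13 : ℝ) / 3) with hW
  set M := (q : ℝ) - ((d : ℝ) - 1) * (d - 2) * Real.sqrt q - (d : ℝ) ^ 4 - 2 * d with hM
  have h1 : (k : ℝ) < Q * M := by
    have : Q * ((q : ℝ) - ((d : ℝ) - 1) * (d - 2) * Real.sqrt q - 5 * W) ≤ Q * M :=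
      mul_le_mul_of_nonneg_left (by rw [hM]; nlinarith) hQ0.le
    nlinarith
  have h2 : (q : ℝ) * (q - 1) * s ≤ q ^ 2 * k := by
    have hs0 : (0 : ℝ) ≤ s := Nat.cast_nonneg s
    have : (q : ℝ) * (q - 1) * s ≤ q ^ 2 * s := mul_le_mul_of_nonneg_right (by nlinarith) hs0
    have : (q : ℝ) ^ 2 * s ≤ q ^ 2 * k := mul_le_mul_of_nonneg_left hsk (by positivity)
    linarith
  have h3 : (q : ℝ) ^ 2 * k < q ^ 2 * (Q * M) := mul_lt_mul_of_pos_left h1 (by positivity)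
  nlinarith

end NT


end

theorem stmt_18 (p m r k : ℕ) (hp : p.Prime) (hm : 0 < m) (hr : 2 ≤ r)
    (q : ℕ) (hq : q = p ^ m) (hk1 : 1 ≤ k) (hk2 : k < q ^ (2 * r - 1))
    (F : Type) [Field F] [Fintype F] (hF : Fintype.card F = q ^ r)
    (fbar : Polynomial F) (kbar : ℕ) (hkbar : fbar.natDegree = kbar)
    (hkbar1 : 1 ≤ kbar) (hkbark : kbar ≤ k)
    (dbar : ℕ) (hdbar : dbar = max kbar r)
    (hcase : (kbar > r ∧ 3 ≤ r ∧ ¬ p ∣ kbar) ∨ (kbar = r ∧ 4 ≤ r) ∨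
      (0 < kbar ∧ kbar < r ∧ 3 ≤ r))
    (hq2 : q > 2 * r * dbar ^ 2)
    (hbound : (q : ℝ) ^ (r - 1) -
        ((dbar : ℝ) - 1) * ((dbar : ℝ) - 2) * (q : ℝ) ^ ((r : ℝ) - 3 / 2) -
        5 * (dbar : ℝ) ^ ((13 : ℝ) / 3) * (q : ℝ) ^ (r - 2) > (k : ℝ)) :
    ∀ (b : F) (g : Polynomial F), g.natDegree ≤ k →
      (∀ x y : F, x ^ ((q ^ r - 1) / (q - 1)) = ∑ i ∈ Finset.range r, y ^ q ^ i →
        b * y - g.eval x ≠ 0 → y - fbar.eval x ≠ 0) →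
      ∃ l : F, ∀ x y : F, x ^ ((q ^ r - 1) / (q - 1)) = ∑ i ∈ Finset.range r, y ^ q ^ i →
        b * y - g.eval x = l * (y - fbar.eval x) := by
  classical
  have hq1 : 1 < q := by rw [hq]; exact Nat.one_lt_pow hm.ne' hp.one_lt
  have hFp : Fact p.Prime := ⟨hp⟩
  have hchar : CharP F p := charP_of_card_eq_prime_pow (f := m * r) (by
    rw [hF, hq, pow_mul])
  have hexp : ExpChar F p := ExpChar.prime hp
  have hexpK : ExpChar (AlgebraicClosure F) p :=
    expChar_of_injective_algebraMap (algebraMap F (AlgebraicClosure F)).injective p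
  have hA : (NT.AF F q).card = q := (NT.Fq_facts (K := AlgebraicClosure F) hq hp hm hF).2.2
  have hrd : r ≤ dbar := by rw [hdbar]; exact le_max_right _ _
  have hkd : kbar ≤ dbar := by rw [hdbar]; exact le_max_left _ _
  have hdq : dbar + 1 < q := by nlinarith
  have hfd : fbar.natDegree ≤ dbar := by omega
  have hlead : fbar.coeff kbar ≠ 0 := by
    rw [← hkbar, Polynomial.coeff_natDegree, Ne, Polynomial.leadingCoeff_eq_zero]
    intro h; rw [h, Polynomial.natDegree_zero] at hkbar; omega
  have hS : (q : ℝ) ^ r * ((q : ℝ) - ((dbar : ℝ) - 1) * (dbar - 2) * Real.sqrt q - (dbar : ℝ) ^ 4 - 2 * dbar) ≤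
      q * (q - 1) * (NT.SS q r fbar).card := by
    rcases hcase with ⟨h1, h2, h3⟩ | ⟨h1, h2⟩ | ⟨h1, h2, h3⟩
    · have hd : dbar = kbar := by rw [hdbar]; exact max_eq_left h1.le
      rw [← hd] at hlead h3 h1
      obtain ⟨x, hx, hx0⟩ := NT.case_i hq hq1 h2 hF hA (k := dbar) (by omega) hq2 hlead
      refine NT.bound_inf hq hp hm hF hr hrd hdq hfd hx hlead ?_ ?_
      · rw [if_neg h1.ne', hx0]
      · rw [if_neg h1.ne']
        have : (dbar : F) ≠ 0 := by rwa [Ne, CharP.cast_eq_zero_iff F p]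
        exact (mul_ne_zero (mul_ne_zero this hlead) (pow_ne_zero _ hx)).symm
    · have hd : dbar = r := by rw [hdbar, h1, max_self]
      rw [h1] at hlead
      rw [hd] at hq2 hdq hfd ⊢
      obtain ⟨x, hx, hx0, hx1⟩ := NT.case_ii hq hq1 h2 hF hA hq2 hlead
      refine NT.bound_inf hq hp hm hF hr le_rfl hdq hfd hx hlead ?_ ?_
      · rw [if_pos rfl, hx0]
      · rwa [if_pos rfl]
    · have hd : dbar = r := by rw [hdbar]; exact max_eq_right h2.le
      rw [hd] at hq2 hdq hfd ⊢
      obtain ⟨x, hx, hx0, hx1⟩ := NT.case_iii hq hp hm h3 hF h1 h2 (by omega) hkbar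
      exact NT.bound_affine hq hp hm hF hr hdq hfd hx hx0 hx1
  have hcard : k < (NT.SS q r fbar).card := NT.final_num (by omega) hr (by omega) hbound hS
  intro b g hg hsup
  have hgeom : (q ^ r - 1) / (q - 1) = ∑ i ∈ Finset.range r, q ^ i :=
    (Nat.geomSum_eq (by omega) r).symm
  have hg2 : g = Polynomial.C b * fbar := by
    rw [← sub_eq_zero]
    by_contra hne
    have hdeg : (g - Polynomial.C b * fbar).natDegree ≤ k :=
      (Polynomial.natDegree_sub_le _ _).trans
        (max_le hg ((Polynomial.natDegree_C_mul_le _ _).trans (by omega)))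
    have hsub : (NT.SS q r fbar) ⊆ (g - Polynomial.C b * fbar).roots.toFinset := by
      intro x hx
      rw [NT.SS, Finset.mem_filter] at hx
      rw [Multiset.mem_toFinset, Polynomial.mem_roots hne, Polynomial.IsRoot.def]
      by_contra h
      refine hsup x (fbar.eval x) ?_ ?_ (sub_self _)
      · rw [hgeom, ← Finset.prod_pow_eq_pow_sum]; exact hx.2
      · intro h'
        apply h
        rw [Polynomial.eval_sub, Polynomial.eval_mul, Polynomial.eval_C]
        linear_combination -h'
    have := (Finset.card_le_card hsub).trans ((Multiset.toFinset_card_le _).trans (Polynomial.card_roots' _))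
    omega
  refine ⟨b, fun x y _ => ?_⟩
  rw [hg2, Polynomial.eval_mul, Polynomial.eval_C]
  ring
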